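/- Let s = k+1+ρ for an integer k ≥ 0 and ρ ∈ (0,1]. Suppose Assumption (A) holds, the covariance matrix Σ of ξ satisfies ‖Σ‖ ≤ c_0, and d ≤ c_1·n^α for some α ∈ (0,1). Then there is a constant C depending only on L, M, m, s, α, c_0, c_1 such that sup over f with ‖f‖_{C^s} ≤ 1 and sup over θ ∈ ℝ^d of ‖f_k(θ̂) − f(θ)‖_{L_2(P_θ)} is at most C·( (1/√n ∨ (√(d/n))^s) ∧ 1 ). -/

import Mathlib

open MeasureTheory Real
open scoped RealInnerProductSpace BigOperators ENNReal NNReal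

noncomputable section

abbrev Euc (d : ℕ) : Type := EuclideanSpace ℝ (Fin d)

/-- The noise distribution with density `e^{-V(x)}` w.r.t. Lebesgue measure. -/
def noiseMeasure {d : ℕ} (V : Euc d → ℝ) : Measure (Euc d) :=
  MeasureTheory.volume.withDensity fun x => ENNReal.ofReal (Real.exp (-(V x)))

/-- The joint distribution of an i.i.d. sample `X_1, …, X_n` from `P_θ(dx) = e^{-V(x-θ)}dx`. -/
def sampleMeasure {d : ℕ} (V : Euc d → ℝ) (n : ℕ) (θ : Euc d) : Measure (Fin n → Euc d) :=
  Measure.pi fun _ => (noiseMeasure V).map (fun x => θ + x)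

/-- `ψ_α`-norm of a random variable: `sup_{p ≥ 1} p^{-1/α} (E|η|^p)^{1/p}`. -/
def psiNorm {Ω : Type*} [MeasurableSpace Ω] (α : ℝ) (μ : Measure Ω) (η : Ω → ℝ) : ℝ :=
  ⨆ p : {p : ℝ // 1 ≤ p}, (p : ℝ) ^ (-(1 / α)) * (∫ ω, |η ω| ^ (p : ℝ) ∂μ) ^ ((1 : ℝ) / (p : ℝ))

/-- `f` belongs to the Hölder ball of radius `B` in `C^s`, `s = l + ρ`. -/
def holderCLe {d : ℕ} (l : ℕ) (ρ : ℝ) (f : Euc d → ℝ) (B : ℝ) : Prop :=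
  ContDiff ℝ l f ∧
  (∀ j : ℕ, j ≤ l → ∀ x, ‖iteratedFDeriv ℝ j f x‖ ≤ B) ∧
  (∀ x y, ‖iteratedFDeriv ℝ l f x - iteratedFDeriv ℝ l f y‖ ≤ B * ‖x - y‖ ^ ρ)

/-- The operator `(T g)(θ) = E_θ g(θ̂)`. -/
def Texp {d : ℕ} (V : Euc d → ℝ) (n : ℕ) (hatθ : (Fin n → Euc d) → Euc d) (g : Euc d → ℝ) :
    Euc d → ℝ :=
  fun θ => ∫ x, g (hatθ x) ∂ sampleMeasure V n θ

/-- The operator `𝓑 = 𝓣 - Id`. -/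
def Bop {d : ℕ} (V : Euc d → ℝ) (n : ℕ) (hatθ : (Fin n → Euc d) → Euc d) :
    (Euc d → ℝ) → Euc d → ℝ :=
  fun g θ => Texp V n hatθ g θ - g θ

/-- The bias-corrected functional `f_k = Σ_{j=0}^k (-1)^j 𝓑^j f`. -/
def biasCorrect {d : ℕ} (V : Euc d → ℝ) (n : ℕ) (hatθ : (Fin n → Euc d) → Euc d) (k : ℕ)
    (f : Euc d → ℝ) : Euc d → ℝ :=
  fun θ => ∑ j ∈ Finset.range (k + 1), (-1 : ℝ) ^ j * (Bop V n hatθ)^[j] f θ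

/-- The Poincaré constant `c(V)` of the distribution `e^{-V(x)}dx`. -/
def poincareConst {d : ℕ} (V : Euc d → ℝ) : ℝ :=
  sInf {C : ℝ | 0 ≤ C ∧ ∀ g : Euc d → ℝ, LocallyLipschitz g →
    ∫ x, (g x - ∫ y, g y ∂ noiseMeasure V) ^ 2 ∂ noiseMeasure V ≤
      C * ∫ x, ‖gradient g x‖ ^ 2 ∂ noiseMeasure V}

/-- The standing assumptions on the potential `V` of a log-concave location family. -/
structure IsRegularPotential (L M m : ℝ) {d : ℕ} (V : Euc d → ℝ) : Prop where
  L_pos : 0 < L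
  M_pos : 0 < M
  m_pos : 0 < m
  strictConvexOn : StrictConvexOn ℝ Set.univ V
  contDiff : ContDiff ℝ 2 V
  integral_eq_one : ∫ x, Real.exp (-(V x)) = 1
  norm_le : ∀ x, ‖iteratedFDeriv ℝ 2 V x‖ ≤ M
  norm_sub_le : ∀ x y, ‖iteratedFDeriv ℝ 2 V x - iteratedFDeriv ℝ 2 V y‖ ≤ L * ‖x - y‖
  fisher : ∀ u, m * ‖u‖ ^ 2 ≤ ⟪∫ x, ⟪gradient V x, u⟫ • gradient V x ∂ noiseMeasure V, u⟫

/-- The Hessian of `V` as the derivative of its gradient. -/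
def hess {d : ℕ} (V : Euc d → ℝ) (x : Euc d) : Euc d →L[ℝ] Euc d := fderiv ℝ (gradient V) x

/-- The Riesz identification of functionals with vectors, as a real-linear isometry. -/
def rieszIsometry (d : ℕ) : StrongDual ℝ (Euc d) →ₗᵢ[ℝ] Euc d where
  toFun := (InnerProductSpace.toDual ℝ (Euc d)).symm
  map_add' := by simp
  map_smul' := by simp
  norm_map' := by simp

theorem ContinuousLinearMap.opNorm_le_of_inner_le {E : Type*} [NormedAddCommGroup E]
    [InnerProductSpace ℝ E] (A : E →L[ℝ] E) {K : ℝ} (hK : 0 ≤ K)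
    (hA : ∀ u v, ⟪A u, v⟫ ≤ K * ‖u‖ * ‖v‖) : ‖A‖ ≤ K := by
  refine A.opNorm_le_bound hK fun u => ?_
  have h1 := hA u (A u)
  rw [real_inner_self_eq_norm_sq] at h1
  rcases (norm_nonneg (A u)).eq_or_lt with h0 | h0
  · rw [← h0]; positivity
  · nlinarith

theorem norm_image_sub_sub_le_of_lipschitz {E F : Type*} [NormedAddCommGroup E] [NormedSpace ℝ E]
    [NormedAddCommGroup F] [NormedSpace ℝ F] {f : E → F} {f' : E → E →L[ℝ] F} {K : ℝ}
    (hK : 0 ≤ K) (hf : ∀ x, HasFDerivAt f (f' x) x) (hl : ∀ x y, ‖f' x - f' y‖ ≤ K * ‖x - y‖)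
    (x y : E) : ‖f y - f x - f' x (y - x)‖ ≤ K * ‖y - x‖ ^ 2 := by
  have := (convex_segment x y).norm_image_sub_le_of_norm_hasFDerivWithin_le' (𝕜 := ℝ)
    (f := f) (f' := f') (φ := f' x) (C := K * ‖y - x‖)
    (fun z _ => (hf z).hasFDerivWithinAt) (fun z hz => by
      refine (hl z x).trans ?_
      gcongr
      obtain ⟨a, b, ha, hb, hab, rfl⟩ := hz
      have h1 : a • x + b • y - x = b • (y - x) := by
        have : a = 1 - b := by linarith
        subst this
        module
      rw [h1, norm_smul, Real.norm_of_nonneg hb]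
      nlinarith [norm_nonneg (y - x)])
    (left_mem_segment ℝ x y) (right_mem_segment ℝ x y)
  linarith [this, pow_two ‖y - x‖]

namespace IsRegularPotential

variable {L M m : ℝ} {d : ℕ} {V : Euc d → ℝ}

theorem differentiable (h : IsRegularPotential L M m V) : Differentiable ℝ V :=
  h.contDiff.differentiable (by norm_num)

theorem contDiff_fderiv (h : IsRegularPotential L M m V) : ContDiff ℝ 1 (fderiv ℝ V) :=
  h.contDiff.fderiv_right (by norm_num)

theorem inner_gradient (_ : IsRegularPotential L M m V) (x u : Euc d) :
    ⟪gradient V x, u⟫ = fderiv ℝ V x u := by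
  simp [gradient]

theorem hasFDerivAt_gradient_aux (h : IsRegularPotential L M m V) (x : Euc d) :
    HasFDerivAt (gradient V) ((rieszIsometry d).toContinuousLinearMap.comp
      (fderiv ℝ (fderiv ℝ V) x)) x := by
  have h1 : HasFDerivAt (fderiv ℝ V) (fderiv ℝ (fderiv ℝ V) x) x :=
    (h.contDiff_fderiv.differentiable (by norm_num) x).hasFDerivAt
  exact ((rieszIsometry d).toContinuousLinearMap.hasFDerivAt).comp x h1

theorem hasFDerivAt_gradient (h : IsRegularPotential L M m V) (x : Euc d) :
    HasFDerivAt (gradient V) (hess V x) x := (h.hasFDerivAt_gradient_aux x).differentiableAt.hasFDerivAt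

theorem inner_hess (h : IsRegularPotential L M m V) (x u v : Euc d) :
    ⟪hess V x u, v⟫ = iteratedFDeriv ℝ 2 V x ![u, v] := by
  rw [hess, (h.hasFDerivAt_gradient_aux x).fderiv, iteratedFDeriv_two_apply]
  simp [rieszIsometry]

theorem inner_hess_comm (h : IsRegularPotential L M m V) (x u v : Euc d) :
    ⟪hess V x u, v⟫ = ⟪u, hess V x v⟫ := by
  rw [real_inner_comm (hess V x v) u, h.inner_hess, h.inner_hess, iteratedFDeriv_two_apply,
    iteratedFDeriv_two_apply]
  have : IsSymmSndFDerivAt ℝ V x := h.contDiff.contDiffAt.isSymmSndFDerivAt (by simp)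
  exact this u v

theorem norm_hess_le (h : IsRegularPotential L M m V) (x : Euc d) : ‖hess V x‖ ≤ M := by
  refine ContinuousLinearMap.opNorm_le_of_inner_le _ h.M_pos.le fun u v => ?_
  rw [h.inner_hess]
  refine (le_abs_self _).trans (((iteratedFDeriv ℝ 2 V x).le_opNorm _).trans ?_)
  simp only [Fin.prod_univ_two, Matrix.cons_val_zero, Matrix.cons_val_one, ← mul_assoc]
  gcongr
  exact h.norm_le x

theorem norm_hess_sub_le (h : IsRegularPotential L M m V) (x y : Euc d) :
    ‖hess V x - hess V y‖ ≤ L * ‖x - y‖ := by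
  have hL := h.L_pos
  refine ContinuousLinearMap.opNorm_le_of_inner_le _ (by positivity) fun u v => ?_
  rw [_root_.sub_apply, inner_sub_left, h.inner_hess, h.inner_hess,
    ← _root_.sub_apply]
  refine (le_abs_self _).trans (((iteratedFDeriv ℝ 2 V x - iteratedFDeriv ℝ 2 V y).le_opNorm _).trans ?_)
  simp only [Fin.prod_univ_two, Matrix.cons_val_zero, Matrix.cons_val_one, ← mul_assoc]
  gcongr
  exact h.norm_sub_le x y

theorem norm_gradient_sub_le (h : IsRegularPotential L M m V) (x y : Euc d) :
    ‖gradient V x - gradient V y‖ ≤ M * ‖x - y‖ :=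
  convex_univ.norm_image_sub_le_of_norm_hasFDerivWithin_le (𝕜 := ℝ)
    (fun z _ => (h.hasFDerivAt_gradient z).hasFDerivWithinAt) (fun z _ => h.norm_hess_le z)
    trivial trivial

theorem norm_gradient_taylor_le (h : IsRegularPotential L M m V) (x y : Euc d) :
    ‖gradient V y - gradient V x - hess V x (y - x)‖ ≤ L * ‖y - x‖ ^ 2 :=
  norm_image_sub_sub_le_of_lipschitz h.L_pos.le h.hasFDerivAt_gradient h.norm_hess_sub_le x y

theorem taylor_le (h : IsRegularPotential L M m V) (x u : Euc d) :
    V (x - u) ≤ V x - ⟪gradient V x, u⟫ + M * ‖u‖ ^ 2 := by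
  have h1 : ∀ x y, ‖fderiv ℝ V x - fderiv ℝ V y‖ ≤ M * ‖x - y‖ := fun x y => by
    refine le_trans (le_of_eq ?_) (h.norm_gradient_sub_le x y)
    rw [gradient, gradient, ← map_sub, LinearIsometryEquiv.norm_map]
  have := norm_image_sub_sub_le_of_lipschitz h.M_pos.le (fun x => (h.differentiable x).hasFDerivAt)
    h1 x (x - u)
  rw [Real.norm_eq_abs, ← h.inner_gradient] at this
  have h2 := (abs_le.mp this).2
  simp only [sub_sub_cancel_left, inner_neg_right, norm_neg] at h2
  linarith

theorem gradient_inner_le (h : IsRegularPotential L M m V) (x y : Euc d) :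
    ⟪gradient V x, y - x⟫ ≤ V y - V x := by
  have hc : ConvexOn ℝ Set.univ (V ∘ AffineMap.lineMap (k := ℝ) x y) := by
    simpa using h.strictConvexOn.convexOn.comp_affineMap (AffineMap.lineMap (k := ℝ) x y)
  have hd : HasDerivAt (V ∘ AffineMap.lineMap (k := ℝ) x y) (fderiv ℝ V x (y - x)) 0 := by
    have h1 : HasFDerivAt V (fderiv ℝ V x) (AffineMap.lineMap (k := ℝ) x y 0) := by
      simpa using (h.differentiable x).hasFDerivAt
    exact h1.comp_hasDerivAt (0 : ℝ) AffineMap.hasDerivAt_lineMap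
  have := hc.deriv_le_slope (x := 0) (y := 1) trivial trivial one_pos hd.differentiableAt
  rw [hd.deriv] at this
  simpa [slope, h.inner_gradient] using this

theorem gradient_mono (h : IsRegularPotential L M m V) (x y : Euc d) :
    0 ≤ ⟪gradient V x - gradient V y, x - y⟫ := by
  have h1 := h.gradient_inner_le x y
  have h2 := h.gradient_inner_le y x
  rw [← neg_sub x y, inner_neg_right] at h1
  rw [inner_sub_left]
  linarith

theorem continuous_gradient (h : IsRegularPotential L M m V) : Continuous (gradient V) :=
  continuous_iff_continuousAt.2 fun x => (h.hasFDerivAt_gradient x).continuousAt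

theorem continuous_hess (h : IsRegularPotential L M m V) : Continuous (hess V) := by
  refine (LipschitzWith.of_dist_le_mul (K := L.toNNReal) fun x y => ?_).continuous
  rw [dist_eq_norm, dist_eq_norm, Real.coe_toNNReal _ h.L_pos.le]
  exact h.norm_hess_sub_le x y

end IsRegularPotential

namespace IsRegularPotential

open ProbabilityTheory

variable {L M m : ℝ} {d : ℕ} {V : Euc d → ℝ}

theorem integrable_exp_neg (h : IsRegularPotential L M m V) :
    Integrable fun x => Real.exp (-(V x)) := by
  by_contra hc
  have := h.integral_eq_one
  rw [integral_undef hc] at this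
  norm_num at this

theorem continuous (h : IsRegularPotential L M m V) : Continuous V := h.differentiable.continuous

theorem isProbabilityMeasure (h : IsRegularPotential L M m V) :
    IsProbabilityMeasure (noiseMeasure V) := by
  constructor
  rw [noiseMeasure, withDensity_apply _ MeasurableSet.univ, Measure.restrict_univ,
    ← ofReal_integral_eq_lintegral_ofReal h.integrable_exp_neg
      (Filter.Eventually.of_forall fun _ => (Real.exp_pos _).le), h.integral_eq_one]
  simp

theorem integral_noise (h : IsRegularPotential L M m V) (g : Euc d → ℝ) :
    ∫ x, g x ∂ noiseMeasure V = ∫ x, Real.exp (-(V x)) * g x := by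
  have hm : Measurable fun x => ENNReal.ofReal (Real.exp (-(V x))) := by
    have := h.continuous.measurable
    fun_prop
  rw [noiseMeasure, integral_withDensity_eq_integral_toReal_smul hm (by simp)]
  simp [ENNReal.toReal_ofReal (Real.exp_pos _).le]

theorem integrable_noise_iff (h : IsRegularPotential L M m V) (g : Euc d → ℝ) :
    Integrable g (noiseMeasure V) ↔ Integrable fun x => Real.exp (-(V x)) * g x := by
  have hm : Measurable fun x => ENNReal.ofReal (Real.exp (-(V x))) := by
    have := h.continuous.measurable
    fun_prop
  rw [noiseMeasure, integrable_withDensity_iff_integrable_smul' hm (by simp)]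
  simp [ENNReal.toReal_ofReal (Real.exp_pos _).le]

theorem exp_mul_exp_le (h : IsRegularPotential L M m V) (u x : Euc d) (t : ℝ) :
    Real.exp (-(V x)) * Real.exp (t * ⟪gradient V x, u⟫) ≤
      Real.exp (M * ‖u‖ ^ 2 * t ^ 2) * Real.exp (-(V (x - t • u))) := by
  rw [← Real.exp_add, ← Real.exp_add, Real.exp_le_exp]
  have := h.taylor_le x (t • u)
  rw [inner_smul_right, norm_smul, mul_pow, Real.norm_eq_abs, sq_abs] at this
  linarith

theorem hasSubgaussianMGF_gradient (h : IsRegularPotential L M m V) (u : Euc d) :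
    HasSubgaussianMGF (fun x => ⟪gradient V x, u⟫) (2 * M * ‖u‖ ^ 2).toNNReal
      (noiseMeasure V) := by
  have hM := h.M_pos
  have hc := h.continuous_gradient
  have hV := h.continuous
  have h_int : ∀ t : ℝ, Integrable (fun x =>
      Real.exp (M * ‖u‖ ^ 2 * t ^ 2) * Real.exp (-(V (x - t • u)))) := fun t =>
    (h.integrable_exp_neg.comp_sub_right (t • u)).const_mul _
  have h_int' : ∀ t : ℝ, Integrable (fun x =>
      Real.exp (-(V x)) * Real.exp (t * ⟪gradient V x, u⟫)) := fun t => by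
    refine (h_int t).mono' (by fun_prop) (Filter.Eventually.of_forall fun x => ?_)
    rw [Real.norm_of_nonneg (by positivity)]
    exact h.exp_mul_exp_le u x t
  refine ⟨fun t => (h.integrable_noise_iff _).2 (h_int' t), fun t => ?_⟩
  rw [mgf, h.integral_noise]
  refine (integral_mono (h_int' t) (h_int t) fun x => h.exp_mul_exp_le u x t).trans (le_of_eq ?_)
  rw [integral_const_mul, integral_sub_right_eq_self (fun x => Real.exp (-(V x))),
    h.integral_eq_one, Real.coe_toNNReal _ (by positivity)]
  ring_nf

theorem memLp_inner_gradient (h : IsRegularPotential L M m V) (u : Euc d) {p : ℝ≥0∞} (hp : p ≠ ∞) :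
    MemLp (fun x => ⟪gradient V x, u⟫) p (noiseMeasure V) := by
  lift p to ℝ≥0 using hp
  exact (h.hasSubgaussianMGF_gradient u).memLp p

theorem hasFDerivAt_exp_neg (h : IsRegularPotential L M m V) (x : Euc d) :
    HasFDerivAt (fun x => Real.exp (-(V x))) (-(Real.exp (-(V x))) • fderiv ℝ V x) x := by
  have := (h.differentiable x).hasFDerivAt.neg.exp
  simpa only [Pi.neg_apply, smul_neg, neg_smul] using this

theorem integral_inner_gradient (h : IsRegularPotential L M m V) (u : Euc d) :
    ∫ x, ⟪gradient V x, u⟫ ∂ noiseMeasure V = 0 := by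
  have hi := (h.integrable_noise_iff _).1 (h.hasSubgaussianMGF_gradient u).integrable
  have := integral_mul_fderiv_eq_neg_fderiv_mul_of_integrable (μ := volume)
    (f := fun _ : Euc d => (1 : ℝ)) (g := fun x => Real.exp (-(V x))) (v := u)
    (by simp)
    (by
      refine hi.neg.congr (Filter.Eventually.of_forall fun x => ?_)
      simp [(h.hasFDerivAt_exp_neg x).fderiv, h.inner_gradient])
    (by simpa using h.integrable_exp_neg) (fun x _ => by fun_prop)
    (fun x _ => (h.hasFDerivAt_exp_neg x).differentiableAt)
  rw [h.integral_noise]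
  simp only [(h.hasFDerivAt_exp_neg _).fderiv] at this
  simpa [integral_neg, h.inner_gradient] using this

theorem integrable_inner_hess (h : IsRegularPotential L M m V) (u v : Euc d) :
    Integrable (fun x => ⟪hess V x u, v⟫) (noiseMeasure V) := by
  have := h.isProbabilityMeasure
  have hc := h.continuous_hess
  refine Integrable.of_bound (C := M * ‖u‖ * ‖v‖) (by fun_prop) (Filter.Eventually.of_forall fun x => ?_)
  refine (abs_real_inner_le_norm _ _).trans ?_
  gcongr
  exact (hess V x).le_of_opNorm_le (h.norm_hess_le x) u

theorem integral_inner_hess (h : IsRegularPotential L M m V) (u : Euc d) :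
    ∫ x, ⟪hess V x u, u⟫ ∂ noiseMeasure V = ∫ x, ⟪gradient V x, u⟫ ^ 2 ∂ noiseMeasure V := by
  have hi := (h.integrable_noise_iff _).1 (h.hasSubgaussianMGF_gradient u).integrable
  have hi2 := (h.integrable_noise_iff _).1 (h.memLp_inner_gradient u (p := 2) (by simp)).integrable_sq
  have hi3 := (h.integrable_noise_iff _).1 (h.integrable_inner_hess u u)
  have hd : ∀ x, HasFDerivAt (fun x => ⟪gradient V x, u⟫) ((innerSL ℝ u).comp (hess V x)) x :=
    fun x => by
      have := ((innerSL ℝ u).hasFDerivAt (x := gradient V x)).comp x (h.hasFDerivAt_gradient x)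
      refine this.congr_of_eventuallyEq (Filter.Eventually.of_forall fun y => ?_)
      simp
  have := integral_mul_fderiv_eq_neg_fderiv_mul_of_integrable (μ := volume)
    (f := fun x => ⟪gradient V x, u⟫) (g := fun x => Real.exp (-(V x))) (v := u)
    (by
      refine hi3.congr (Filter.Eventually.of_forall fun x => ?_)
      simp only [(hd x).fderiv, ContinuousLinearMap.comp_apply, innerSL_apply_apply]
      rw [real_inner_comm, mul_comm])
    (by
      refine hi2.neg.congr (Filter.Eventually.of_forall fun x => ?_)
      simp only [(h.hasFDerivAt_exp_neg x).fderiv, Pi.neg_apply]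
      simp [h.inner_gradient]; ring)
    (by
      refine hi.congr (Filter.Eventually.of_forall fun x => ?_)
      simp [mul_comm])
    (fun x _ => (hd x).differentiableAt)
    (fun x _ => (h.hasFDerivAt_exp_neg x).differentiableAt)
  rw [h.integral_noise, h.integral_noise]
  simp only [(h.hasFDerivAt_exp_neg _).fderiv, (hd _).fderiv] at this
  have e1 : ∀ x, ⟪gradient V x, u⟫ * (-Real.exp (-(V x)) • fderiv ℝ V x) u =
      -(Real.exp (-(V x)) * ⟪gradient V x, u⟫ ^ 2) := fun x => by
    simp [h.inner_gradient]; ring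
  have e2 : ∀ x, ((innerSL ℝ u).comp (hess V x)) u * Real.exp (-(V x)) =
      Real.exp (-(V x)) * ⟪hess V x u, u⟫ := fun x => by
    rw [ContinuousLinearMap.comp_apply, innerSL_apply_apply, real_inner_comm, mul_comm]
  simp only [e1, e2, integral_neg] at this
  linarith

theorem memLp_gradient (h : IsRegularPotential L M m V) {p : ℝ≥0∞} (hp : p ≠ ∞) :
    MemLp (gradient V) p (noiseMeasure V) := by
  refine MemLp.of_eval_piLp fun i => ?_
  have := h.memLp_inner_gradient (EuclideanSpace.single i 1) hp
  simpa only [EuclideanSpace.inner_single_right, one_mul, conj_trivial] using this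

theorem le_integral_inner_hess (h : IsRegularPotential L M m V) (u : Euc d) :
    m * ‖u‖ ^ 2 ≤ ∫ x, ⟪hess V x u, u⟫ ∂ noiseMeasure V := by
  rw [h.integral_inner_hess]
  refine (h.fisher u).trans (le_of_eq ?_)
  rw [real_inner_comm, ← integral_inner]
  · simp [inner_smul_right, pow_two]
  · have hc := h.continuous_gradient
    have h2 : Integrable (fun x => ‖gradient V x‖ ^ 2) (noiseMeasure V) :=
      (h.memLp_gradient (p := 2) (by simp)).integrable_norm_pow (by simp)
    refine (h2.const_mul ‖u‖).mono' (by fun_prop) (Filter.Eventually.of_forall fun x => ?_)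
    rw [norm_smul]
    have := norm_inner_le_norm (𝕜 := ℝ) (gradient V x) u
    nlinarith [norm_nonneg (gradient V x)]

end IsRegularPotential

section

open ProbabilityTheory

/-- The constant in the moment bound of order `2 * p` for sub-Gaussian variables. -/
def subgaussianMomentConst (p : ℕ) : ℝ := 2 * Real.exp (1 / 2) * (2 * p).factorial

theorem one_le_subgaussianMomentConst (p : ℕ) : 1 ≤ subgaussianMomentConst p := by
  have h1 : (1 : ℝ) ≤ (2 * p).factorial := by exact_mod_cast (2 * p).factorial_pos
  have h2 : 1 ≤ Real.exp (1 / 2) := Real.one_le_exp (by norm_num)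
  unfold subgaussianMomentConst
  nlinarith

theorem ProbabilityTheory.HasSubgaussianMGF.integral_pow_le {Ω : Type*} [MeasurableSpace Ω]
    {μ : Measure Ω} [IsProbabilityMeasure μ] {X : Ω → ℝ} {c : ℝ≥0}
    (h : HasSubgaussianMGF X c μ) (p : ℕ) :
    ∫ ω, X ω ^ (2 * p) ∂μ ≤ subgaussianMomentConst p * (c : ℝ) ^ p := by
  rcases eq_or_ne c 0 with rfl | hc
  · have h0 := h.ae_eq_zero_of_hasSubgaussianMGF_zero
    rw [integral_congr_ae (g := fun _ => (0 : ℝ) ^ (2 * p))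
      (by filter_upwards [h0] with ω hω; simp [hω])]
    have := one_le_subgaussianMomentConst p
    rcases p with _ | p <;> simp
    exact this
  have hc' : (0 : ℝ) < c := by exact_mod_cast pos_iff_ne_zero.2 hc
  set t : ℝ := 1 / √c
  have ht2 : t ^ 2 * c = 1 := by
    simp only [t, div_pow, Real.sq_sqrt hc'.le, one_pow]; field_simp
  have hpt : ∀ ω, X ω ^ (2 * p) ≤ (2 * p).factorial * (c : ℝ) ^ p *
      (Real.exp (t * X ω) + Real.exp ((-t) * X ω)) := fun ω => by
    have h1 := Real.pow_div_factorial_le_exp |t * X ω| (abs_nonneg _) (2 * p)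
    have h2 : Real.exp |t * X ω| ≤ Real.exp (t * X ω) + Real.exp ((-t) * X ω) := by
      rcases abs_cases (t * X ω) with ⟨h, _⟩ | ⟨h, _⟩ <;> rw [h] <;>
      · rw [neg_mul]; linarith [Real.exp_pos (t * X ω), Real.exp_pos (-(t * X ω))]
    rw [div_le_iff₀ (by positivity), pow_mul, sq_abs, ← pow_mul] at h1
    have h3 : X ω ^ (2 * p) = (c : ℝ) ^ p * (t * X ω) ^ (2 * p) := by
      have : (c : ℝ) ^ p * (t ^ 2) ^ p = 1 := by rw [← mul_pow, mul_comm, ht2, one_pow]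
      rw [mul_pow, ← mul_assoc, pow_mul t, this, one_mul]
    rw [h3]
    calc (c : ℝ) ^ p * (t * X ω) ^ (2 * p)
        ≤ (c : ℝ) ^ p * ((Real.exp (t * X ω) + Real.exp ((-t) * X ω)) * (2 * p).factorial) := by
          gcongr; exact h1.trans (by gcongr)
      _ = _ := by ring
  have i1 := (h.integrable_exp_mul t)
  have i2 := (h.integrable_exp_mul (-t))
  have hm : ∀ s : ℝ, s ^ 2 * c = 1 → ∫ ω, Real.exp (s * X ω) ∂μ ≤ Real.exp (1 / 2) := fun s hs => by
    refine (h.mgf_le s).trans (le_of_eq ?_)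
    rw [mul_comm, hs]
  calc ∫ ω, X ω ^ (2 * p) ∂μ
      ≤ ∫ ω, (2 * p).factorial * (c : ℝ) ^ p *
        (Real.exp (t * X ω) + Real.exp ((-t) * X ω)) ∂μ := by
        refine integral_mono_of_nonneg (Filter.Eventually.of_forall fun ω => ?_)
          ((i1.add i2).const_mul _) (Filter.Eventually.of_forall hpt)
        simp only [Pi.zero_apply, pow_mul]; positivity
    _ = (2 * p).factorial * (c : ℝ) ^ p *
        (∫ ω, Real.exp (t * X ω) ∂μ + ∫ ω, Real.exp ((-t) * X ω) ∂μ) := by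
        rw [integral_const_mul, integral_add i1 i2]
    _ ≤ (2 * p).factorial * (c : ℝ) ^ p * (Real.exp (1 / 2) + Real.exp (1 / 2)) := by
        gcongr
        · exact hm t ht2
        · exact hm (-t) (by rw [neg_sq, ht2])
    _ = _ := by unfold subgaussianMomentConst; ring

theorem integral_norm_pow_le_of_subgaussian {Ω : Type*} [MeasurableSpace Ω] {μ : Measure Ω}
    [IsProbabilityMeasure μ] {d : ℕ} {X : Ω → Euc d} {c : ℝ≥0}
    (h : ∀ i, HasSubgaussianMGF (fun ω => X ω i) c μ) (p : ℕ) :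
    Integrable (fun ω => ‖X ω‖ ^ (2 * p)) μ ∧
    ∫ ω, ‖X ω‖ ^ (2 * p) ∂μ ≤ subgaussianMomentConst p * ((c : ℝ) * d) ^ p := by
  have hL : MemLp X ((2 * p : ℕ) : ℝ≥0∞) μ := MemLp.of_eval_piLp fun i => by
    simpa using (h i).memLp (2 * p : ℕ)
  refine ⟨hL.integrable_norm_pow', ?_⟩
  rcases p with _ | p
  · simpa using one_le_subgaussianMomentConst 0
  have hi : ∀ i, Integrable (fun ω => X ω i ^ (2 * (p + 1))) μ := fun i => by
    have : MemLp (fun ω => X ω i) ((2 * (p + 1) : ℕ) : ℝ≥0∞) μ := by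
      simpa using (h i).memLp (2 * (p + 1) : ℕ)
    refine this.integrable_norm_pow'.congr (Filter.Eventually.of_forall fun ω => ?_)
    simp only [Real.norm_eq_abs, pow_mul, sq_abs]
  have hpt : ∀ ω, ‖X ω‖ ^ (2 * (p + 1)) ≤ (d : ℝ) ^ p * ∑ i, X ω i ^ (2 * (p + 1)) := fun ω => by
    rw [pow_mul, EuclideanSpace.real_norm_sq_eq]
    have := pow_sum_div_card_le_sum_pow (s := Finset.univ) (f := fun i => X ω i ^ 2)
      (fun i _ => sq_nonneg _) p
    simp only [Finset.card_univ, Fintype.card_fin, ← pow_mul] at this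
    rcases Nat.eq_zero_or_pos d with rfl | hd
    · simp
    · rw [div_le_iff₀ (by positivity)] at this
      linarith
  calc ∫ ω, ‖X ω‖ ^ (2 * (p + 1)) ∂μ
      ≤ ∫ ω, (d : ℝ) ^ p * ∑ i, X ω i ^ (2 * (p + 1)) ∂μ :=
        integral_mono_of_nonneg (Filter.Eventually.of_forall fun ω => by positivity)
          ((integrable_finsetSum _ fun i _ => hi i).const_mul _) (Filter.Eventually.of_forall hpt)
    _ = (d : ℝ) ^ p * ∑ i, ∫ ω, X ω i ^ (2 * (p + 1)) ∂μ := by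
        rw [integral_const_mul, integral_finsetSum _ fun i _ => hi i]
    _ ≤ (d : ℝ) ^ p * ∑ i : Fin d, subgaussianMomentConst (p + 1) * (c : ℝ) ^ (p + 1) := by
        gcongr with i
        exact (h i).integral_pow_le (p + 1)
    _ = _ := by simp; ring

theorem ProbabilityTheory.HasSubgaussianMGF.sum_pi {E : Type*} [MeasurableSpace E] {μ : Measure E}
    [IsProbabilityMeasure μ] {X : E → ℝ} {c : ℝ≥0} (h : HasSubgaussianMGF X c μ)
    (hX : Measurable X) (n : ℕ) :
    HasSubgaussianMGF (fun x : Fin n → E => ∑ j, X (x j)) (n * c) (Measure.pi fun _ => μ) := by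
  have hind : iIndepFun (fun (j : Fin n) (x : Fin n → E) => X (x j)) (Measure.pi fun _ => μ) :=
    iIndepFun_pi (X := fun _ => X) fun _ => hX.aemeasurable
  have := HasSubgaussianMGF.sum_of_iIndepFun hind (s := Finset.univ) (c := fun _ => c)
    fun j _ => by
      have hp := measurePreserving_eval (fun _ : Fin n => μ) j
      rw [← hp.map_eq] at h
      exact h.of_map hp.measurable.aemeasurable
  simpa using this

namespace IsRegularPotential

variable {L M m : ℝ} {d : ℕ} {V : Euc d → ℝ}

theorem integral_norm_gradient_pow_le (h : IsRegularPotential L M m V) (p : ℕ) :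
    Integrable (fun x => ‖gradient V x‖ ^ (2 * p)) (noiseMeasure V) ∧
    ∫ x, ‖gradient V x‖ ^ (2 * p) ∂ noiseMeasure V ≤
      subgaussianMomentConst p * (2 * M * d) ^ p := by
  have := h.isProbabilityMeasure
  have hM := h.M_pos
  have := integral_norm_pow_le_of_subgaussian (X := gradient V) (μ := noiseMeasure V)
    (c := (2 * M).toNNReal) (fun i => by
      have := h.hasSubgaussianMGF_gradient (EuclideanSpace.single i 1)
      simpa only [EuclideanSpace.inner_single_right, one_mul, conj_trivial,
        PiLp.norm_single, norm_one, one_pow, mul_one] using this) p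
  rwa [Real.coe_toNNReal _ (by positivity)] at this

/-- The law of the noise sample. -/
def _root_.noiseSample {d : ℕ} (V : Euc d → ℝ) (n : ℕ) : Measure (Fin n → Euc d) :=
  Measure.pi fun _ => noiseMeasure V

theorem isProbabilityMeasure_noiseSample (h : IsRegularPotential L M m V) (n : ℕ) :
    IsProbabilityMeasure (noiseSample V n) := by
  have := h.isProbabilityMeasure
  unfold noiseSample
  infer_instance

/-- The score of the sample `x` at the location `c`. -/
def _root_.score {d n : ℕ} (V : Euc d → ℝ) (x : Fin n → Euc d) (c : Euc d) : Euc d :=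
  ∑ j, gradient V (x j - c)

theorem hasSubgaussianMGF_score (h : IsRegularPotential L M m V) (n : ℕ) (u : Euc d) :
    HasSubgaussianMGF (fun x => ⟪score V x 0, u⟫) (n * (2 * M * ‖u‖ ^ 2).toNNReal)
      (noiseSample V n) := by
  have := h.isProbabilityMeasure
  have hc := h.continuous_gradient
  have := (h.hasSubgaussianMGF_gradient u).sum_pi (by fun_prop) n
  simpa only [noiseSample, score, sum_inner, sub_zero] using this

theorem integral_norm_score_pow_le (h : IsRegularPotential L M m V) (n p : ℕ) :
    Integrable (fun x => ‖score V x 0‖ ^ (2 * p)) (noiseSample V n) ∧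
    ∫ x, ‖score V x 0‖ ^ (2 * p) ∂ noiseSample V n ≤
      subgaussianMomentConst p * (2 * M * n * d) ^ p := by
  have := h.isProbabilityMeasure_noiseSample n
  have hM := h.M_pos
  have := integral_norm_pow_le_of_subgaussian (X := fun x => score V x 0) (μ := noiseSample V n)
    (c := n * (2 * M).toNNReal) (fun i => by
      have := h.hasSubgaussianMGF_score n (EuclideanSpace.single i 1)
      simpa only [EuclideanSpace.inner_single_right, one_mul, conj_trivial,
        PiLp.norm_single, norm_one, one_pow, mul_one] using this) p
  rw [NNReal.coe_mul, Real.coe_toNNReal _ (by positivity), NNReal.coe_natCast] at this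
  rwa [show (n : ℝ) * (2 * M) = 2 * M * n by ring] at this

theorem integral_inner_score_sq_le (h : IsRegularPotential L M m V) (n : ℕ) (u : Euc d) :
    ∫ x, ⟪score V x 0, u⟫ ^ 2 ∂ noiseSample V n ≤
      subgaussianMomentConst 1 * (2 * M * n * ‖u‖ ^ 2) := by
  have := h.isProbabilityMeasure_noiseSample n
  have hM := h.M_pos
  have := (h.hasSubgaussianMGF_score n u).integral_pow_le 1
  rw [NNReal.coe_mul, Real.coe_toNNReal _ (by positivity), NNReal.coe_natCast] at this
  refine this.trans (le_of_eq (by ring))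

theorem integral_inner_score (h : IsRegularPotential L M m V) (n : ℕ) (u : Euc d) :
    ∫ x, ⟪score V x 0, u⟫ ∂ noiseSample V n = 0 := by
  have := h.isProbabilityMeasure
  simp only [score, sum_inner, sub_zero]
  rw [integral_finsetSum]
  · refine Finset.sum_eq_zero fun j _ => ?_
    have := integral_comp_eval (μ := fun _ : Fin n => noiseMeasure V) (i := j)
      (f := fun x => ⟪gradient V x, u⟫) (h.hasSubgaussianMGF_gradient u).aestronglyMeasurable
    exact this.trans (h.integral_inner_gradient u)
  · intro j _
    exact integrable_comp_eval (μ := fun _ : Fin n => noiseMeasure V) (i := j)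
      (f := fun x => ⟪gradient V x, u⟫) (h.hasSubgaussianMGF_gradient u).integrable

theorem integral_inner_gradient_sq_le (h : IsRegularPotential L M m V) (u : Euc d) :
    ∫ x, ⟪gradient V x, u⟫ ^ 2 ∂ noiseMeasure V ≤
      subgaussianMomentConst 1 * (2 * M * ‖u‖ ^ 2) := by
  have := h.isProbabilityMeasure
  have hM := h.M_pos
  have := (h.hasSubgaussianMGF_gradient u).integral_pow_le 1
  rw [Real.coe_toNNReal _ (by positivity)] at this
  refine this.trans (le_of_eq (by ring))

end IsRegularPotential

end

/-- Constants in the expansion of `(T + h) ^ (p + 1)`. -/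
def expansionConst : ℕ → ℝ
  | 0 => 0
  | p + 1 => 10 * (p + 1) + 6 * expansionConst p

theorem expansionConst_nonneg (p : ℕ) : 0 ≤ expansionConst p := by
  induction p with
  | zero => simp [expansionConst]
  | succ p ih => rw [expansionConst]; positivity

theorem add_pow_le_of_sq_le {T h β : ℝ} (hT : 0 ≤ T) (hβ : 0 ≤ β) (h0 : 0 ≤ T + h)
    (h1 : T + h ≤ 2 * T + 2 * β) (h2 : h ^ 2 ≤ 8 * T * β + 2 * β ^ 2) (p : ℕ) :
    (T + h) ^ (p + 1) ≤ T ^ (p + 1) + (p + 1) * T ^ p * h +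
      expansionConst p * (T ^ p * β + β ^ (p + 1)) := by
  induction p with
  | zero => simp [expansionConst]
  | succ p ih =>
    have hc := expansionConst_nonneg p
    have e1 : T * β ^ (p + 1) ≤ T ^ (p + 1) * β + β ^ (p + 2) := by
      rcases le_total T β with h | h
      · have : T * β ^ (p + 1) ≤ β * β ^ (p + 1) := by gcongr
        have : 0 ≤ T ^ (p + 1) * β := by positivity
        nlinarith [pow_succ β (p + 1)]
      · have : β ^ p * (T * β) ≤ T ^ p * (T * β) := by gcongr
        have : 0 ≤ β ^ (p + 2) := by positivity
        nlinarith [pow_succ β p, pow_succ T p]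
    have e2 : T ^ p * β ^ 2 ≤ T ^ (p + 1) * β + β ^ (p + 2) := by
      rcases le_total T β with h | h
      · have : T ^ p * β ^ 2 ≤ β ^ p * β ^ 2 := by gcongr
        have : 0 ≤ T ^ (p + 1) * β := by positivity
        rw [pow_add β p 2]; linarith
      · have : (T ^ p * β) * β ≤ (T ^ p * β) * T := by gcongr
        have : 0 ≤ β ^ (p + 2) := by positivity
        nlinarith [pow_succ T p]
    have e3 : T ^ p * h ^ 2 ≤ T ^ p * (8 * T * β + 2 * β ^ 2) := by gcongr
    have e4 : (T + h) * (T ^ p * β + β ^ (p + 1)) ≤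
        (2 * T + 2 * β) * (T ^ p * β + β ^ (p + 1)) := by gcongr
    have e5 : (T + h) * (T + h) ^ (p + 1) ≤ (T + h) * (T ^ (p + 1) + (p + 1) * T ^ p * h +
        expansionConst p * (T ^ p * β + β ^ (p + 1))) := by gcongr
    have e6 : T ^ p * h ^ 2 ≤ 10 * (T ^ (p + 1) * β + β ^ (p + 2)) := by
      have : 0 ≤ β ^ (p + 2) := by positivity
      rw [pow_succ T p] at *
      linarith
    have e7 : (T + h) * (T ^ p * β + β ^ (p + 1)) ≤ 6 * (T ^ (p + 1) * β + β ^ (p + 2)) := by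
      have : (2 * T + 2 * β) * (T ^ p * β + β ^ (p + 1)) = 2 * (T ^ (p + 1) * β + β ^ (p + 2)) +
        2 * (T * β ^ (p + 1)) + 2 * (T ^ p * β ^ 2) := by ring
      linarith
    have e8 := mul_le_mul_of_nonneg_left e7 hc
    have e9 := mul_le_mul_of_nonneg_left e6 (by positivity : (0 : ℝ) ≤ p + 1)
    rw [expansionConst, pow_succ' (T + h)]
    push_cast
    refine e5.trans ?_
    have e10 : (T + h) * (T ^ (p + 1) + (p + 1) * T ^ p * h +
        expansionConst p * (T ^ p * β + β ^ (p + 1))) = T ^ (p + 2) + (p + 2) * T ^ (p + 1) * h +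
        (p + 1) * (T ^ p * h ^ 2) +
        expansionConst p * ((T + h) * (T ^ p * β + β ^ (p + 1))) := by ring
    rw [e10]
    linarith

/-- Constants in the moment bound for sums of bounded centred vectors. -/
def boundedMomentConst : ℕ → ℝ
  | 0 => 1
  | p + 1 => (p + 1 + expansionConst p) * boundedMomentConst p + expansionConst p

theorem boundedMomentConst_nonneg (p : ℕ) : 0 ≤ boundedMomentConst p := by
  induction p with
  | zero => simp [boundedMomentConst]
  | succ p ih => have := expansionConst_nonneg p; rw [boundedMomentConst]; positivity

theorem measurePreserving_cons {E : Type*} [MeasurableSpace E] (μ : Measure E)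
    [IsProbabilityMeasure μ] (n : ℕ) :
    MeasurePreserving (fun z : E × (Fin n → E) => (Fin.cons z.1 z.2 : Fin (n + 1) → E))
      (μ.prod (Measure.pi fun _ => μ)) (Measure.pi fun _ => μ) := by
  have := (measurePreserving_piFinSuccAbove (fun _ : Fin (n + 1) => μ) 0).symm
  convert this using 1
  ext z i
  simp [MeasurableEquiv.piFinSuccAbove]

theorem integral_pi_succ {E : Type*} [MeasurableSpace E] (μ : Measure E)
    [IsProbabilityMeasure μ] (n : ℕ) (f : (Fin (n + 1) → E) → ℝ) :
    ∫ x, f x ∂(Measure.pi fun _ => μ) =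
      ∫ z, f (Fin.cons z.1 z.2) ∂(μ.prod (Measure.pi fun _ : Fin n => μ)) := by
  have := (measurePreserving_piFinSuccAbove (fun _ : Fin (n + 1) => μ) 0).symm
  refine ((this.integral_comp' f).symm.trans ?_)
  congr 1
  ext z
  congr 1
  ext i
  simp [MeasurableEquiv.piFinSuccAbove]

theorem integral_norm_sum_pow_le {E H : Type*} [MeasurableSpace E] (μ : Measure E)
    [IsProbabilityMeasure μ] [NormedAddCommGroup H] [InnerProductSpace ℝ H] [CompleteSpace H]
    [MeasurableSpace H] [BorelSpace H] [SecondCountableTopology H] {Y : E → H} (hY : Measurable Y)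
    {b : ℝ} (hb : ∀ x, ‖Y x‖ ≤ b) (h0 : ∫ x, Y x ∂μ = 0) (p n : ℕ) :
    ∫ x : Fin n → E, ‖∑ j, Y (x j)‖ ^ (2 * p) ∂(Measure.pi fun _ => μ) ≤
      boundedMomentConst p * b ^ (2 * p) * (n : ℝ) ^ p := by
  have hb0 : 0 ≤ b := by
    obtain ⟨x⟩ := μ.nonempty_of_neZero
    exact (norm_nonneg _).trans (hb x)
  induction p generalizing n with
  | zero => simp [boundedMomentConst]
  | succ p ihp =>
  induction n with
  | zero => simp
  | succ n ihn =>
    set ν : Measure (Fin n → E) := Measure.pi fun _ => μ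
    set S : (Fin n → E) → H := fun x => ∑ j, Y (x j) with hS
    have hSm : Measurable S := by fun_prop
    have hSb : ∀ x, ‖S x‖ ≤ n * b := fun x => by
      refine (norm_sum_le _ _).trans ((Finset.sum_le_sum fun j _ => hb (x j)).trans ?_)
      simp
    have hc := expansionConst_nonneg p
    have hC := boundedMomentConst_nonneg p
    have hYi : Integrable Y μ := Integrable.of_bound hY.aestronglyMeasurable b (.of_forall hb)
    have hpow : ∀ q, Integrable (fun x => (‖S x‖ ^ 2) ^ q) ν := fun q =>
      Integrable.of_bound (C := ((n * b) ^ 2) ^ q) (by fun_prop) (.of_forall fun x => by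
        rw [Real.norm_eq_abs, abs_of_nonneg (by positivity)]; gcongr; exact hSb x)
    have hpow2 : ∀ q, Integrable (fun z : E × (Fin n → E) => (‖S z.2‖ ^ 2) ^ q) (μ.prod ν) :=
      fun q => (hpow q).comp_snd μ
    have i1 : Integrable (fun z : E × (Fin n → E) => (‖S z.2‖ ^ 2) ^ p * ⟪S z.2, Y z.1⟫)
        (μ.prod ν) := by
      refine Integrable.of_bound (C := ((n * b) ^ 2) ^ p * ((n * b) * b))
        (by fun_prop) (.of_forall fun z => ?_)
      rw [norm_mul, Real.norm_of_nonneg (by positivity)]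
      gcongr
      · exact hSb _
      · exact (norm_inner_le_norm _ _).trans (mul_le_mul (hSb _) (hb _) (by positivity)
          (by positivity))
    have z1 : ∫ z : E × (Fin n → E), (‖S z.2‖ ^ 2) ^ p * ⟪S z.2, Y z.1⟫ ∂(μ.prod ν) = 0 := by
      rw [integral_prod_symm _ i1]
      simp only [integral_const_mul, integral_inner hYi, h0, inner_zero_right, mul_zero,
        integral_zero]
    have hq : ∀ q, ∫ z : E × (Fin n → E), (‖S z.2‖ ^ 2) ^ q ∂(μ.prod ν) =
        ∫ x, ‖S x‖ ^ (2 * q) ∂ν := fun q => by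
      rw [integral_fun_snd (fun x => (‖S x‖ ^ 2) ^ q)]
      simp [pow_mul]
    rw [integral_pi_succ]
    have hpt : ∀ z : E × (Fin n → E), ‖∑ j, Y ((Fin.cons z.1 z.2 : Fin (n + 1) → E) j)‖ ^
        (2 * (p + 1)) ≤ (‖S z.2‖ ^ 2) ^ (p + 1) + 2 * (p + 1) *
          ((‖S z.2‖ ^ 2) ^ p * ⟪S z.2, Y z.1⟫) + (p + 1 + expansionConst p) * b ^ 2 *
          (‖S z.2‖ ^ 2) ^ p + expansionConst p * b ^ (2 * (p + 1)) := fun z => by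
      rw [Fin.sum_univ_succ]
      simp only [Fin.cons_zero, Fin.cons_succ]
      change ‖Y z.1 + S z.2‖ ^ (2 * (p + 1)) ≤ _
      have e1 : ‖Y z.1 + S z.2‖ ^ 2 = ‖S z.2‖ ^ 2 + (2 * ⟪S z.2, Y z.1⟫ + ‖Y z.1‖ ^ 2) := by
        rw [add_comm, norm_add_sq_real]; ring
      have hin := abs_le.1 (abs_real_inner_le_norm (S z.2) (Y z.1))
      set t := ‖S z.2‖
      set y := ‖Y z.1‖
      set w := ⟪S z.2, Y z.1⟫
      have hy : y ≤ b := hb _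
      have ht0 : 0 ≤ t := norm_nonneg _
      have hy0 : 0 ≤ y := norm_nonneg _
      have hyb : y ^ 2 ≤ b ^ 2 := by gcongr
      have hw2 : w ^ 2 ≤ t ^ 2 * b ^ 2 := by
        have : w ^ 2 ≤ (t * y) ^ 2 := sq_le_sq' (by linarith) hin.2
        rw [mul_pow] at this
        refine this.trans (by gcongr)
      have key := add_pow_le_of_sq_le (T := t ^ 2) (h := 2 * w + y ^ 2) (β := b ^ 2)
        (by positivity) (by positivity) (by rw [← e1]; positivity)
        (by nlinarith [sq_nonneg (t - y)])
        (by
          have : (y ^ 2) ^ 2 ≤ (b ^ 2) ^ 2 := by gcongr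
          nlinarith [sq_nonneg (2 * w - y ^ 2)]) p
      rw [pow_mul, e1]
      refine key.trans ?_
      have e2 : (p + 1) * (t ^ 2) ^ p * (2 * w + y ^ 2) ≤
          (p + 1) * (t ^ 2) ^ p * (2 * w + b ^ 2) := by gcongr
      rw [pow_mul b]
      linarith
    calc _ ≤ ∫ z : E × (Fin n → E), ((‖S z.2‖ ^ 2) ^ (p + 1) + 2 * (p + 1) *
          ((‖S z.2‖ ^ 2) ^ p * ⟪S z.2, Y z.1⟫) + (p + 1 + expansionConst p) * b ^ 2 *
          (‖S z.2‖ ^ 2) ^ p + expansionConst p * b ^ (2 * (p + 1))) ∂(μ.prod ν) := by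
          refine integral_mono_of_nonneg (.of_forall fun z => by simp only [Pi.zero_apply]; positivity) ?_ (.of_forall hpt)
          exact ((((hpow2 _).add (i1.const_mul _)).add ((hpow2 _).const_mul _)).add
            (integrable_const _))
      _ = ∫ x, ‖S x‖ ^ (2 * (p + 1)) ∂ν + (p + 1 + expansionConst p) * b ^ 2 *
          ∫ x, ‖S x‖ ^ (2 * p) ∂ν + expansionConst p * b ^ (2 * (p + 1)) := by
          have j1 := (hpow2 (p + 1)).fun_add (i1.const_mul (2 * (p + 1)))
          have j2 := (hpow2 p).const_mul ((p + 1 + expansionConst p) * b ^ 2)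
          rw [integral_add (j1.fun_add j2) (integrable_const _), integral_add j1 j2,
            integral_add (hpow2 _) (i1.const_mul _), integral_const_mul, integral_const_mul, z1,
            hq, hq]
          simp
      _ ≤ boundedMomentConst (p + 1) * b ^ (2 * (p + 1)) * (n : ℝ) ^ (p + 1) +
          (p + 1 + expansionConst p) * b ^ 2 * (boundedMomentConst p * b ^ (2 * p) * (n : ℝ) ^ p) +
          expansionConst p * b ^ (2 * (p + 1)) := by
          gcongr
          exact ihp n
      _ ≤ boundedMomentConst (p + 1) * b ^ (2 * (p + 1)) * ((n + 1 : ℕ) : ℝ) ^ (p + 1) := by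
          push_cast
          have f1 : (n : ℝ) ^ (p + 1) + ((n : ℝ) + 1) ^ p ≤ ((n : ℝ) + 1) ^ (p + 1) := by
            have : (n : ℝ) ^ p ≤ ((n : ℝ) + 1) ^ p := by gcongr; linarith
            rw [pow_succ, pow_succ]
            nlinarith [(Nat.cast_nonneg n : (0 : ℝ) ≤ n)]
          have f2 : (n : ℝ) ^ p ≤ ((n : ℝ) + 1) ^ p := by gcongr; linarith
          have f3 : (1 : ℝ) ≤ ((n : ℝ) + 1) ^ p := one_le_pow₀ (by linarith [(Nat.cast_nonneg n : (0 : ℝ) ≤ n)])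
          have hC' := boundedMomentConst_nonneg (p + 1)
          have g1 := mul_le_mul_of_nonneg_left f1
            (by positivity : 0 ≤ boundedMomentConst (p + 1) * b ^ (2 * (p + 1)))
          refine le_trans ?_ g1
          have g2 := mul_le_mul_of_nonneg_left f2
            (by positivity : 0 ≤ (p + 1 + expansionConst p) * boundedMomentConst p * b ^ (2 * (p + 1)))
          have g3 := mul_le_mul_of_nonneg_left f3
            (by positivity : 0 ≤ expansionConst p * b ^ (2 * (p + 1)))
          have : boundedMomentConst (p + 1) = (p + 1 + expansionConst p) * boundedMomentConst p +
            expansionConst p := rfl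
          have e1 : (p + 1 + expansionConst p) * b ^ 2 * (boundedMomentConst p * b ^ (2 * p) *
            (n : ℝ) ^ p) = (p + 1 + expansionConst p) * boundedMomentConst p * b ^ (2 * (p + 1)) *
            (n : ℝ) ^ p := by ring
          rw [e1, mul_add _ ((n : ℝ) ^ (p + 1)) _]
          have e2 : boundedMomentConst (p + 1) * b ^ (2 * (p + 1)) * ((n : ℝ) + 1) ^ p =
            (p + 1 + expansionConst p) * boundedMomentConst p * b ^ (2 * (p + 1)) *
              ((n : ℝ) + 1) ^ p + expansionConst p * b ^ (2 * (p + 1)) * ((n : ℝ) + 1) ^ p := by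
            rw [this]; ring
          rw [e2, ← add_assoc]
          rw [mul_one] at g3
          exact add_le_add (add_le_add le_rfl g2) g3

theorem norm_toLp_apply_single_le {d : ℕ} (B : Euc d →L[ℝ] Euc d) :
    ‖WithLp.toLp 2 fun k : Fin d => B (EuclideanSpace.single k 1)‖ ≤ √d * ‖B‖ := by
  rw [PiLp.norm_eq_of_L2]
  refine Real.sqrt_le_iff.2 ⟨by positivity, ?_⟩
  rw [mul_pow, Real.sq_sqrt (Nat.cast_nonneg d)]
  calc ∑ k : Fin d, ‖B (EuclideanSpace.single k 1)‖ ^ 2 ≤ ∑ k : Fin d, ‖B‖ ^ 2 := by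
        gcongr with k
        simpa using B.le_opNorm (EuclideanSpace.single k 1)
    _ = _ := by simp

/-- The isomorphism of operators with the Frobenius inner product space. -/
def frobeniusMap (d : ℕ) : (Euc d →L[ℝ] Euc d) →L[ℝ] PiLp 2 fun _ : Fin d => Euc d :=
  LinearMap.mkContinuous
    { toFun := fun B => WithLp.toLp 2 fun k => B (EuclideanSpace.single k 1)
      map_add' := fun _ _ => rfl
      map_smul' := fun _ _ => rfl } (√d) norm_toLp_apply_single_le

theorem norm_frobenius_le {d : ℕ} (B : Euc d →L[ℝ] Euc d) : ‖frobeniusMap d B‖ ≤ √d * ‖B‖ :=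
  norm_toLp_apply_single_le B

theorem norm_apply_le_norm_frobenius {d : ℕ} (B : Euc d →L[ℝ] Euc d) (v : Euc d) :
    ‖B v‖ ≤ ‖frobeniusMap d B‖ * ‖v‖ := by
  have hv : B v = ∑ k, v k • B (EuclideanSpace.single k 1) := by
    conv_lhs => rw [← (EuclideanSpace.basisFun (Fin d) ℝ).sum_repr v]
    simp
  have h1 : ‖B v‖ ≤ ∑ k, ‖B (EuclideanSpace.single k 1)‖ * |v k| := by
    rw [hv]
    refine (norm_sum_le _ _).trans (Finset.sum_le_sum fun k _ => ?_)
    rw [norm_smul, mul_comm, Real.norm_eq_abs]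
  refine h1.trans ((Real.sum_mul_le_sqrt_mul_sqrt _ _ _).trans (le_of_eq ?_))
  rw [EuclideanSpace.norm_eq v, PiLp.norm_eq_of_L2 (frobeniusMap d B)]
  simp only [Real.norm_eq_abs]
  rfl

/-- The Fisher information as the mean of the Hessian. -/
def meanHess {d : ℕ} (V : Euc d → ℝ) : Euc d →L[ℝ] Euc d := ∫ x, hess V x ∂ noiseMeasure V

/-- The Frobenius norm of the deviation of the empirical Hessian from its mean. -/
def hessDev {d n : ℕ} (V : Euc d → ℝ) (x : Fin n → Euc d) : ℝ :=
  ‖∑ j, frobeniusMap d (hess V (x j) - meanHess V)‖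

theorem hessDev_nonneg {d n : ℕ} (V : Euc d → ℝ) (x : Fin n → Euc d) : 0 ≤ hessDev V x :=
  norm_nonneg _

theorem norm_sum_hess_sub_le {d n : ℕ} (V : Euc d → ℝ) (x : Fin n → Euc d) (v : Euc d) :
    ‖(∑ j, hess V (x j) v) - (n : ℝ) • meanHess V v‖ ≤ hessDev V x * ‖v‖ := by
  have := norm_apply_le_norm_frobenius (∑ j, (hess V (x j) - meanHess V)) v
  rw [map_sum] at this
  refine le_trans (le_of_eq ?_) this
  congr 1
  simp [← Nat.cast_smul_eq_nsmul ℝ]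

namespace IsRegularPotential

variable {L M m : ℝ} {d : ℕ} {V : Euc d → ℝ}

theorem integrable_hess (h : IsRegularPotential L M m V) :
    Integrable (hess V) (noiseMeasure V) := by
  have := h.isProbabilityMeasure
  exact Integrable.of_bound h.continuous_hess.aestronglyMeasurable M (.of_forall h.norm_hess_le)

theorem norm_meanHess_le (h : IsRegularPotential L M m V) : ‖meanHess V‖ ≤ M := by
  have := h.isProbabilityMeasure
  simpa [meanHess] using norm_integral_le_of_norm_le_const (μ := noiseMeasure V) (.of_forall h.norm_hess_le)

theorem inner_meanHess (h : IsRegularPotential L M m V) (u v : Euc d) :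
    ⟪meanHess V u, v⟫ = ∫ x, ⟪hess V x u, v⟫ ∂ noiseMeasure V := by
  rw [meanHess, ContinuousLinearMap.integral_apply h.integrable_hess, real_inner_comm, ← integral_inner]
  · simp only [real_inner_comm]
  · exact h.integrable_hess.apply_continuousLinearMap u

theorem le_inner_meanHess (h : IsRegularPotential L M m V) (u : Euc d) :
    m * ‖u‖ ^ 2 ≤ ⟪meanHess V u, u⟫ := by
  rw [h.inner_meanHess]; exact h.le_integral_inner_hess u

theorem inner_meanHess_comm (h : IsRegularPotential L M m V) (u v : Euc d) :
    ⟪meanHess V u, v⟫ = ⟪u, meanHess V v⟫ := by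
  rw [real_inner_comm (meanHess V v) u, h.inner_meanHess, h.inner_meanHess]
  simp only [h.inner_hess_comm _ u v, real_inner_comm]

theorem norm_frobenius_hess_sub_le (h : IsRegularPotential L M m V) (x : Euc d) :
    ‖frobeniusMap d (hess V x - meanHess V)‖ ≤ √d * (2 * M) := by
  refine (norm_frobenius_le _).trans ?_
  gcongr
  refine (_root_.norm_sub_le _ _).trans ?_
  linarith [h.norm_hess_le x, h.norm_meanHess_le]

theorem continuous_hessDev (h : IsRegularPotential L M m V) (n : ℕ) :
    Continuous fun x : Fin n → Euc d => hessDev V x := by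
  have := h.continuous_hess
  unfold hessDev
  fun_prop

theorem hessDev_update_le (h : IsRegularPotential L M m V) {n : ℕ} (x : Fin n → Euc d)
    (i : Fin n) (a : Euc d) : hessDev V (Function.update x i a) ≤ hessDev V x + √d * (4 * M) := by
  have e : ∑ j, frobeniusMap d (hess V (Function.update x i a j) - meanHess V) =
      ∑ j, frobeniusMap d (hess V (x j) - meanHess V) +
        (frobeniusMap d (hess V a - meanHess V) - frobeniusMap d (hess V (x i) - meanHess V)) := by
    rw [← Finset.add_sum_erase _ _ (Finset.mem_univ i), ← Finset.add_sum_erase (a := i)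
      (f := fun j => frobeniusMap d (hess V (x j) - meanHess V)) _ (Finset.mem_univ i)]
    rw [Finset.sum_congr rfl fun j hj => by
      rw [Function.update_of_ne (Finset.ne_of_mem_erase hj)], Function.update_self]
    abel
  rw [hessDev, e]
  refine (norm_add_le _ _).trans ?_
  refine add_le_add le_rfl ((_root_.norm_sub_le _ _).trans ?_)
  linarith [h.norm_frobenius_hess_sub_le a, h.norm_frobenius_hess_sub_le (x i)]

theorem integral_hessDev_pow_le (h : IsRegularPotential L M m V) (n p : ℕ) :
    Integrable (fun x => hessDev V x ^ (2 * p)) (noiseSample V n) ∧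
    ∫ x, hessDev V x ^ (2 * p) ∂ noiseSample V n ≤
      boundedMomentConst p * (4 * M ^ 2 * d * n) ^ p := by
  have := h.isProbabilityMeasure
  have := h.isProbabilityMeasure_noiseSample n
  have hc := h.continuous_hessDev n
  constructor
  · refine Integrable.of_bound (C := (n * (√d * (2 * M))) ^ (2 * p)) (by fun_prop)
      (.of_forall fun x => ?_)
    rw [norm_pow, Real.norm_of_nonneg (hessDev_nonneg V x)]
    have := hessDev_nonneg V x
    gcongr
    refine (norm_sum_le _ _).trans
      ((Finset.sum_le_sum fun j _ => h.norm_frobenius_hess_sub_le (x j)).trans (by simp))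
  · borelize (PiLp 2 fun _ : Fin d => Euc d)
    have hY : Continuous fun x => frobeniusMap d (hess V x - meanHess V) := by
      have := h.continuous_hess
      fun_prop
    have h0 : ∫ x, frobeniusMap d (hess V x - meanHess V) ∂ noiseMeasure V = 0 := by
      have hi : Integrable (fun x => hess V x - meanHess V) (noiseMeasure V) :=
        h.integrable_hess.sub (integrable_const _)
      rw [ContinuousLinearMap.integral_comp_comm _ hi,
        integral_sub h.integrable_hess (integrable_const _)]
      simp [meanHess]
    have := integral_norm_sum_pow_le (noiseMeasure V) hY.measurable h.norm_frobenius_hess_sub_le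
      h0 p n
    refine this.trans (le_of_eq ?_)
    rw [mul_assoc, pow_mul, ← mul_pow, mul_pow √d, Real.sq_sqrt (Nat.cast_nonneg d)]
    ring

end IsRegularPotential

/-- `hatθ` minimizes the empirical risk for every sample. -/
def IsMLE {d n : ℕ} (V : Euc d → ℝ) (hatθ : (Fin n → Euc d) → Euc d) : Prop :=
  ∀ (x : Fin n → Euc d) (θ' : Euc d), ∑ j, V (x j - hatθ x) ≤ ∑ j, V (x j - θ')

namespace IsRegularPotential

variable {L M m : ℝ} {d n : ℕ} {V : Euc d → ℝ} {hatθ : (Fin n → Euc d) → Euc d}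

theorem norm_score_sub_le (h : IsRegularPotential L M m V) (x : Fin n → Euc d) (c u : Euc d) :
    ‖score V x (c + u) - score V x c + ∑ j, hess V (x j - c) u‖ ≤ n * (L * ‖u‖ ^ 2) := by
  have : score V x (c + u) - score V x c + ∑ j, hess V (x j - c) u =
      ∑ j, (gradient V (x j - (c + u)) - gradient V (x j - c) -
        hess V (x j - c) ((x j - (c + u)) - (x j - c))) := by
    simp only [score, ← Finset.sum_sub_distrib, ← Finset.sum_add_distrib]
    refine Finset.sum_congr rfl fun j _ => ?_
    rw [show x j - (c + u) - (x j - c) = -u by abel, map_neg, sub_neg_eq_add]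
  rw [this]
  refine (norm_sum_le _ _).trans ((Finset.sum_le_sum fun j _ =>
    h.norm_gradient_taylor_le _ _).trans (le_of_eq ?_))
  rw [Finset.sum_congr rfl fun j _ => by
    rw [show x j - (c + u) - (x j - c) = -u by abel, norm_neg]]
  simp

theorem inner_score_nonneg (h : IsRegularPotential L M m V) {x : Fin n → Euc d} {c Δ : Euc d}
    (h0 : score V x (c + Δ) = 0) {t : ℝ} (ht : t ≤ 1) : 0 ≤ ⟪score V x (c + t • Δ), Δ⟫ := by
  rcases ht.eq_or_lt with rfl | ht
  · rw [one_smul, h0, inner_zero_left]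
  have h1 : 0 ≤ ⟪score V x (c + t • Δ) - score V x (c + Δ), (1 - t) • Δ⟫ := by
    rw [score, score, ← Finset.sum_sub_distrib, sum_inner]
    refine Finset.sum_nonneg fun j _ => ?_
    have := h.gradient_mono (x j - (c + t • Δ)) (x j - (c + Δ))
    rwa [show x j - (c + t • Δ) - (x j - (c + Δ)) = (1 - t) • Δ by
      rw [sub_smul, one_smul]; abel] at this
  rw [h0, sub_zero, inner_smul_right] at h1
  exact nonneg_of_mul_nonneg_right h1 (by linarith)

theorem norm_le_of_score_eq_zero (h : IsRegularPotential L M m V) (hn : 0 < n)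
    {x : Fin n → Euc d} {c Δ : Euc d} {κ : ℝ} (hκ : 0 < κ)
    (hA : ∀ u, κ * n * ‖u‖ ^ 2 ≤ ∑ j, ⟪hess V (x j - c) u, u⟫)
    (h0 : score V x (c + Δ) = 0) (hs : ‖score V x c‖ < n * κ ^ 2 / (4 * L)) :
    ‖Δ‖ ≤ 2 / (κ * n) * ‖score V x c‖ := by
  have hL := h.L_pos
  have hn' : (0 : ℝ) < n := by exact_mod_cast hn
  rcases (norm_nonneg Δ).eq_or_lt with hΔ | hΔ
  · rw [← hΔ]; positivity
  have key : ∀ t : ℝ, 0 < t → t ≤ 1 → t * ‖Δ‖ ≤ κ / (2 * L) →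
      t * κ * n * ‖Δ‖ / 2 ≤ ‖score V x c‖ := fun t ht0 ht1 htΔ => by
    have h1 := h.inner_score_nonneg h0 ht1
    have h2 := h.norm_score_sub_le x c (t • Δ)
    have h3 := (real_inner_le_norm (score V x (c + t • Δ) - score V x c +
      ∑ j, hess V (x j - c) (t • Δ)) Δ).trans (mul_le_mul_of_nonneg_right h2 hΔ.le)
    rw [inner_add_left, inner_sub_left, sum_inner] at h3
    simp only [map_smul, inner_smul_left, norm_smul, conj_trivial] at h3
    rw [← Finset.mul_sum, Real.norm_of_nonneg ht0.le] at h3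
    have h4 := mul_le_mul_of_nonneg_left (hA Δ) ht0.le
    have h5 := real_inner_le_norm (score V x c) Δ
    have h6 : n * (L * (t * ‖Δ‖) ^ 2) * ‖Δ‖ ≤ t * κ * n * ‖Δ‖ ^ 2 / 2 := by
      have : t * ‖Δ‖ * L ≤ κ / 2 := by
        rw [le_div_iff₀ (by positivity)] at htΔ; linarith
      have := mul_le_mul_of_nonneg_left this (by positivity : 0 ≤ n * t * ‖Δ‖ ^ 2)
      linarith
    have h7 : (t * κ * n * ‖Δ‖ / 2) * ‖Δ‖ ≤ ‖score V x c‖ * ‖Δ‖ := by linarith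
    exact le_of_mul_le_mul_right h7 hΔ
  rcases le_total ‖Δ‖ (κ / (2 * L)) with hc | hc
  · have := key 1 one_pos le_rfl (by rwa [one_mul])
    rw [div_mul_eq_mul_div, le_div_iff₀ (by positivity)]
    linarith
  · exfalso
    have e : κ / (2 * L) / ‖Δ‖ * ‖Δ‖ = κ / (2 * L) := by field_simp
    have := key (κ / (2 * L) / ‖Δ‖) (by positivity) (by rwa [div_le_one hΔ]) e.le
    rw [show κ / (2 * L) / ‖Δ‖ * κ * n * ‖Δ‖ / 2 = (κ / (2 * L) / ‖Δ‖ * ‖Δ‖) * κ * n / 2 by ring, e,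
      show κ / (2 * L) * κ * n / 2 = n * κ ^ 2 / (4 * L) by field_simp; ring] at this
    linarith

theorem score_eq_zero (h : IsRegularPotential L M m V) (hn : 0 < n) (hθ : IsMLE V hatθ)
    (x : Fin n → Euc d) : score V x (hatθ x) = 0 := by
  have hM := h.M_pos
  have hn' : (0 : ℝ) < n := by exact_mod_cast hn
  set S := score V x (hatθ x)
  have key : ∀ u : Euc d, ⟪S, u⟫ ≤ n * (M * ‖u‖ ^ 2) := fun u => by
    have h1 := hθ x (hatθ x + u)
    have h2 : ∑ j, V (x j - (hatθ x + u)) ≤ ∑ j, (V (x j - hatθ x) -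
        ⟪gradient V (x j - hatθ x), u⟫ + M * ‖u‖ ^ 2) := Finset.sum_le_sum fun j _ => by
      have := h.taylor_le (x j - hatθ x) u
      rwa [sub_sub] at this
    rw [Finset.sum_add_distrib, Finset.sum_sub_distrib, ← sum_inner] at h2
    have h3 := h1.trans h2
    simp only [Finset.sum_const, Finset.card_univ, Fintype.card_fin, nsmul_eq_mul] at h3
    change _ ≤ _ - ⟪S, u⟫ + _ at h3
    linarith
  have := key ((1 / (2 * n * M)) • S)
  rw [inner_smul_right, real_inner_self_eq_norm_sq, norm_smul, mul_pow,
    Real.norm_of_nonneg (by positivity)] at this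
  have e : n * (M * ((1 / (2 * n * M)) ^ 2 * ‖S‖ ^ 2)) = (1 / (2 * n * M)) * ‖S‖ ^ 2 / 2 := by
    field_simp
  rw [e] at this
  have h5 : 1 / (2 * n * M) * ‖S‖ ^ 2 ≤ 0 := by linarith
  have h6 : 0 < 1 / (2 * n * M) := by positivity
  have h7 : ‖S‖ ^ 2 ≤ 0 := nonpos_of_mul_nonpos_right h5 h6
  have : ‖S‖ = 0 := by nlinarith [norm_nonneg S]
  exact norm_eq_zero.1 this

theorem eq_of_sum_le (h : IsRegularPotential L M m V) (hn : 0 < n) {x : Fin n → Euc d}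
    {c c' : Euc d} (hc : ∀ θ', ∑ j, V (x j - c) ≤ ∑ j, V (x j - θ'))
    (hc' : ∑ j, V (x j - c') ≤ ∑ j, V (x j - c)) : c' = c := by
  by_contra hne
  have hlt : ∑ j, V (x j - ((1 / 2 : ℝ) • c + (1 / 2 : ℝ) • c')) <
      ∑ j, ((1 / 2 : ℝ) • V (x j - c) + (1 / 2 : ℝ) • V (x j - c')) := by
    refine Finset.sum_lt_sum_of_nonempty ⟨⟨0, hn⟩, Finset.mem_univ _⟩ fun j _ => ?_
    have := h.strictConvexOn.2 (x := x j - c) trivial (y := x j - c') trivial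
      (by simpa [eq_comm] using hne) (by norm_num : (0 : ℝ) < 1 / 2)
      (by norm_num : (0 : ℝ) < 1 / 2) (by norm_num)
    refine lt_of_eq_of_lt ?_ this
    congr 1
    module
  rw [Finset.sum_add_distrib, ← Finset.smul_sum, ← Finset.smul_sum, smul_eq_mul, smul_eq_mul] at hlt
  linarith [hc ((1 / 2 : ℝ) • c + (1 / 2 : ℝ) • c')]

theorem estimator_add (h : IsRegularPotential L M m V) (hn : 0 < n) (hθ : IsMLE V hatθ)
    (θ : Euc d) (x : Fin n → Euc d) : hatθ (fun j => θ + x j) = θ + hatθ x := by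
  refine (h.eq_of_sum_le hn (hθ _) ?_).symm
  have := hθ x (hatθ (fun j => θ + x j) - θ)
  refine le_trans (le_of_eq ?_) (this.trans (le_of_eq ?_))
  · simp
  · refine Finset.sum_congr rfl fun j _ => ?_
    congr 1
    abel

theorem continuous_estimator (h : IsRegularPotential L M m V) (hn : 0 < n) (hθ : IsMLE V hatθ) :
    Continuous hatθ := by
  have hV := h.continuous
  rw [continuous_iff_continuousAt]
  intro x0
  rw [ContinuousAt, Metric.tendsto_nhds]
  intro ε hε
  set Φ : (Fin n → Euc d) → Euc d → ℝ := fun x c => ∑ j, V (x j - c) with hΦ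
  have hΦc : Continuous fun z : (Fin n → Euc d) × Euc d => Φ z.1 z.2 := by fun_prop
  have hev := (isCompact_sphere (hatθ x0) ε).eventually_forall_of_forall_eventually
    (x₀ := x0) (P := fun x c => Φ x (hatθ x0) < Φ x c) fun c hc => by
      have hlt : Φ x0 (hatθ x0) < Φ x0 c := by
        refine lt_of_le_of_ne (hθ x0 c) fun heq => ?_
        have := h.eq_of_sum_le hn (hθ x0) heq.ge
        rw [this, mem_sphere_iff_norm, sub_self, norm_zero] at hc
        exact hε.ne hc
      have h1 : Continuous fun z : (Fin n → Euc d) × Euc d => Φ z.1 (hatθ x0) :=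
        hΦc.comp (continuous_fst.prodMk continuous_const)
      exact (h1.continuousAt (x := (x0, c))).eventually_lt hΦc.continuousAt hlt
  filter_upwards [hev] with x hx
  by_contra hge
  rw [not_lt, dist_eq_norm] at hge
  set D := hatθ x - hatθ x0
  have hD : 0 < ‖D‖ := hε.trans_le hge
  have h1 := hx (hatθ x0 + (ε / ‖D‖) • D) (by
    rw [mem_sphere_iff_norm, add_sub_cancel_left, norm_smul, Real.norm_of_nonneg (by positivity)]
    field_simp)
  have ht : ε / ‖D‖ ≤ 1 := by rwa [div_le_one hD]
  set t := ε / ‖D‖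
  have h2 : Φ x (hatθ x0 + t • D) ≤ (1 - t) * Φ x (hatθ x0) + t * Φ x (hatθ x) := by
    simp only [hΦ, Finset.mul_sum, ← Finset.sum_add_distrib]
    refine Finset.sum_le_sum fun j _ => ?_
    have := h.strictConvexOn.convexOn.2 (x := x j - hatθ x0) trivial (y := x j - hatθ x) trivial
      (by linarith : 0 ≤ 1 - t) (by positivity : 0 ≤ t) (by ring)
    refine le_trans (le_of_eq ?_) this
    congr 1
    simp only [D]
    module
  have h3 : Φ x (hatθ x) ≤ Φ x (hatθ x0) := hθ x (hatθ x0)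
  have h4 : 0 ≤ t := by positivity
  nlinarith

theorem exists_gradient_eq_zero (h : IsRegularPotential L M m V) (hn : 0 < n)
    (hθ : IsMLE V hatθ) : ∃ a, gradient V a = 0 := by
  have h0 := h.score_eq_zero hn hθ (fun _ => 0)
  refine ⟨0 - hatθ (fun _ => 0), ?_⟩
  rw [score, Finset.sum_const, Finset.card_univ, Fintype.card_fin, ← Nat.cast_smul_eq_nsmul ℝ] at h0
  exact (smul_eq_zero.1 h0).resolve_left (by exact_mod_cast hn.ne')

theorem integral_sampleMeasure (h : IsRegularPotential L M m V) (θ : Euc d)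
    (g : (Fin n → Euc d) → ℝ) :
    ∫ x, g x ∂ sampleMeasure V n θ = ∫ x, g (fun j => θ + x j) ∂ noiseSample V n := by
  have := h.isProbabilityMeasure
  have e : sampleMeasure V n θ = (noiseSample V n).map (fun x j => θ + x j) := by
    rw [noiseSample, Measure.pi_map_pi fun _ => by fun_prop]
    rfl
  rw [e]
  exact (measurableEmbedding_addLeft (fun _ : Fin n => θ)).integral_map g

theorem Texp_eq (h : IsRegularPotential L M m V) (hn : 0 < n) (hθ : IsMLE V hatθ)
    (g : Euc d → ℝ) (θ : Euc d) :
    Texp V n hatθ g θ = ∫ x, g (θ + hatθ x) ∂ noiseSample V n := by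
  rw [Texp, h.integral_sampleMeasure]
  simp only [h.estimator_add hn hθ]

end IsRegularPotential

/-- The radius, per observation, allowed for the score on the good event. -/
def scoreRadius (L m : ℝ) : ℝ := m ^ 2 / (32 * L)

/-- The event on which the empirical Hessian and the score are controlled. -/
structure IsGood (L m : ℝ) {d n : ℕ} (V : Euc d → ℝ) (z : Fin n → Euc d) : Prop where
  hessDev_le : hessDev V z ≤ m / 2 * n
  norm_score_le : ‖score V z 0‖ ≤ scoreRadius L m * n

/-- A moment-type majorant of the indicator of the complement of the good event. -/
def badWeight (L m : ℝ) (p : ℕ) {d n : ℕ} (V : Euc d → ℝ) (z : Fin n → Euc d) : ℝ :=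
  (2 / (m * n) * hessDev V z) ^ (2 * p) + (1 / (scoreRadius L m * n) * ‖score V z 0‖) ^ (2 * p)

/-- The constant in the bound for the mean of `badWeight`. -/
def badConst (L M m : ℝ) (p : ℕ) : ℝ :=
  boundedMomentConst p * (16 * M ^ 2 / m ^ 2) ^ p +
    subgaussianMomentConst p * (2 * M / scoreRadius L m ^ 2) ^ p

/-- The constant in the bound for the mean of `badWeight` at a perturbed sample. -/
def badUpdateConst (L M m : ℝ) (p : ℕ) : ℝ :=
  4 ^ p * (badConst L M m p + (64 * M ^ 2 / m ^ 2) ^ p +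
    subgaussianMomentConst p * (2 * M / scoreRadius L m ^ 2) ^ p)

theorem add_pow_two_mul_le {a b : ℝ} (ha : 0 ≤ a) (hb : 0 ≤ b) (p : ℕ) :
    (a + b) ^ (2 * p) ≤ 4 ^ p * (a ^ (2 * p) + b ^ (2 * p)) := by
  refine (add_pow_le ha hb _).trans ?_
  gcongr
  calc (2 : ℝ) ^ (2 * p - 1) ≤ 2 ^ (2 * p) := pow_le_pow_right₀ (by norm_num) (by omega)
    _ = 4 ^ p := by rw [pow_mul]; norm_num

theorem score_update {d n : ℕ} (V : Euc d → ℝ) (x : Fin n → Euc d) (i : Fin n) (a c : Euc d) :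
    score V (Function.update x i a) c = score V x c + (gradient V (a - c) - gradient V (x i - c)) := by
  rw [score, score, ← Finset.add_sum_erase _ _ (Finset.mem_univ i), ← Finset.add_sum_erase (a := i)
    (f := fun j => gradient V (x j - c)) _ (Finset.mem_univ i)]
  rw [Finset.sum_congr rfl fun j hj => by
    rw [Function.update_of_ne (Finset.ne_of_mem_erase hj)], Function.update_self]
  abel

namespace IsRegularPotential

variable {L M m : ℝ} {d n : ℕ} {V : Euc d → ℝ} {hatθ : (Fin n → Euc d) → Euc d}

theorem scoreRadius_pos (h : IsRegularPotential L M m V) : 0 < scoreRadius L m := by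
  have := h.L_pos; have := h.m_pos
  unfold scoreRadius; positivity

theorem badWeight_nonneg (h : IsRegularPotential L M m V) (p : ℕ) (z : Fin n → Euc d) :
    0 ≤ badWeight L m p V z := by
  have := h.scoreRadius_pos; have := h.m_pos; have := hessDev_nonneg V z
  unfold badWeight; positivity

theorem one_le_badWeight (h : IsRegularPotential L M m V) (hn : 0 < n) (p : ℕ)
    {z : Fin n → Euc d} (hz : ¬ IsGood L m V z) : 1 ≤ badWeight L m p V z := by
  have h1 := h.scoreRadius_pos; have h2 := h.m_pos; have h3 := hessDev_nonneg V z
  have hn' : (0 : ℝ) < n := by exact_mod_cast hn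
  by_cases hd : hessDev V z ≤ m / 2 * n
  · have hs : scoreRadius L m * n < ‖score V z 0‖ := by
      by_contra hs; exact hz ⟨hd, not_lt.1 hs⟩
    have : 1 ≤ 1 / (scoreRadius L m * n) * ‖score V z 0‖ := by
      rw [one_div_mul_eq_div, one_le_div (by positivity)]; exact hs.le
    have := one_le_pow₀ this (n := 2 * p)
    have : 0 ≤ (2 / (m * n) * hessDev V z) ^ (2 * p) := by positivity
    unfold badWeight; linarith
  · have : 1 ≤ 2 / (m * n) * hessDev V z := by
      rw [div_mul_eq_mul_div, one_le_div (by positivity)]; linarith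
    have := one_le_pow₀ this (n := 2 * p)
    have : 0 ≤ (1 / (scoreRadius L m * n) * ‖score V z 0‖) ^ (2 * p) := by positivity
    unfold badWeight; linarith

theorem IsGood.le_sum_inner_hess (h : IsRegularPotential L M m V) {z : Fin n → Euc d}
    (hz : IsGood L m V z) (u : Euc d) : m / 2 * n * ‖u‖ ^ 2 ≤ ∑ j, ⟪hess V (z j) u, u⟫ := by
  have h1 := norm_sum_hess_sub_le V z u
  have h2 := neg_le_of_abs_le (abs_real_inner_le_norm ((∑ j, hess V (z j) u) - (n : ℝ) • meanHess V u) u)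
  rw [inner_sub_left, inner_smul_left, conj_trivial, sum_inner] at h2
  have h3 := mul_le_mul_of_nonneg_left (h.le_inner_meanHess u) (Nat.cast_nonneg n : (0 : ℝ) ≤ n)
  have h4 : ‖(∑ j, hess V (z j) u) - (n : ℝ) • meanHess V u‖ * ‖u‖ ≤ (m / 2 * n * ‖u‖) * ‖u‖ := by
    gcongr
    exact h1.trans (mul_le_mul_of_nonneg_right hz.hessDev_le (norm_nonneg _))
  nlinarith

theorem IsGood.norm_estimator_le (h : IsRegularPotential L M m V) (hn : 0 < n)
    (hθ : IsMLE V hatθ) {z : Fin n → Euc d} (hz : IsGood L m V z) :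
    ‖hatθ z‖ ≤ 4 / (m * n) * ‖score V z 0‖ := by
  have hm := h.m_pos
  have hL := h.L_pos
  have hn' : (0 : ℝ) < n := by exact_mod_cast hn
  have h0 := h.score_eq_zero hn hθ z
  have := h.norm_le_of_score_eq_zero hn (x := z) (c := 0) (Δ := hatθ z) (κ := m / 2)
    (by positivity) (fun u => by simpa using IsGood.le_sum_inner_hess h hz u) (by rwa [zero_add]) (by
      refine hz.norm_score_le.trans_lt ?_
      have e : (n : ℝ) * (m / 2) ^ 2 / (4 * L) = 2 * (m ^ 2 / (32 * L) * n) := by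
        field_simp; norm_num
      have : 0 < m ^ 2 / (32 * L) * n := by positivity
      rw [scoreRadius, e]
      linarith)
  refine this.trans (le_of_eq ?_)
  field_simp
  ring

theorem IsGood.norm_estimator_le_radius (h : IsRegularPotential L M m V) (hn : 0 < n)
    (hθ : IsMLE V hatθ) {z : Fin n → Euc d} (hz : IsGood L m V z) : ‖hatθ z‖ ≤ m / (8 * L) := by
  have hm := h.m_pos
  have hL := h.L_pos
  have hn' : (0 : ℝ) < n := by exact_mod_cast hn
  refine (IsGood.norm_estimator_le h hn hθ hz).trans
    ((mul_le_mul_of_nonneg_left hz.norm_score_le (by positivity)).trans (le_of_eq ?_))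
  rw [scoreRadius]
  field_simp
  norm_num

theorem continuous_score (h : IsRegularPotential L M m V) (n : ℕ) :
    Continuous fun x : Fin n → Euc d => score V x 0 := by
  have := h.continuous_gradient
  unfold score
  fun_prop

theorem continuous_badWeight (h : IsRegularPotential L M m V) (n p : ℕ) :
    Continuous fun x : Fin n → Euc d => badWeight L m p V x := by
  have := h.continuous_hessDev n
  have := h.continuous_score n
  unfold badWeight
  fun_prop

theorem integral_badWeight_le (h : IsRegularPotential L M m V) (hn : 0 < n) (p : ℕ) :
    Integrable (fun x => badWeight L m p V x) (noiseSample V n) ∧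
    ∫ x, badWeight L m p V x ∂ noiseSample V n ≤ badConst L M m p * (d / n : ℝ) ^ p := by
  have h1 := h.scoreRadius_pos; have h2 := h.m_pos
  have hn' : (0 : ℝ) < n := by exact_mod_cast hn
  obtain ⟨i1, j1⟩ := h.integral_hessDev_pow_le n p
  obtain ⟨i2, j2⟩ := h.integral_norm_score_pow_le n p
  have i1' := i1.const_mul ((2 / (m * n)) ^ (2 * p))
  have i2' := i2.const_mul ((1 / (scoreRadius L m * n)) ^ (2 * p))
  have e : (fun x => badWeight L m p V x) = fun x : Fin n → Euc d =>
      (2 / (m * n)) ^ (2 * p) * hessDev V x ^ (2 * p) +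
        (1 / (scoreRadius L m * n)) ^ (2 * p) * ‖score V x 0‖ ^ (2 * p) := by
    ext x; rw [badWeight, mul_pow, mul_pow]
  rw [e]
  refine ⟨i1'.add i2', ?_⟩
  rw [integral_add i1' i2', integral_const_mul, integral_const_mul, badConst, add_mul]
  refine add_le_add ((mul_le_mul_of_nonneg_left j1 (by positivity)).trans (le_of_eq ?_))
    ((mul_le_mul_of_nonneg_left j2 (by positivity)).trans (le_of_eq ?_))
  · rw [mul_left_comm, pow_mul, ← mul_pow, mul_assoc (boundedMomentConst p), ← mul_pow]
    congr 2
    field_simp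
    ring
  · rw [mul_left_comm, pow_mul, ← mul_pow, mul_assoc (subgaussianMomentConst p), ← mul_pow]
    congr 2
    field_simp

theorem badWeight_update_le (h : IsRegularPotential L M m V) (p : ℕ)
    (x : Fin n → Euc d) (i : Fin n) {a : Euc d} (ha : gradient V a = 0) :
    badWeight L m p V (Function.update x i a) ≤ 4 ^ p * (badWeight L m p V x +
      (2 / (m * n) * (√d * (4 * M))) ^ (2 * p) +
      (1 / (scoreRadius L m * n)) ^ (2 * p) * ‖gradient V (x i)‖ ^ (2 * p)) := by
  have h1 := h.scoreRadius_pos; have h2 := h.m_pos; have h3 := h.M_pos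
  have h4 := hessDev_nonneg V x; have h5 := hessDev_nonneg V (Function.update x i a)
  have e1 : (2 / (m * n) * hessDev V (Function.update x i a)) ^ (2 * p) ≤
      (2 / (m * n) * hessDev V x + 2 / (m * n) * (√d * (4 * M))) ^ (2 * p) := by
    rw [← mul_add]
    gcongr
    exact h.hessDev_update_le x i a
  have e2 : (1 / (scoreRadius L m * n) * ‖score V (Function.update x i a) 0‖) ^ (2 * p) ≤
      (1 / (scoreRadius L m * n) * ‖score V x 0‖ +
        1 / (scoreRadius L m * n) * ‖gradient V (x i)‖) ^ (2 * p) := by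
    rw [← mul_add]
    gcongr
    rw [score_update, sub_zero, sub_zero, ha, zero_sub, ← sub_eq_add_neg]
    exact _root_.norm_sub_le _ _
  have e3 := e1.trans (add_pow_two_mul_le (by positivity) (by positivity) p)
  have e4 := e2.trans (add_pow_two_mul_le (by positivity) (by positivity) p)
  rw [mul_pow _ ‖gradient V (x i)‖] at e4
  unfold badWeight
  refine (add_le_add e3 e4).trans (le_of_eq ?_)
  ring

theorem integral_badWeight_update_le (h : IsRegularPotential L M m V) (hn : 0 < n) (p : ℕ)
    (i : Fin n) {a : Euc d} (ha : gradient V a = 0) :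
    Integrable (fun x => badWeight L m p V (Function.update x i a)) (noiseSample V n) ∧
    ∫ x, badWeight L m p V (Function.update x i a) ∂ noiseSample V n ≤
      badUpdateConst L M m p * (d / n : ℝ) ^ p := by
  have hr := h.scoreRadius_pos; have h2 := h.m_pos
  have hM := h.M_pos
  have hn' : (0 : ℝ) < n := by exact_mod_cast hn
  have hn1 : (1 : ℝ) ≤ n := by exact_mod_cast hn
  have := h.isProbabilityMeasure
  have := h.isProbabilityMeasure_noiseSample n
  obtain ⟨i1, j1⟩ := h.integral_badWeight_le hn p
  obtain ⟨i2, j2⟩ := h.integral_norm_gradient_pow_le p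
  have i3 : Integrable (fun x : Fin n → Euc d => ‖gradient V (x i)‖ ^ (2 * p)) (noiseSample V n) :=
    integrable_comp_eval (μ := fun _ : Fin n => noiseMeasure V) (i := i) i2
  have j3 : ∫ x : Fin n → Euc d, ‖gradient V (x i)‖ ^ (2 * p) ∂ noiseSample V n ≤
      subgaussianMomentConst p * (2 * M * d) ^ p :=
    (integral_comp_eval (μ := fun _ : Fin n => noiseMeasure V) (i := i)
      (f := fun x => ‖gradient V x‖ ^ (2 * p)) i2.aestronglyMeasurable).le.trans j2
  have i4 := i3.const_mul ((1 / (scoreRadius L m * n)) ^ (2 * p))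
  have i5 := i1.fun_add (integrable_const ((2 / (m * n) * (√d * (4 * M))) ^ (2 * p)))
  have i6 := (i5.fun_add i4).const_mul (4 ^ p)
  have hc : Continuous fun x : Fin n → Euc d => badWeight L m p V (Function.update x i a) :=
    (h.continuous_badWeight n p).comp (continuous_id.update i continuous_const)
  have hpt := fun x => h.badWeight_update_le (n := n) p x i ha
  have hI : Integrable (fun x => badWeight L m p V (Function.update x i a)) (noiseSample V n) := by
    refine i6.mono' hc.aestronglyMeasurable (.of_forall fun x => ?_)
    rw [Real.norm_of_nonneg (h.badWeight_nonneg p _)]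
    exact hpt x
  refine ⟨hI, (integral_mono hI i6 hpt).trans ?_⟩
  rw [integral_const_mul, integral_add i5 i4, integral_add i1 (integrable_const _),
    integral_const_mul, badUpdateConst, mul_assoc]
  simp only [integral_const, probReal_univ, one_smul]
  have hdn : (d : ℝ) / n ^ 2 ≤ d / n := by
    gcongr
    nlinarith
  gcongr
  rw [add_mul, add_mul]
  refine add_le_add (add_le_add j1 ?_) ?_
  · rw [pow_mul, ← mul_pow]
    gcongr
    rw [mul_pow, mul_pow √d, Real.sq_sqrt (Nat.cast_nonneg d)]
    calc _ = 64 * M ^ 2 / m ^ 2 * (d / n ^ 2) := by field_simp; ring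
      _ ≤ _ := by gcongr
  · refine (mul_le_mul_of_nonneg_left j3 (by positivity)).trans ?_
    have := one_le_subgaussianMomentConst p
    calc _ = subgaussianMomentConst p * (2 * M / scoreRadius L m ^ 2 * (d / n ^ 2)) ^ p := by
          rw [mul_left_comm, pow_mul, ← mul_pow]
          congr 2
          field_simp
      _ ≤ subgaussianMomentConst p * (2 * M / scoreRadius L m ^ 2 * (d / n)) ^ p := by gcongr
      _ = _ := by rw [mul_pow, mul_assoc]

end IsRegularPotential

theorem div_pow_le_of_le_rpow {d n p : ℕ} (hn : 0 < n) {c1 α : ℝ}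
    (hp : 2 ≤ (1 - α) * p) (hd : (d : ℝ) ≤ c1 * (n : ℝ) ^ α) :
    ((d : ℝ) / n) ^ p ≤ c1 ^ p / n ^ 2 := by
  have hn' : (0 : ℝ) < n := by exact_mod_cast hn
  have hn1 : (1 : ℝ) ≤ n := by exact_mod_cast hn
  have h1 : (d : ℝ) / n ≤ c1 * (n : ℝ) ^ (α - 1) := by
    rw [Real.rpow_sub_one hn'.ne', ← mul_div_assoc]; gcongr
  have hc : 0 ≤ c1 := by
    by_contra hc
    have : c1 * (n : ℝ) ^ α < 0 := mul_neg_of_neg_of_pos (not_le.1 hc) (by positivity)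
    linarith [(Nat.cast_nonneg d : (0 : ℝ) ≤ d)]
  calc ((d : ℝ) / n) ^ p ≤ (c1 * (n : ℝ) ^ (α - 1)) ^ p := by gcongr
    _ = c1 ^ p * (n : ℝ) ^ ((α - 1) * p) := by
        rw [mul_pow, ← Real.rpow_natCast ((n : ℝ) ^ (α - 1)), ← Real.rpow_mul hn'.le]
    _ ≤ c1 ^ p * (n : ℝ) ^ (-(2 : ℕ) : ℝ) := by
        gcongr
        push_cast; linarith
    _ = _ := by rw [Real.rpow_neg hn'.le, Real.rpow_natCast, div_eq_mul_inv]

theorem integrable_of_abs_le {α : Type*} [MeasurableSpace α] {μ : Measure α} [IsFiniteMeasure μ]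
    {F : α → ℝ} {K : ℝ} (hF : Measurable F) (hK : ∀ x, |F x| ≤ K) : Integrable F μ :=
  Integrable.of_bound hF.aestronglyMeasurable K (.of_forall hK)

theorem sq_integral_sub_le {α : Type*} [MeasurableSpace α] (μ : Measure α) [IsProbabilityMeasure μ]
    {F : α → ℝ} {K : ℝ} (hF : Measurable F) (hK : ∀ x, |F x| ≤ K) (b : ℝ) :
    (∫ x, F x ∂μ) ^ 2 - 2 * b * ∫ x, F x ∂μ + b ^ 2 ≤ ∫ x, (F x - b) ^ 2 ∂μ ∧
    ∫ x, (F x - b) ^ 2 ∂μ = ∫ x, F x ^ 2 ∂μ - 2 * b * ∫ x, F x ∂μ + b ^ 2 := by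
  have hi := integrable_of_abs_le (μ := μ) hF hK
  have hi2 : Integrable (fun x => F x ^ 2) μ := integrable_of_abs_le (K := K ^ 2) (hF.pow_const 2)
    fun x => by
      rw [abs_pow]
      exact pow_le_pow_left₀ (abs_nonneg _) (hK x) 2
  have key : ∀ c : ℝ, ∫ x, (F x - c) ^ 2 ∂μ = ∫ x, F x ^ 2 ∂μ - 2 * c * ∫ x, F x ∂μ + c ^ 2 := by
    intro c
    have e : (fun x => (F x - c) ^ 2) = fun x => (F x ^ 2 - 2 * c * F x) + c ^ 2 := by
      ext x; ring
    have j1 : Integrable (fun x => F x ^ 2 - 2 * c * F x) μ := hi2.sub (hi.const_mul _)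
    rw [e, integral_add j1 (integrable_const _), integral_sub hi2 (hi.const_mul _),
      integral_const_mul]
    simp
  have h0 : 0 ≤ ∫ x, (F x - ∫ y, F y ∂μ) ^ 2 ∂μ := integral_nonneg fun x => sq_nonneg _
  rw [key] at h0
  refine ⟨?_, key b⟩
  rw [key b]
  nlinarith

theorem measurePreserving_update {E : Type*} [MeasurableSpace E] (μ : Measure E)
    [IsProbabilityMeasure μ] {n : ℕ} (i : Fin n) :
    MeasurePreserving (fun z : (Fin n → E) × E => Function.update z.1 i z.2)
      ((Measure.pi fun _ => μ).prod μ) (Measure.pi fun _ => μ) := by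
  have hm : Measurable fun z : (Fin n → E) × E => Function.update z.1 i z.2 := by
    refine measurable_pi_iff.2 fun j => ?_
    by_cases hj : j = i
    · subst hj; simpa using measurable_snd
    · simp only [Function.update_of_ne hj]
      exact (measurable_pi_apply j).comp measurable_fst
  refine ⟨hm, (Measure.pi_eq fun s hs => ?_).symm⟩
  rw [Measure.map_apply hm (MeasurableSet.univ_pi hs)]
  have e : (fun z : (Fin n → E) × E => Function.update z.1 i z.2) ⁻¹' Set.univ.pi s =
      (Set.univ.pi (Function.update s i Set.univ)) ×ˢ s i := by
    ext z
    simp only [Set.mem_preimage, Set.mem_pi, Set.mem_univ, true_implies, Set.mem_prod]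
    constructor
    · intro hz
      refine ⟨fun j => ?_, by simpa using hz i⟩
      by_cases hj : j = i
      · subst hj; simp
      · simpa [Function.update_of_ne hj] using hz j
    · rintro ⟨h1, h2⟩ j
      by_cases hj : j = i
      · subst hj; simpa using h2
      · simpa [Function.update_of_ne hj] using h1 j
  rw [e, Measure.prod_prod, Measure.pi_pi, ← Finset.mul_prod_erase _ _ (Finset.mem_univ i),
    ← Finset.mul_prod_erase (a := i) (f := fun j => μ (s j)) _ (Finset.mem_univ i)]
  rw [Finset.prod_congr rfl fun j hj => by
    rw [Function.update_of_ne (Finset.ne_of_mem_erase hj)], Function.update_self, measure_univ,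
    one_mul, mul_comm]

theorem measurable_update_const {E : Type*} [MeasurableSpace E] {n : ℕ} (i : Fin n) (a : E) :
    Measurable fun x : Fin n → E => Function.update x i a := by
  refine measurable_pi_iff.2 fun j => ?_
  by_cases hj : j = i
  · subst hj; simp
  · simpa only [Function.update_of_ne hj] using measurable_pi_apply j

/-- The Efron–Stein inequality, with a fixed reference value in place of an independent copy. -/
theorem integral_sq_sub_sq_integral_le {E : Type*} [MeasurableSpace E] (μ : Measure E)
    [IsProbabilityMeasure μ] (a : E) {K : ℝ} (n : ℕ) :
    ∀ F : (Fin n → E) → ℝ, Measurable F → (∀ x, |F x| ≤ K) →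
    ∫ x, F x ^ 2 ∂(Measure.pi fun _ => μ) - (∫ x, F x ∂(Measure.pi fun _ => μ)) ^ 2 ≤
      ∑ i, ∫ x, (F x - F (Function.update x i a)) ^ 2 ∂(Measure.pi fun _ => μ) := by
  induction n with
  | zero =>
    intro F hF hK
    have : F = fun _ => F fun _ => a := funext fun x => by
      rw [Subsingleton.elim x fun _ => a]
    rw [this]
    simp
  | succ n ih =>
    intro F hF hK
    set P := (Measure.pi fun _ : Fin n => μ) with hP
    set F' : E × (Fin n → E) → ℝ := fun z => F (Fin.cons z.1 z.2) with hF'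
    have hK0 : 0 ≤ K := (abs_nonneg _).trans (hK fun _ => a)
    have hcons := (measurePreserving_cons μ n).measurable
    have mF : Measurable F' := hF.comp hcons
    have hKF : ∀ z, |F' z| ≤ K := fun z => hK _
    have mF2 : ∀ y, Measurable fun x => F' (x, y) := fun y => mF.comp (by fun_prop)
    set H : (Fin n → E) → ℝ := fun y => ∫ x, F' (x, y) ∂μ with hH
    have mH : Measurable H := by
      have := (mF.comp measurable_swap).stronglyMeasurable.integral_prod_right' (ν := μ)
      exact this.measurable
    have hKH : ∀ y, |H y| ≤ K := fun y => by
      have := norm_integral_le_of_norm_le_const (μ := μ) (f := fun x => F' (x, y)) (C := K)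
        (.of_forall fun x => hKF _)
      simpa using this
    have sq_bd : ∀ {u v : ℝ}, |u| ≤ K → |v| ≤ K → |(u - v) ^ 2| ≤ (2 * K) ^ 2 := by
      intro u v hu hv
      rw [abs_pow]
      exact pow_le_pow_left₀ (abs_nonneg _) ((abs_sub _ _).trans (by linarith)) 2
    -- the integrals over the product
    have swap : ∀ G : E × (Fin n → E) → ℝ, Measurable G → (∃ C, ∀ z, |G z| ≤ C) →
        ∫ z, G z ∂(μ.prod P) = ∫ y, ∫ x, G (x, y) ∂μ ∂P := by
      rintro G mG ⟨C, hC⟩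
      exact integral_prod_symm G (integrable_of_abs_le mG hC)
    have hIH := ih H mH hKH
    have e1 : ∫ x, F x ∂(Measure.pi fun _ => μ) = ∫ y, H y ∂P := by
      rw [integral_pi_succ]
      exact swap F' mF ⟨K, hKF⟩
    have e2 : ∫ x, F x ^ 2 ∂(Measure.pi fun _ => μ) = ∫ y, ∫ x, F' (x, y) ^ 2 ∂μ ∂P := by
      rw [integral_pi_succ]
      refine swap (fun z => F' z ^ 2) (mF.pow_const 2) ⟨K ^ 2, fun z => ?_⟩
      rw [abs_pow]
      exact pow_le_pow_left₀ (abs_nonneg _) (hKF z) 2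
    have e3 : ∫ x, (F x - F (Function.update x 0 a)) ^ 2 ∂(Measure.pi fun _ => μ) =
        ∫ y, ∫ x, (F' (x, y) - F' (a, y)) ^ 2 ∂μ ∂P := by
      rw [integral_pi_succ]
      simp only [Fin.update_cons_zero]
      exact swap (fun z => (F' z - F' (a, z.2)) ^ 2)
        ((mF.sub (mF.comp (by fun_prop))).pow_const 2) ⟨_, fun z => sq_bd (hKF _) (hKF _)⟩
    have e4 : ∀ i : Fin n, ∫ x, (F x - F (Function.update x i.succ a)) ^ 2
        ∂(Measure.pi fun _ => μ) =
        ∫ y, ∫ x, (F' (x, y) - F' (x, Function.update y i a)) ^ 2 ∂μ ∂P := by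
      intro i
      rw [integral_pi_succ]
      simp only [← Fin.cons_update]
      exact swap (fun z => (F' z - F' (z.1, Function.update z.2 i a)) ^ 2)
        ((mF.sub (mF.comp (measurable_fst.prodMk
          ((measurable_update_const i a).comp measurable_snd)))).pow_const 2)
        ⟨_, fun z => sq_bd (hKF _) (hKF _)⟩
    have mInner : ∀ G : E × (Fin n → E) → ℝ, Measurable G → (∃ C, ∀ z, |G z| ≤ C) →
        Integrable (fun y => ∫ x, G (x, y) ∂μ) P := by
      rintro G mG ⟨C, hC⟩
      exact (integrable_of_abs_le mG hC).integral_prod_right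
    have iS : Integrable (fun y => ∫ x, F' (x, y) ^ 2 ∂μ) P :=
      mInner (fun z => F' z ^ 2) (mF.pow_const 2) ⟨K ^ 2, fun z => by
        rw [abs_pow]; exact pow_le_pow_left₀ (abs_nonneg _) (hKF z) 2⟩
    have iH : Integrable (fun y => H y ^ 2) P :=
      integrable_of_abs_le (mH.pow_const 2) (K := K ^ 2) fun y => by
        rw [abs_pow]; exact pow_le_pow_left₀ (abs_nonneg _) (hKH y) 2
    rw [Fin.sum_univ_succ, e1, e2, e3]
    simp only [e4]
    have s1 : ∫ y, ∫ x, F' (x, y) ^ 2 ∂μ ∂P - ∫ y, H y ^ 2 ∂P ≤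
        ∫ y, ∫ x, (F' (x, y) - F' (a, y)) ^ 2 ∂μ ∂P := by
      rw [← integral_sub iS iH]
      refine integral_mono (iS.sub iH) (mInner (fun z => (F' z - F' (a, z.2)) ^ 2)
        ((mF.sub (mF.comp (by fun_prop))).pow_const 2) ⟨_, fun z => sq_bd (hKF _) (hKF _)⟩) ?_
      intro y
      have := (sq_integral_sub_le μ (mF2 y) (fun x => hKF (x, y)) (F' (a, y))).2
      dsimp only
      rw [this]
      have : 0 ≤ (H y - F' (a, y)) ^ 2 := sq_nonneg _
      change _ ≤ _ - 2 * F' (a, y) * H y + _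
      nlinarith
    have s2 : ∀ i : Fin n, ∫ y, (H y - H (Function.update y i a)) ^ 2 ∂P ≤
        ∫ y, ∫ x, (F' (x, y) - F' (x, Function.update y i a)) ^ 2 ∂μ ∂P := by
      intro i
      refine integral_mono (integrable_of_abs_le
        ((mH.sub (mH.comp (measurable_update_const i a))).pow_const 2)
          fun y => sq_bd (hKH _) (hKH _)) (mInner
          (fun z => (F' z - F' (z.1, Function.update z.2 i a)) ^ 2)
          ((mF.sub (mF.comp (measurable_fst.prodMk
          ((measurable_update_const i a).comp measurable_snd)))).pow_const 2)
          ⟨_, fun z => sq_bd (hKF _) (hKF _)⟩) ?_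
      intro y
      have := (sq_integral_sub_le μ ((mF2 y).sub (mF2 (Function.update y i a))) (K := 2 * K)
        (fun x => (abs_sub _ _).trans (by linarith [hKF (x, y), hKF (x, Function.update y i a)])) 0).1
      simp only [Pi.sub_apply, sub_zero, mul_zero, zero_mul] at this
      rw [integral_sub (integrable_of_abs_le (mF2 y) fun x => hKF _)
        (integrable_of_abs_le (mF2 _) fun x => hKF _)] at this
      simpa [hH] using this
    have s3 := Finset.sum_le_sum fun i (_ : i ∈ Finset.univ) => s2 i
    linarith

/-- Efron–Stein with conditional integrals over one coordinate. -/
theorem integral_sub_sq_le_sum_update {E : Type*} [MeasurableSpace E] (μ : Measure E)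
    [IsProbabilityMeasure μ] (a : E) {K : ℝ} (n : ℕ) {F : (Fin n → E) → ℝ} (hF : Measurable F)
    (hK : ∀ x, |F x| ≤ K) :
    ∫ x, (F x - ∫ y, F y ∂(Measure.pi fun _ => μ)) ^ 2 ∂(Measure.pi fun _ => μ) ≤
      ∑ i, ∫ x, ∫ y, (F (Function.update x i y) - F (Function.update x i a)) ^ 2 ∂μ
        ∂(Measure.pi fun _ => μ) := by
  rw [(sq_integral_sub_le _ hF hK _).2]
  have h := integral_sq_sub_sq_integral_le μ a n F hF hK
  have e : ∀ i : Fin n, ∫ x, (F x - F (Function.update x i a)) ^ 2 ∂(Measure.pi fun _ => μ) =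
      ∫ x, ∫ y, (F (Function.update x i y) - F (Function.update x i a)) ^ 2 ∂μ
        ∂(Measure.pi fun _ => μ) := by
    intro i
    have mp := measurePreserving_update μ i
    have mG : Measurable fun x => (F x - F (Function.update x i a)) ^ 2 :=
      (hF.sub (hF.comp (measurable_update_const i a))).pow_const 2
    rw [← mp.map_eq, integral_map mp.measurable.aemeasurable mG.aestronglyMeasurable, mp.map_eq,
      integral_prod]
    · simp only [Function.update_idem]
    · refine integrable_of_abs_le (K := (2 * K) ^ 2) (mG.comp mp.measurable) fun z => ?_
      refine (abs_pow _ 2).trans_le (pow_le_pow_left₀ (abs_nonneg _) ((abs_sub _ _).trans ?_) 2)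
      linarith [hK (Function.update z.1 i z.2),
        hK (Function.update (Function.update z.1 i z.2) i a)]
  simp only [e] at h
  linarith

theorem exists_eq_of_coercive {E : Type*} [NormedAddCommGroup E] [InnerProductSpace ℝ E]
    [FiniteDimensional ℝ E] (A : E →L[ℝ] E) {κ : ℝ} (hκ : 0 < κ)
    (hA : ∀ u, κ * ‖u‖ ^ 2 ≤ ⟪A u, u⟫) (w : E) : ∃ v, A v = w ∧ ‖v‖ ≤ ‖w‖ / κ := by
  have hb : ∀ u, κ * ‖u‖ ≤ ‖A u‖ := fun u => by
    rcases (norm_nonneg u).eq_or_lt with hu | hu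
    · rw [← hu, mul_zero]; exact norm_nonneg _
    · have := (hA u).trans (real_inner_le_norm _ _)
      nlinarith
  have hinj : Function.Injective (A : E →ₗ[ℝ] E) := by
    rw [← LinearMap.ker_eq_bot, LinearMap.ker_eq_bot']
    intro u hu
    have := hb u
    rw [show A u = 0 from hu, norm_zero] at this
    exact norm_le_zero_iff.1 (by nlinarith [norm_nonneg u])
  obtain ⟨v, hv⟩ := LinearMap.surjective_of_injective hinj w
  have hv : A v = w := hv
  refine ⟨v, hv, ?_⟩
  rw [le_div_iff₀ hκ, mul_comm, ← hv]
  exact hb v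

theorem sum_update {E F : Type*} [AddCommGroup F] {n : ℕ} (φ : E → F) (x : Fin n → E) (i : Fin n)
    (y : E) : ∑ j, φ (Function.update x i y j) = ∑ j, φ (x j) + (φ y - φ (x i)) := by
  rw [← Finset.add_sum_erase _ _ (Finset.mem_univ i), ← Finset.add_sum_erase (a := i)
    (f := fun j => φ (x j)) _ (Finset.mem_univ i)]
  rw [Finset.sum_congr rfl fun j hj => by
    rw [Function.update_of_ne (Finset.ne_of_mem_erase hj)], Function.update_self]
  abel

/-- A bounded function with a uniformly bounded first-order expansion. -/
structure HasExpansion {E : Type*} [NormedAddCommGroup E] [InnerProductSpace ℝ E] (K : ℝ)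
    (g : E → ℝ) : Prop where
  continuous : Continuous g
  abs_le : ∀ x, |g x| ≤ K
  expansion : ∀ c, ∃ w, ‖w‖ ≤ K ∧ ∀ u, |g (c + u) - g c - ⟪w, u⟫| ≤ K * ‖u‖ ^ 2

/-- The constant in the bound for the effect of replacing one observation. -/
def incrementConst (L M m : ℝ) : ℝ :=
  4 / m + M / L + 64 * M / m ^ 2 +
    (256 * L / m ^ 3 + 64 / m ^ 2 + 64 * M / m ^ 2 + 2 * (64 * L / m ^ 2) ^ 2) *
      (8 * M ^ 2 * (m / (8 * L)) ^ 2 + 3)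

namespace IsRegularPotential

variable {L M m : ℝ} {d n : ℕ} {V : Euc d → ℝ} {hatθ : (Fin n → Euc d) → Euc d}

theorem norm_hess_apply_le (h : IsRegularPotential L M m V) (x u : Euc d) :
    ‖hess V x u‖ ≤ M * ‖u‖ :=
  ((hess V x).le_opNorm u).trans (by gcongr; exact h.norm_hess_le x)

theorem IsGood.le_sum_inner_hess_sub (h : IsRegularPotential L M m V) {z : Fin n → Euc d}
    (hz : IsGood L m V z) {c : Euc d} (hc : ‖c‖ ≤ m / (8 * L)) (u : Euc d) :
    3 * m / 8 * n * ‖u‖ ^ 2 ≤ ∑ j, ⟪hess V (z j - c) u, u⟫ := by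
  have hL := h.L_pos
  have h1 := IsGood.le_sum_inner_hess h hz u
  have h2 : ∀ j : Fin n, ⟪hess V (z j) u, u⟫ - m / 8 * ‖u‖ ^ 2 ≤ ⟪hess V (z j - c) u, u⟫ := by
    intro j
    have h3 : |⟪(hess V (z j) - hess V (z j - c)) u, u⟫| ≤ m / 8 * ‖u‖ ^ 2 := by
      refine (abs_real_inner_le_norm _ _).trans ?_
      rw [sq, ← mul_assoc]
      gcongr
      refine (ContinuousLinearMap.le_opNorm _ _).trans ?_
      gcongr
      refine (h.norm_hess_sub_le _ _).trans ?_
      rw [sub_sub_cancel]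
      refine (mul_le_mul_of_nonneg_left hc hL.le).trans (le_of_eq ?_)
      field_simp
    rw [_root_.sub_apply, inner_sub_left] at h3
    linarith [le_abs_self (⟪hess V (z j) u, u⟫ - ⟪hess V (z j - c) u, u⟫)]
  have h4 := Finset.sum_le_sum fun j (_ : j ∈ Finset.univ) => h2 j
  rw [Finset.sum_sub_distrib] at h4
  simp only [Finset.sum_const, Finset.card_univ, Fintype.card_fin, nsmul_eq_mul] at h4
  linarith

set_option maxHeartbeats 1000000 in
theorem IsGood.exists_increment_le (h : IsRegularPotential L M m V) (hn : 0 < n)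
    (hnM : 16 * M ≤ m * n) (hθ : IsMLE V hatθ) {z : Fin n → Euc d} (hz : IsGood L m V z)
    {i : Fin n} (ha : gradient V (z i) = 0) {K : ℝ} {g : Euc d → ℝ} (hg : HasExpansion K g)
    (θ : Euc d) :
    ∃ v, ‖v‖ ≤ incrementConst L M m * K ∧ ∀ y : Euc d,
      n * |g (θ + hatθ (Function.update z i y)) - g (θ + hatθ z)| ≤
        |⟪gradient V y, v⟫| + incrementConst L M m * K * (1 + ‖gradient V y‖ ^ 2 / n) := by
  have hm := h.m_pos; have hL := h.L_pos; have hM := h.M_pos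
  have hn' : (0 : ℝ) < n := by exact_mod_cast hn
  have hn1 : (1 : ℝ) ≤ n := by exact_mod_cast hn
  have hK : 0 ≤ K := (abs_nonneg _).trans (hg.abs_le 0)
  set c := hatθ z with hc
  have hcR : ‖c‖ ≤ m / (8 * L) := IsGood.norm_estimator_le_radius h hn hθ hz
  obtain ⟨w, hw, hwt⟩ := hg.expansion (θ + c)
  set N : Euc d →L[ℝ] Euc d := ∑ j, hess V (z j - c) with hN
  have hNa : ∀ u, N u = ∑ j, hess V (z j - c) u := fun u => by
    rw [hN, _root_.sum_apply]
  have hNc : ∀ u, 3 * m / 8 * n * ‖u‖ ^ 2 ≤ ⟪N u, u⟫ := fun u => by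
    rw [hNa, sum_inner]; exact IsGood.le_sum_inner_hess_sub h hz hcR u
  have hNs : ∀ u v, ⟪N u, v⟫ = ⟪u, N v⟫ := fun u v => by
    rw [hNa, hNa, sum_inner, inner_sum]
    exact Finset.sum_congr rfl fun j _ => h.inner_hess_comm _ _ _
  obtain ⟨v, hv, hvn⟩ := exists_eq_of_coercive N (by positivity) hNc ((n : ℝ) • w)
  have hv4 : ‖v‖ ≤ 4 / m * K := by
    rw [norm_smul, Real.norm_of_nonneg hn'.le] at hvn
    calc ‖v‖ ≤ _ := hvn
      _ = 8 / 3 / m * ‖w‖ := by field_simp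
      _ ≤ 4 / m * K := by gcongr; norm_num
  set B := 256 * L / m ^ 3 + 64 / m ^ 2 + 64 * M / m ^ 2 + 2 * (64 * L / m ^ 2) ^ 2 with hB
  have hB0 : 0 ≤ B := by positivity
  have hC4 : 4 / m ≤ incrementConst L M m := by
    have : 0 ≤ B * (8 * M ^ 2 * (m / (8 * L)) ^ 2 + 3) := by positivity
    have : 0 ≤ M / L := by positivity
    have : 0 ≤ 64 * M / m ^ 2 := by positivity
    unfold incrementConst; linarith
  refine ⟨v, hv4.trans (by gcongr), fun y => ?_⟩
  set x := Function.update z i y with hx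
  set η := gradient V (y - c) - gradient V (z i - c) with hη
  set q := ‖gradient V y‖
  have hscore : score V x c = η := by
    have h1 := score_update V z i y c
    rw [show score V z c = 0 from h.score_eq_zero hn hθ z, zero_add] at h1
    exact h1
  have hηG : ‖η - gradient V y‖ ≤ 2 * (M * (m / (8 * L))) := by
    have e : η - gradient V y = (gradient V (y - c) - gradient V y) -
        (gradient V (z i - c) - gradient V (z i)) := by rw [ha, hη]; abel
    have hs : ∀ t : Euc d, ‖gradient V (t - c) - gradient V t‖ ≤ M * (m / (8 * L)) := fun t => by
      refine (h.norm_gradient_sub_le _ _).trans ?_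
      rw [sub_sub_cancel_left, norm_neg]
      gcongr
    rw [e]
    exact (_root_.norm_sub_le _ _).trans (by linarith [hs y, hs (z i)])
  set e := ‖η‖ with he
  have he0 : 0 ≤ e := norm_nonneg _
  have heq : e ^ 2 ≤ 2 * q ^ 2 + 8 * M ^ 2 * (m / (8 * L)) ^ 2 := by
    have h1 : e ≤ q + 2 * (M * (m / (8 * L))) := by
      have := norm_le_norm_add_norm_sub' η (gradient V y)
      linarith
    have h2 : e ^ 2 ≤ (q + 2 * (M * (m / (8 * L)))) ^ 2 := by gcongr
    nlinarith only [h2, sq_nonneg (q - 2 * (M * (m / (8 * L))))]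
  have key : n * |g (θ + hatθ x) - g (θ + c)| ≤
      |⟪gradient V y, v⟫| + K * (M / L + 64 * M / m ^ 2 + B * (e ^ 2 / n)) := by
    by_cases hs : e < n * (m / 4) ^ 2 / (4 * L)
    · have hx0 := h.score_eq_zero hn hθ x
      set Δ := hatθ x - c with hΔ
      have hxe : hatθ x = c + Δ := by rw [hΔ]; abel
      have hsum : ∀ u, ∑ j, hess V (x j - c) u =
          N u + (hess V (y - c) u - hess V (z i - c) u) := fun u => by
        rw [hNa]; exact sum_update (fun t => hess V (t - c) u) z i y
      have hrep : ∀ u, ‖hess V (y - c) u - hess V (z i - c) u‖ ≤ 2 * M * ‖u‖ := fun u =>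
        (_root_.norm_sub_le _ _).trans (by
          linarith [h.norm_hess_apply_le (y - c) u, h.norm_hess_apply_le (z i - c) u])
      have hA : ∀ u, m / 4 * n * ‖u‖ ^ 2 ≤ ∑ j, ⟪hess V (x j - c) u, u⟫ := fun u => by
        rw [← sum_inner, hsum, inner_add_left]
        have h1 := neg_le_of_abs_le ((abs_real_inner_le_norm
          (hess V (y - c) u - hess V (z i - c) u) u).trans
          (mul_le_mul_of_nonneg_right (hrep u) (norm_nonneg u)))
        have h2 := hNc u
        have h3 : 2 * M * ‖u‖ * ‖u‖ ≤ m / 8 * n * ‖u‖ ^ 2 := by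
          rw [mul_assoc, ← sq]
          exact mul_le_mul_of_nonneg_right (by linarith) (sq_nonneg _)
        linarith
      rw [hxe] at hx0
      have hΔe := h.norm_le_of_score_eq_zero hn (κ := m / 4) (by positivity) hA hx0
        (by rw [hscore]; exact hs)
      rw [hscore, ← he] at hΔe
      have hΔe : ‖Δ‖ ≤ 8 / m * (e / n) := hΔe.trans (le_of_eq (by field_simp; ring))
      have htay := h.norm_score_sub_le x c Δ
      rw [hx0, hscore, hsum] at htay
      have hr : ‖N Δ - η‖ ≤ n * (L * ‖Δ‖ ^ 2) + 2 * M * ‖Δ‖ := by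
        have e1 : N Δ - η = (0 - η + (N Δ + (hess V (y - c) Δ - hess V (z i - c) Δ))) -
          (hess V (y - c) Δ - hess V (z i - c) Δ) := by abel
        rw [e1]
        exact (_root_.norm_sub_le _ _).trans (add_le_add htay (hrep Δ))
      have hin : n * ⟪w, Δ⟫ = ⟪gradient V y, v⟫ + ⟪v, η - gradient V y⟫ + ⟪v, N Δ - η⟫ := by
        rw [real_inner_comm v (gradient V y), ← inner_add_right, ← inner_add_right,
          show gradient V y + (η - gradient V y) + (N Δ - η) = N Δ by abel, ← hNs, hv,
          real_inner_smul_left]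
      have hw1 := hwt Δ
      rw [add_assoc, ← hxe] at hw1
      have b1 := (abs_real_inner_le_norm v (η - gradient V y)).trans
        (mul_le_mul hv4 hηG (norm_nonneg _) (by positivity))
      have b2 := (abs_real_inner_le_norm v (N Δ - η)).trans
        (mul_le_mul hv4 hr (norm_nonneg _) (by positivity))
      have b3 : n * |g (θ + hatθ x) - g (θ + c)| ≤ n * (K * ‖Δ‖ ^ 2) + |n * ⟪w, Δ⟫| := by
        rw [abs_mul, abs_of_pos hn', ← mul_add]
        gcongr
        have := abs_sub_abs_le_abs_sub (g (θ + hatθ x) - g (θ + c)) ⟪w, Δ⟫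
        linarith
      have b4 : |n * ⟪w, Δ⟫| ≤ |⟪gradient V y, v⟫| + |⟪v, η - gradient V y⟫| + |⟪v, N Δ - η⟫| := by
        rw [hin]; exact abs_add_three _ _ _
      have b5 : n * ‖Δ‖ ^ 2 ≤ 64 / m ^ 2 * (e ^ 2 / n) := by
        calc n * ‖Δ‖ ^ 2 ≤ n * (8 / m * (e / n)) ^ 2 := by gcongr
          _ = _ := by field_simp; ring
      have b6 : ‖Δ‖ ≤ 8 / m * (1 + e ^ 2 / n) := by
        refine hΔe.trans ?_
        gcongr
        have h1 : e / n ≤ (1 + e ^ 2) / n := by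
          gcongr
          nlinarith only [sq_nonneg (e - 1)]
        have h2 : 1 / (n : ℝ) ≤ 1 := by rw [div_le_one hn']; exact hn1
        rw [add_div] at h1
        linarith
      have b7 : n * (K * ‖Δ‖ ^ 2) ≤ K * (64 / m ^ 2 * (e ^ 2 / n)) := by
        rw [mul_left_comm]; gcongr
      have b8 : 4 / m * K * (n * (L * ‖Δ‖ ^ 2) + 2 * M * ‖Δ‖) ≤
          4 / m * K * (L * (64 / m ^ 2 * (e ^ 2 / n)) + 2 * M * (8 / m * (1 + e ^ 2 / n))) := by
        rw [mul_left_comm (n : ℝ)]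
        gcongr
      have b9 : 0 ≤ K * (2 * (64 * L / m ^ 2) ^ 2 * (e ^ 2 / n)) := by positivity
      have b10 : 4 / m * K * (2 * (M * (m / (8 * L)))) + K * (64 / m ^ 2 * (e ^ 2 / n)) +
          4 / m * K * (L * (64 / m ^ 2 * (e ^ 2 / n)) + 2 * M * (8 / m * (1 + e ^ 2 / n))) +
          K * (2 * (64 * L / m ^ 2) ^ 2 * (e ^ 2 / n)) =
          K * (M / L + 64 * M / m ^ 2 + B * (e ^ 2 / n)) := by
        rw [hB]; field_simp; ring
      linarith
    · have hs := not_lt.1 hs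
      have h1 : |g (θ + hatθ x) - g (θ + c)| ≤ 2 * K :=
        (abs_sub _ _).trans (by linarith [hg.abs_le (θ + hatθ x), hg.abs_le (θ + c)])
      have h2 : (n : ℝ) ≤ (64 * L / m ^ 2) ^ 2 * (e ^ 2 / n) := by
        have h3 : (n : ℝ) ≤ 64 * L / m ^ 2 * e := by
          refine le_trans (le_of_eq ?_) (mul_le_mul_of_nonneg_left hs (by positivity))
          field_simp; norm_num
        rw [← mul_div_assoc, le_div_iff₀ hn', ← mul_pow, ← sq]
        gcongr
      have h4 : n * |g (θ + hatθ x) - g (θ + c)| ≤ K * (2 * (64 * L / m ^ 2) ^ 2 * (e ^ 2 / n)) := by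
        calc n * |g (θ + hatθ x) - g (θ + c)| ≤ ((64 * L / m ^ 2) ^ 2 * (e ^ 2 / n)) * (2 * K) := by
              gcongr
          _ = _ := by ring
      have h5 : K * (2 * (64 * L / m ^ 2) ^ 2 * (e ^ 2 / n)) ≤
          K * (M / L + 64 * M / m ^ 2 + B * (e ^ 2 / n)) := by
        gcongr
        have : 2 * (64 * L / m ^ 2) ^ 2 ≤ B := by
          rw [hB]; exact le_add_of_nonneg_left (by positivity)
        have := mul_le_mul_of_nonneg_right this (by positivity : 0 ≤ e ^ 2 / n)
        have : 0 ≤ M / L + 64 * M / m ^ 2 := by positivity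
        linarith
      linarith [abs_nonneg ⟪gradient V y, v⟫]
  refine key.trans (add_le_add le_rfl ?_)
  rw [mul_comm (incrementConst L M m), mul_assoc]
  refine mul_le_mul_of_nonneg_left ?_ hK
  have h1 : e ^ 2 / n ≤ (8 * M ^ 2 * (m / (8 * L)) ^ 2 + 3) * (1 + q ^ 2 / n) := by
    have h2 : e ^ 2 / n ≤ 2 * (q ^ 2 / n) + 8 * M ^ 2 * (m / (8 * L)) ^ 2 := by
      rw [div_le_iff₀ hn']
      have : (2 * (q ^ 2 / n) + 8 * M ^ 2 * (m / (8 * L)) ^ 2) * n =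
        2 * q ^ 2 + 8 * M ^ 2 * (m / (8 * L)) ^ 2 * n := by field_simp
      rw [this]
      have : 0 ≤ 8 * M ^ 2 * (m / (8 * L)) ^ 2 := by positivity
      nlinarith only [this, heq, hn1]
    have h3 : 0 ≤ 8 * M ^ 2 * (m / (8 * L)) ^ 2 := by positivity
    have h4 : 0 ≤ q ^ 2 / n := by positivity
    nlinarith only [h2, h3, h4]
  have h2 : 0 ≤ q ^ 2 / n := by positivity
  have h3 : 0 ≤ M / L + 64 * M / m ^ 2 := by positivity
  have h4 : 0 ≤ 4 / m := by positivity
  have h5 := mul_le_mul_of_nonneg_left h1 hB0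
  have h6 : incrementConst L M m = 4 / m + (M / L + 64 * M / m ^ 2) +
    B * (8 * M ^ 2 * (m / (8 * L)) ^ 2 + 3) := by rw [hB]; unfold incrementConst; ring
  rw [h6]
  nlinarith only [mul_nonneg h3 h2, mul_nonneg h4 h2, h5, h4, h3]

end IsRegularPotential

/-- The constant in the variance bound, apart from the contribution of the bad event. -/
def goodVarianceConst (L M m c : ℝ) : ℝ :=
  incrementConst L M m ^ 2 *
    (4 * M * subgaussianMomentConst 1 + 4 * (1 + subgaussianMomentConst 2 * (4 * M ^ 2 * c ^ 2)))

/-- The constant in the variance bound. -/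
def varianceConst (L M m : ℝ) (p : ℕ) (c : ℝ) : ℝ :=
  goodVarianceConst L M m c + 4 * (badUpdateConst L M m p * c ^ p) + 64 * M / m

namespace IsRegularPotential

variable {L M m : ℝ} {d n : ℕ} {V : Euc d → ℝ} {hatθ : (Fin n → Euc d) → Euc d}

theorem goodVarianceConst_nonneg (h : IsRegularPotential L M m V) (c : ℝ) :
    0 ≤ goodVarianceConst L M m c := by
  have := h.M_pos
  have := one_le_subgaussianMomentConst 1
  have := one_le_subgaussianMomentConst 2
  unfold goodVarianceConst; positivity

theorem badConst_nonneg (h : IsRegularPotential L M m V) (p : ℕ) : 0 ≤ badConst L M m p := by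
  have := h.M_pos
  have := one_le_subgaussianMomentConst p
  have := boundedMomentConst_nonneg p
  unfold badConst; positivity

theorem badUpdateConst_nonneg (h : IsRegularPotential L M m V) (p : ℕ) :
    0 ≤ badUpdateConst L M m p := by
  have := h.M_pos
  have := one_le_subgaussianMomentConst p
  have := h.badConst_nonneg p
  unfold badUpdateConst; positivity

theorem integral_update_sq_le (h : IsRegularPotential L M m V) (hn : 0 < n)
    (hnM : 16 * M ≤ m * n) (hθ : IsMLE V hatθ) (p : ℕ) {c : ℝ} (hc : (d : ℝ) / n ≤ c)
    (x : Fin n → Euc d) (i : Fin n) {a : Euc d} (ha : gradient V a = 0) {K : ℝ} {g : Euc d → ℝ}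
    (hg : HasExpansion K g) (θ : Euc d) :
    ∫ y, (g (θ + hatθ (Function.update x i y)) - g (θ + hatθ (Function.update x i a))) ^ 2
      ∂noiseMeasure V ≤
      goodVarianceConst L M m c * K ^ 2 / n ^ 2 +
        4 * K ^ 2 * badWeight L m p V (Function.update x i a) := by
  have := h.isProbabilityMeasure
  have hM := h.M_pos
  have hn' : (0 : ℝ) < n := by exact_mod_cast hn
  have hK : 0 ≤ K := (abs_nonneg _).trans (hg.abs_le 0)
  have hw0 := h.badWeight_nonneg p (Function.update x i a)
  have hg0 := h.goodVarianceConst_nonneg c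
  by_cases hz : IsGood L m V (Function.update x i a)
  · obtain ⟨v, hv, hinc⟩ := IsGood.exists_increment_le h hn hnM hθ hz (i := i)
      (by rw [Function.update_self]; exact ha) hg θ
    simp only [Function.update_idem] at hinc
    set I := incrementConst L M m with hI
    have hpt : ∀ y, (g (θ + hatθ (Function.update x i y)) -
        g (θ + hatθ (Function.update x i a))) ^ 2 ≤
        1 / n ^ 2 * ((2 * ⟪gradient V y, v⟫ ^ 2 + 4 * (I * K) ^ 2) +
          4 * (I * K) ^ 2 / n ^ 2 * ‖gradient V y‖ ^ (2 * 2)) := by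
      intro y
      have h1 := hinc y
      set δ := g (θ + hatθ (Function.update x i y)) - g (θ + hatθ (Function.update x i a))
      set t := ⟪gradient V y, v⟫
      set r := ‖gradient V y‖ ^ 2 / n
      have h2 : (n * |δ|) ^ 2 ≤ (|t| + I * K * (1 + r)) ^ 2 := by gcongr
      have h3 : (|t| + I * K * (1 + r)) ^ 2 ≤ 2 * t ^ 2 + 4 * (I * K) ^ 2 * (1 + r ^ 2) := by
        have := sq_nonneg (|t| - I * K * (1 + r))
        have := mul_nonneg (sq_nonneg (I * K)) (sq_nonneg (1 - r))
        nlinarith [sq_abs t]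
      rw [mul_pow, sq_abs] at h2
      rw [one_div, inv_mul_eq_div, le_div_iff₀ (by positivity), mul_comm]
      refine (h2.trans h3).trans (le_of_eq ?_)
      simp only [r]
      field_simp
      ring
    obtain ⟨i1, j1⟩ := h.integral_norm_gradient_pow_le 2
    have i2 : Integrable (fun y => ⟪gradient V y, v⟫ ^ 2) (noiseMeasure V) :=
      (h.memLp_inner_gradient v (p := 2) (by simp)).integrable_sq
    have j2 := h.integral_inner_gradient_sq_le v
    have i3 := (i2.const_mul 2).fun_add (integrable_const (4 * (I * K) ^ 2))
    have i4 := i1.const_mul (4 * (I * K) ^ 2 / n ^ 2)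
    refine (integral_mono_of_nonneg (.of_forall fun y => sq_nonneg _)
      ((i3.fun_add i4).const_mul (1 / (n : ℝ) ^ 2)) (.of_forall hpt)).trans ?_
    rw [integral_const_mul, integral_add i3 i4, integral_add (i2.const_mul 2) (integrable_const _),
      integral_const_mul, integral_const_mul (4 * (I * K) ^ 2 / (n : ℝ) ^ 2)]
    simp only [integral_const, probReal_univ, one_smul]
    have k1 : ∫ y, ⟪gradient V y, v⟫ ^ 2 ∂noiseMeasure V ≤
        subgaussianMomentConst 1 * (2 * M) * (I * K) ^ 2 := by
      have := one_le_subgaussianMomentConst 1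
      refine j2.trans ?_
      rw [mul_assoc (subgaussianMomentConst 1)]
      gcongr
    have k2 : 4 * (I * K) ^ 2 / n ^ 2 * ∫ y, ‖gradient V y‖ ^ (2 * 2) ∂noiseMeasure V ≤
        4 * (I * K) ^ 2 * (subgaussianMomentConst 2 * (4 * M ^ 2 * c ^ 2)) := by
      have := one_le_subgaussianMomentConst 2
      calc _ ≤ 4 * (I * K) ^ 2 / n ^ 2 * (subgaussianMomentConst 2 * (2 * M * d) ^ 2) := by gcongr
        _ = 4 * (I * K) ^ 2 * (subgaussianMomentConst 2 * (4 * M ^ 2 * (d / n) ^ 2)) := by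
          field_simp; ring
        _ ≤ _ := by gcongr
    have k3 : 1 / (n : ℝ) ^ 2 * (2 * ∫ y, ⟪gradient V y, v⟫ ^ 2 ∂noiseMeasure V +
        4 * (I * K) ^ 2 + 4 * (I * K) ^ 2 / n ^ 2 * ∫ y, ‖gradient V y‖ ^ (2 * 2) ∂noiseMeasure V)
        ≤ goodVarianceConst L M m c * K ^ 2 / n ^ 2 := by
      rw [one_div, inv_mul_eq_div]
      gcongr
      unfold goodVarianceConst
      rw [← hI]
      linarith
    have : 0 ≤ 4 * K ^ 2 * badWeight L m p V (Function.update x i a) := by positivity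
    linarith
  · have hw := h.one_le_badWeight hn p hz
    have hpt : ∀ y, (g (θ + hatθ (Function.update x i y)) -
        g (θ + hatθ (Function.update x i a))) ^ 2 ≤ 4 * K ^ 2 := fun y => by
      rw [← sq_abs, show 4 * K ^ 2 = (2 * K) ^ 2 by ring]
      refine pow_le_pow_left₀ (abs_nonneg _) ((abs_sub _ _).trans ?_) 2
      linarith [hg.abs_le (θ + hatθ (Function.update x i y)),
        hg.abs_le (θ + hatθ (Function.update x i a))]
    refine (integral_mono_of_nonneg (.of_forall fun y => sq_nonneg _) (integrable_const _)
      (.of_forall hpt)).trans ?_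
    simp only [integral_const, probReal_univ, one_smul]
    have : 0 ≤ goodVarianceConst L M m c * K ^ 2 / n ^ 2 := by positivity
    nlinarith [sq_nonneg K]

theorem measurable_comp_estimator (h : IsRegularPotential L M m V) (hn : 0 < n)
    (hθ : IsMLE V hatθ) {g : Euc d → ℝ} (hg : Continuous g) (θ : Euc d) :
    Measurable fun x => g (θ + hatθ x) :=
  (hg.comp (continuous_const.add (h.continuous_estimator hn hθ))).measurable

theorem variance_le (h : IsRegularPotential L M m V) (hn : 0 < n) (hθ : IsMLE V hatθ) {p : ℕ}
    {c : ℝ} (hc : (d : ℝ) / n ≤ c) (hp : ((d : ℝ) / n) ^ p ≤ c ^ p / n ^ 2) {K : ℝ}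
    {g : Euc d → ℝ} (hg : HasExpansion K g) (θ : Euc d) :
    ∫ x, (g (θ + hatθ x) - ∫ y, g (θ + hatθ y) ∂noiseSample V n) ^ 2 ∂noiseSample V n ≤
      varianceConst L M m p c * K ^ 2 / n := by
  have := h.isProbabilityMeasure
  have := h.isProbabilityMeasure_noiseSample n
  have hM := h.M_pos
  have hm := h.m_pos
  have hn' : (0 : ℝ) < n := by exact_mod_cast hn
  have hK : 0 ≤ K := (abs_nonneg _).trans (hg.abs_le 0)
  have hmeas := h.measurable_comp_estimator hn hθ hg.continuous θ
  have hb := h.badUpdateConst_nonneg p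
  have hc0 : 0 ≤ c := le_trans (by positivity) hc
  have hg0 := h.goodVarianceConst_nonneg c
  by_cases hnM : 16 * M ≤ m * n
  · obtain ⟨a, ha⟩ := h.exists_gradient_eq_zero hn hθ
    refine (integral_sub_sq_le_sum_update (noiseMeasure V) a n hmeas
      (fun x => hg.abs_le (θ + hatθ x))).trans ?_
    have hi : ∀ i : Fin n, ∫ x, ∫ y, (g (θ + hatθ (Function.update x i y)) -
        g (θ + hatθ (Function.update x i a))) ^ 2 ∂noiseMeasure V
        ∂(Measure.pi fun _ => noiseMeasure V) ≤
        (goodVarianceConst L M m c + 4 * (badUpdateConst L M m p * c ^ p)) * K ^ 2 / n ^ 2 := by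
      intro i
      obtain ⟨i1, j1⟩ := h.integral_badWeight_update_le hn p i ha
      refine (integral_mono_of_nonneg
        (.of_forall fun x => integral_nonneg fun y => sq_nonneg _)
        ((integrable_const _).fun_add (i1.const_mul (4 * K ^ 2)))
        (.of_forall fun x => h.integral_update_sq_le hn hnM hθ p hc x i ha hg θ)).trans ?_
      change ∫ x, _ ∂noiseSample V n ≤ _
      rw [integral_add (integrable_const _) (i1.const_mul _), integral_const_mul]
      simp only [integral_const, probReal_univ, one_smul]
      calc _ ≤ goodVarianceConst L M m c * K ^ 2 / n ^ 2 +
            4 * K ^ 2 * (badUpdateConst L M m p * (c ^ p / n ^ 2)) := by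
            gcongr
            exact j1.trans (by gcongr)
        _ = _ := by ring
    refine (Finset.sum_le_sum fun i _ => hi i).trans ?_
    rw [Finset.sum_const, Finset.card_univ, Fintype.card_fin, nsmul_eq_mul, varianceConst]
    have : 0 ≤ 64 * M / m * K ^ 2 / n := by positivity
    calc _ = (goodVarianceConst L M m c + 4 * (badUpdateConst L M m p * c ^ p)) * K ^ 2 / n := by
          field_simp
      _ ≤ _ := by
          rw [add_mul _ (64 * M / m), add_div]
          linarith
  · have hpt : ∀ x, (g (θ + hatθ x) - ∫ y, g (θ + hatθ y) ∂noiseSample V n) ^ 2 ≤ 4 * K ^ 2 := by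
      intro x
      have h1 := norm_integral_le_of_norm_le_const (μ := noiseSample V n)
        (f := fun x => g (θ + hatθ x)) (C := K) (.of_forall fun x => hg.abs_le _)
      simp only [probReal_univ, mul_one, Real.norm_eq_abs] at h1
      rw [← sq_abs, show 4 * K ^ 2 = (2 * K) ^ 2 by ring]
      refine pow_le_pow_left₀ (abs_nonneg _) ((abs_sub _ _).trans ?_) 2
      linarith [hg.abs_le (θ + hatθ x)]
    refine (integral_mono_of_nonneg (.of_forall fun y => sq_nonneg _) (integrable_const _)
      (.of_forall hpt)).trans ?_
    simp only [integral_const, probReal_univ, one_smul]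
    have h1 : 0 ≤ (goodVarianceConst L M m c + 4 * (badUpdateConst L M m p * c ^ p)) * K ^ 2 / n := by
      positivity
    have h2 : 4 * K ^ 2 ≤ 64 * M / m * K ^ 2 / n := by
      have : 1 ≤ 16 * M / (m * n) := by
        rw [one_le_div (by positivity)]; linarith
      calc 4 * K ^ 2 = 4 * K ^ 2 * 1 := by ring
        _ ≤ 4 * K ^ 2 * (16 * M / (m * n)) := by gcongr
        _ = _ := by field_simp; ring
    rw [varianceConst, add_mul _ (64 * M / m), add_div]
    linarith

end IsRegularPotential

/-- `g` is `l` times differentiable, with all derivatives up to order `l` bounded by `B` and the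
last one `ρ`-Hölder with constant `B`. -/
def HolderBound {E : Type} [NormedAddCommGroup E] [NormedSpace ℝ E] (ρ B : ℝ) :
    ℕ → ∀ {F : Type} [NormedAddCommGroup F] [NormedSpace ℝ F], (E → F) → Prop
  | 0, _, _, _, g => (∀ x, ‖g x‖ ≤ B) ∧ ∀ x y, ‖g x - g y‖ ≤ B * ‖x - y‖ ^ ρ
  | l + 1, _, _, _, g => (∀ x, ‖g x‖ ≤ B) ∧ Differentiable ℝ g ∧ HolderBound ρ B l (fderiv ℝ g)

/-- Convolution of `g` with the law of `Z`. -/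
def shiftMean {E F Ω : Type} [NormedAddCommGroup E] [NormedSpace ℝ E] [NormedAddCommGroup F]
    [NormedSpace ℝ F] [MeasurableSpace Ω] (P : Measure Ω) (Z : Ω → E) (g : E → F) (θ : E) : F :=
  ∫ ω, g (θ + Z ω) ∂P

theorem integrable_min_norm {E Ω : Type} [NormedAddCommGroup E] [MeasurableSpace Ω]
    [TopologicalSpace Ω] [OpensMeasurableSpace Ω] {P : Measure Ω} [IsProbabilityMeasure P]
    {Z : Ω → E} (hZ : Continuous Z) :
    Integrable (fun ω => min ‖Z ω‖ 1) P :=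
  Integrable.of_bound (hZ.norm.min continuous_const).aestronglyMeasurable 1 (.of_forall fun ω => by
    rw [Real.norm_of_nonneg (le_min (norm_nonneg _) zero_le_one)]; exact min_le_right _ _)

namespace HolderBound

variable {E : Type} [NormedAddCommGroup E] [NormedSpace ℝ E] {ρ B : ℝ} {l : ℕ}
  {F : Type} [NormedAddCommGroup F] [NormedSpace ℝ F] {g : E → F}

theorem norm_le (h : HolderBound ρ B l g) (x : E) : ‖g x‖ ≤ B := by
  cases l with
  | zero => exact h.1 x
  | succ l => exact h.1 x

theorem nonneg (h : HolderBound ρ B l g) : 0 ≤ B := (norm_nonneg _).trans (h.norm_le 0)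

theorem continuous (hρ : 0 < ρ) (h : HolderBound ρ B l g) : Continuous g := by
  cases l with
  | zero =>
    rw [continuous_iff_continuousAt]
    intro x
    rw [ContinuousAt, tendsto_iff_norm_sub_tendsto_zero]
    refine squeeze_zero (fun _ => norm_nonneg _) (fun y => h.2 y x) ?_
    have : Continuous fun y : E => B * ‖y - x‖ ^ ρ :=
      continuous_const.mul ((by fun_prop : Continuous fun y : E => ‖y - x‖).rpow_const
        fun _ => Or.inr hρ.le)
    simpa [hρ.ne'] using this.tendsto x
  | succ l => exact h.2.1.continuous

theorem of_iteratedFDeriv (l : ℕ) : ∀ {F : Type} [NormedAddCommGroup F] [NormedSpace ℝ F]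
    {g : E → F}, ContDiff ℝ l g → (∀ j : ℕ, j ≤ l → ∀ x, ‖iteratedFDeriv ℝ j g x‖ ≤ B) →
    (∀ x y, ‖iteratedFDeriv ℝ l g x - iteratedFDeriv ℝ l g y‖ ≤ B * ‖x - y‖ ^ ρ) →
    HolderBound ρ B l g := by
  induction l with
  | zero =>
    intro F _ _ g _ h1 h2
    refine ⟨fun x => by simpa using h1 0 le_rfl x, fun x y => ?_⟩
    have := h2 x y
    rwa [iteratedFDeriv_zero_eq_comp, Function.comp, Function.comp, ← map_sub,
      LinearIsometryEquiv.norm_map] at this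
  | succ l ih =>
    intro F _ _ g h0 h1 h2
    refine ⟨fun x => by simpa using h1 0 (Nat.zero_le _) x, h0.differentiable (by simp), ?_⟩
    refine ih (h0.fderiv_right (by norm_cast)) (fun j hj x => ?_) fun x y => ?_
    · rw [norm_iteratedFDeriv_fderiv]
      exact h1 (j + 1) (by omega) x
    · have := h2 x y
      rw [iteratedFDeriv_succ_eq_comp_right, iteratedFDeriv_succ_eq_comp_right (x := y)] at this
      have e := (continuousMultilinearCurryRightEquiv' ℝ l E F).symm.dist_map
        (iteratedFDeriv ℝ l (fun y => fderiv ℝ g y) x) (iteratedFDeriv ℝ l (fun y => fderiv ℝ g y) y)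
      rw [dist_eq_norm, dist_eq_norm] at e
      exact e.symm.trans_le this

theorem mono {B' : ℝ} (hB : B ≤ B') (h : HolderBound ρ B l g) : HolderBound ρ B' l g := by
  induction l generalizing F with
  | zero => exact ⟨fun x => (h.1 x).trans hB, fun x y => (h.2 x y).trans (by gcongr)⟩
  | succ l ih => exact ⟨fun x => (h.1 x).trans hB, h.2.1, ih h.2.2⟩

theorem add {B' : ℝ} {g' : E → F} (h : HolderBound ρ B l g) (h' : HolderBound ρ B' l g') :
    HolderBound ρ (B + B') l (fun x => g x + g' x) := by
  induction l generalizing F with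
  | zero =>
    refine ⟨fun x => (norm_add_le _ _).trans (add_le_add (h.1 x) (h'.1 x)), fun x y => ?_⟩
    rw [add_sub_add_comm, add_mul]
    exact (norm_add_le _ _).trans (add_le_add (h.2 x y) (h'.2 x y))
  | succ l ih =>
    refine ⟨fun x => (norm_add_le _ _).trans (add_le_add (h.1 x) (h'.1 x)), h.2.1.add h'.2.1, ?_⟩
    have e : fderiv ℝ (fun x => g x + g' x) = fun x => fderiv ℝ g x + fderiv ℝ g' x :=
      funext fun x => fderiv_fun_add (h.2.1 x) (h'.2.1 x)
    rw [e]
    exact ih h.2.2 h'.2.2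

theorem neg (h : HolderBound ρ B l g) : HolderBound ρ B l (fun x => -g x) := by
  induction l generalizing F with
  | zero =>
    refine ⟨fun x => by rw [norm_neg]; exact h.1 x, fun x y => ?_⟩
    rw [← neg_sub', norm_neg]
    exact h.2 x y
  | succ l ih =>
    refine ⟨fun x => by rw [norm_neg]; exact h.1 x, h.2.1.neg, ?_⟩
    have e : fderiv ℝ (fun x => -g x) = fun x => -fderiv ℝ g x :=
      funext fun x => fderiv_fun_neg
    rw [e]
    exact ih h.2.2

theorem norm_fderiv_le (h : HolderBound ρ B (l + 1) g) (x : E) : ‖fderiv ℝ g x‖ ≤ B :=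
  h.2.2.norm_le x

theorem norm_sub_le (h : HolderBound ρ B (l + 1) g) (x y : E) : ‖g x - g y‖ ≤ B * ‖x - y‖ :=
  Convex.norm_image_sub_le_of_norm_fderiv_le (s := Set.univ) (fun z _ => h.2.1 z)
    (fun z _ => h.norm_fderiv_le z) convex_univ trivial trivial

variable {Ω : Type} [MeasurableSpace Ω] {P : Measure Ω} [IsProbabilityMeasure P] {Z : Ω → E}

theorem norm_shiftMean_le (h : HolderBound ρ B l g) (θ : E) : ‖shiftMean P Z g θ‖ ≤ B := by
  have := norm_integral_le_of_norm_le_const (μ := P) (f := fun ω => g (θ + Z ω)) (C := B)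
    (.of_forall fun ω => h.norm_le _)
  simpa [_root_.shiftMean] using this

variable [TopologicalSpace Ω] [OpensMeasurableSpace Ω] [SecondCountableTopology Ω]

theorem integrable (hρ : 0 < ρ) (hZ : Continuous Z) (h : HolderBound ρ B l g) (θ : E) :
    Integrable (fun ω => g (θ + Z ω)) P :=
  Integrable.of_bound ((h.continuous hρ).comp
    (continuous_const.add hZ)).aestronglyMeasurable B (.of_forall fun _ => h.norm_le _)

theorem hasFDerivAt_shiftMean (hρ : 0 < ρ) (hZ : Continuous Z) [CompleteSpace F]
    (h : HolderBound ρ B (l + 1) g) (θ : E) :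
    HasFDerivAt (shiftMean P Z g) (shiftMean P Z (fderiv ℝ g) θ) θ := by
  refine hasFDerivAt_integral_of_dominated_of_fderiv_le (F := fun θ ω => g (θ + Z ω))
    (F' := fun θ ω => fderiv ℝ g (θ + Z ω)) (s := Set.univ) (bound := fun _ => B) Filter.univ_mem
    (.of_forall fun x => (h.integrable hρ hZ x).aestronglyMeasurable) (h.integrable hρ hZ θ)
    (h.2.2.integrable hρ hZ θ).aestronglyMeasurable (.of_forall fun ω x _ => h.norm_fderiv_le _)
    (integrable_const B) (.of_forall fun ω x _ => ?_)
  exact (hasFDerivAt_comp_add_right (Z ω)).2 (h.2.1 (x + Z ω)).hasFDerivAt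

theorem fderiv_shiftMean (hρ : 0 < ρ) (hZ : Continuous Z) [CompleteSpace F]
    (h : HolderBound ρ B (l + 1) g) :
    fderiv ℝ (shiftMean P Z g) = shiftMean P Z (fderiv ℝ g) :=
  funext fun θ => (h.hasFDerivAt_shiftMean hρ hZ θ).fderiv

theorem shiftMean (hρ : 0 < ρ) (hZ : Continuous Z) [CompleteSpace F] (h : HolderBound ρ B l g) :
    HolderBound ρ B l (shiftMean P Z g) := by
  induction l generalizing F with
  | zero =>
    refine ⟨h.norm_shiftMean_le, fun x y => ?_⟩
    rw [_root_.shiftMean, _root_.shiftMean, ← integral_sub (h.integrable hρ hZ x)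
      (h.integrable hρ hZ y)]
    have := norm_integral_le_of_norm_le_const (μ := P)
      (f := fun ω => g (x + Z ω) - g (y + Z ω)) (C := B * ‖x - y‖ ^ ρ)
      (.of_forall fun ω => by simpa using h.2 (x + Z ω) (y + Z ω))
    simpa using this
  | succ l ih =>
    refine ⟨h.norm_shiftMean_le, fun θ => (h.hasFDerivAt_shiftMean hρ hZ θ).differentiableAt, ?_⟩
    rw [h.fderiv_shiftMean hρ hZ]
    exact ih h.2.2

theorem norm_shiftMean_sub_le (hρ : 0 < ρ) (hZ : Continuous Z) [CompleteSpace F]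
    (h : HolderBound ρ B (l + 1) g) (θ : E) :
    ‖_root_.shiftMean P Z g θ - g θ‖ ≤ 4 * (∫ ω, min ‖Z ω‖ 1 ∂P) * B := by
  have e : _root_.shiftMean P Z g θ - g θ = ∫ ω, (g (θ + Z ω) - g θ) ∂P := by
    rw [integral_sub (h.integrable hρ hZ θ) (integrable_const _), integral_const]
    simp [_root_.shiftMean]
  rw [e, mul_right_comm, ← integral_const_mul]
  refine norm_integral_le_of_norm_le ((integrable_min_norm hZ).const_mul _)
    (.of_forall fun ω => ?_)
  have h1 := h.norm_sub_le (θ + Z ω) θ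
  have h2 := _root_.norm_sub_le (g (θ + Z ω)) (g θ)
  have h3 := h.norm_le (θ + Z ω)
  have h4 := h.norm_le θ
  have hB := h.nonneg
  rw [add_sub_cancel_left] at h1
  rcases min_cases ‖Z ω‖ 1 with ⟨h5, _⟩ | ⟨h5, _⟩
  · rw [h5]; nlinarith [mul_nonneg hB (norm_nonneg (Z ω))]
  · rw [h5]; linarith

theorem norm_sub_sub_sub_le (hρ : 0 < ρ) (hρ1 : ρ ≤ 1) (h : HolderBound ρ B 1 g) (x y z : E) :
    ‖g (x + z) - g x - (g (y + z) - g y)‖ ≤ 4 * B * min ‖z‖ 1 * ‖x - y‖ ^ ρ := by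
  have hB := h.nonneg
  have hpow : 0 ≤ ‖x - y‖ ^ ρ := by positivity
  rcases min_cases ‖z‖ 1 with ⟨h5, _⟩ | ⟨h5, _⟩
  · rw [h5]
    have key := Convex.norm_image_sub_le_of_norm_hasFDerivWithin_le (s := Set.univ)
      (f := fun u => g (x + u) - g (y + u))
      (f' := fun u => fderiv ℝ g (x + u) - fderiv ℝ g (y + u)) (C := B * ‖x - y‖ ^ ρ)
      (fun u _ => (((hasFDerivAt_comp_add_left x).2 (h.2.1 (x + u)).hasFDerivAt).sub
        ((hasFDerivAt_comp_add_left y).2 (h.2.1 (y + u)).hasFDerivAt)).hasFDerivWithinAt)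
      (fun u _ => by simpa using h.2.2.2 (x + u) (y + u)) convex_univ (x := 0) (y := z)
      trivial trivial
    simp only [add_zero, sub_zero] at key
    rw [sub_sub_sub_comm]
    have : 0 ≤ B * ‖z‖ * ‖x - y‖ ^ ρ := by positivity
    nlinarith
  · rw [h5]
    have hmin : ∀ u v : E, u - v = x - y → ‖g u - g v‖ ≤ 2 * B * ‖x - y‖ ^ ρ := by
      intro u v huv
      rcases le_total ‖x - y‖ 1 with h1 | h1
      · have h2 := h.norm_sub_le u v
        rw [huv] at h2
        have h3 : ‖x - y‖ ≤ ‖x - y‖ ^ ρ := by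
          simpa using Real.rpow_le_rpow_of_exponent_ge' (norm_nonneg _) h1 hρ.le hρ1
        nlinarith
      · have h2 := Real.one_le_rpow h1 hρ.le
        have h3 := _root_.norm_sub_le (g u) (g v)
        have h4 := h.norm_le u
        have h5 := h.norm_le v
        nlinarith
    rw [sub_sub_sub_comm]
    refine (_root_.norm_sub_le _ _).trans ?_
    linarith [hmin (x + z) (y + z) (by abel), hmin x y rfl]

theorem shiftMean_sub (hρ : 0 < ρ) (hρ1 : ρ ≤ 1) (hZ : Continuous Z) [CompleteSpace F]
    (h : HolderBound ρ B (l + 1) g) :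
    HolderBound ρ (4 * (∫ ω, min ‖Z ω‖ 1 ∂P) * B) l (fun θ => _root_.shiftMean P Z g θ - g θ) := by
  induction l generalizing F with
  | zero =>
    refine ⟨h.norm_shiftMean_sub_le hρ hZ, fun x y => ?_⟩
    have e : ∀ θ, _root_.shiftMean P Z g θ - g θ = ∫ ω, (g (θ + Z ω) - g θ) ∂P := fun θ => by
      rw [integral_sub (h.integrable hρ hZ θ) (integrable_const _), integral_const]
      simp [_root_.shiftMean]
    have i : ∀ θ, Integrable (fun ω => g (θ + Z ω) - g θ) P := fun θ =>
      (h.integrable hρ hZ θ).sub (integrable_const _)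
    dsimp only
    rw [e, e, ← integral_sub (i x) (i y), mul_right_comm 4, ← integral_const_mul,
      ← integral_mul_const]
    exact norm_integral_le_of_norm_le (((integrable_min_norm hZ).const_mul _).mul_const _)
      (.of_forall fun ω => h.norm_sub_sub_sub_le hρ hρ1 x y (Z ω))
  | succ l ih =>
    refine ⟨h.norm_shiftMean_sub_le hρ hZ,
      fun θ => (h.hasFDerivAt_shiftMean hρ hZ θ).differentiableAt.sub (h.2.1 θ), ?_⟩
    have e : fderiv ℝ (fun θ => _root_.shiftMean P Z g θ - g θ) =
        fun θ => _root_.shiftMean P Z (fderiv ℝ g) θ - fderiv ℝ g θ := funext fun θ =>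
      ((h.hasFDerivAt_shiftMean hρ hZ θ).sub (h.2.1 θ).hasFDerivAt).fderiv
    rw [e]
    exact ih h.2.2

end HolderBound

namespace HolderBound

theorem norm_taylor_le {E F : Type} [NormedAddCommGroup E] [NormedSpace ℝ E]
    [NormedAddCommGroup F] [NormedSpace ℝ F] {ρ B : ℝ} {g : E → F} (hρ : 0 < ρ)
    (h : HolderBound ρ B 1 g) (x u : E) :
    ‖g (x + u) - g x - fderiv ℝ g x u‖ ≤ B * ‖u‖ ^ (1 + ρ) := by
  have hB := h.nonneg
  have key := (convex_closedBall x ‖u‖).norm_image_sub_le_of_norm_fderiv_le' (𝕜 := ℝ) (f := g)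
    (φ := fderiv ℝ g x) (C := B * ‖u‖ ^ ρ) (x := x) (y := x + u) (fun z _ => h.2.1 z)
    (fun z hz => (h.2.2.2 z x).trans ?_) (by simp) (by simp)
  · rw [add_sub_cancel_left, mul_assoc] at key
    rwa [Real.rpow_add_of_nonneg (norm_nonneg _) zero_le_one hρ.le, Real.rpow_one, mul_comm ‖u‖]
  · rw [mem_closedBall_iff_norm] at hz
    gcongr

theorem hasExpansion {E : Type} [NormedAddCommGroup E] [InnerProductSpace ℝ E] [CompleteSpace E]
    {ρ B : ℝ} {l : ℕ} {g : E → ℝ} (h : HolderBound ρ B (l + 2) g) : HasExpansion B g := by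
  refine ⟨h.2.1.continuous, h.1, fun c =>
    ⟨(InnerProductSpace.toDual ℝ E).symm (fderiv ℝ g c), ?_, fun u => ?_⟩⟩
  · rw [LinearIsometryEquiv.norm_map]
    exact h.norm_fderiv_le c
  · have := norm_image_sub_sub_le_of_lipschitz h.nonneg (fun x => (h.2.1 x).hasFDerivAt)
      (fun x y => h.2.2.norm_sub_le x y) c (c + u)
    rw [InnerProductSpace.toDual_symm_apply]
    rwa [add_sub_cancel_left, Real.norm_eq_abs] at this

end HolderBound

theorem sq_le_mul_rpow {τ c ρ : ℝ} (hτ : 0 < τ) (hc : τ ^ 2 ≤ c) (hρ : 0 < ρ) (hρ1 : ρ ≤ 1) :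
    τ ^ 2 ≤ (1 + c) * τ ^ (1 + ρ) := by
  have h1 : τ ^ (1 - ρ) ≤ 1 + c := by
    rcases le_total τ 1 with h | h
    · exact (Real.rpow_le_one hτ.le h (by linarith)).trans (by nlinarith [sq_nonneg τ])
    · have : τ ^ (1 - ρ) ≤ τ ^ (2 : ℝ) := Real.rpow_le_rpow_of_exponent_le h (by linarith)
      rw [Real.rpow_two] at this
      linarith
  have h2 : τ ^ 2 = τ ^ (1 - ρ) * τ ^ (1 + ρ) := by
    rw [← Real.rpow_add hτ, ← Real.rpow_two]
    norm_num
  rw [h2]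
  gcongr

theorem rpow_one_add_le {τ r ρ : ℝ} (hτ : 0 < τ) (hr : 0 ≤ r) (hρ : 0 < ρ) (hρ1 : ρ ≤ 1) :
    r ^ (1 + ρ) ≤ τ ^ (1 + ρ) * (1 + r ^ 2 / τ ^ 2) := by
  have e : r ^ (1 + ρ) = τ ^ (1 + ρ) * (r / τ) ^ (1 + ρ) := by
    rw [← Real.mul_rpow hτ.le (by positivity), mul_div_cancel₀ _ hτ.ne']
  rw [e, ← div_pow]
  refine mul_le_mul_of_nonneg_left ?_ (by positivity)
  have hq : 0 ≤ r / τ := by positivity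
  rcases le_total (r / τ) 1 with h | h
  · exact (Real.rpow_le_one hq h (by linarith)).trans (by nlinarith [sq_nonneg (r / τ)])
  · have : (r / τ) ^ (1 + ρ) ≤ (r / τ) ^ (2 : ℝ) :=
      Real.rpow_le_rpow_of_exponent_le h (by linarith)
    rw [Real.rpow_two] at this
    linarith

/-- The normalized squared deviation of the score and of the empirical Hessian. -/
def deviation {d n : ℕ} (V : Euc d → ℝ) (z : Fin n → Euc d) : ℝ :=
  (‖score V z 0‖ ^ 2 + hessDev V z ^ 2) / (n * d)

/-- The constant bounding the indicator of the bad event by the deviation. -/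
def badDeviationConst (L m : ℝ) : ℝ := 4 / m ^ 2 + 1 / scoreRadius L m ^ 2

/-- The constant in the linearization of the estimator. -/
def linearizationConst (L m c : ℝ) : ℝ :=
  1 + (4 / m) ^ 2 + (1 + c) * (4 / m / m + L * (4 / m) ^ 2 / m + 2 * badDeviationConst L m +
    (badDeviationConst L m + 1) / m)

/-- The constant in the bound for the second moment of `1 + deviation`. -/
def deviationConst (M : ℝ) : ℝ :=
  2 + 4 * (subgaussianMomentConst 2 * (2 * M) ^ 2 + boundedMomentConst 2 * (4 * M ^ 2) ^ 2)

theorem badDeviationConst_nonneg (L m : ℝ) : 0 ≤ badDeviationConst L m := by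
  unfold badDeviationConst; positivity

theorem deviation_nonneg {d n : ℕ} (V : Euc d → ℝ) (z : Fin n → Euc d) : 0 ≤ deviation V z := by
  unfold deviation; positivity

theorem deviation_mul {d n : ℕ} (V : Euc d → ℝ) (z : Fin n → Euc d) (hd : 0 < d) (hn : 0 < n) :
    deviation V z * (d / n : ℝ) = (‖score V z 0‖ / n) ^ 2 + (hessDev V z / n) ^ 2 := by
  have hd' : (0 : ℝ) < d := by exact_mod_cast hd
  have hn' : (0 : ℝ) < n := by exact_mod_cast hn
  unfold deviation
  field_simp

namespace IsRegularPotential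

variable {L M m : ℝ} {d n : ℕ} {V : Euc d → ℝ} {hatθ : (Fin n → Euc d) → Euc d}


theorem one_le_linearizationConst (h : IsRegularPotential L M m V) {c : ℝ} (hc : 0 ≤ c) :
    1 ≤ linearizationConst L m c := by
  have h1 := badDeviationConst_nonneg L m
  have hm := h.m_pos
  have hL := h.L_pos
  have : 0 ≤ (4 / m) ^ 2 + (1 + c) * (4 / m / m + L * (4 / m) ^ 2 / m +
    2 * badDeviationConst L m + (badDeviationConst L m + 1) / m) := by positivity
  unfold linearizationConst
  linarith

theorem one_le_deviation (h : IsRegularPotential L M m V) (hd : 0 < d) (hn : 0 < n)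
    {z : Fin n → Euc d} (hz : ¬ IsGood L m V z) :
    1 ≤ badDeviationConst L m * (deviation V z * (d / n)) := by
  have hm := h.m_pos
  have hr := h.scoreRadius_pos
  have hn' : (0 : ℝ) < n := by exact_mod_cast hn
  have h1 := h.one_le_badWeight hn 1 hz
  have e : badWeight L m 1 V z = 4 / m ^ 2 * (hessDev V z / n) ^ 2 +
      1 / scoreRadius L m ^ 2 * (‖score V z 0‖ / n) ^ 2 := by
    rw [badWeight, mul_one, mul_pow, mul_pow, div_pow, div_pow, div_pow, div_pow, mul_pow, mul_pow]
    ring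
  rw [deviation_mul V z hd hn, badDeviationConst]
  rw [e] at h1
  have h2 : 0 ≤ 4 / m ^ 2 * (‖score V z 0‖ / n) ^ 2 +
      1 / scoreRadius L m ^ 2 * (hessDev V z / n) ^ 2 := by positivity
  linarith

theorem min_norm_estimator_le (h : IsRegularPotential L M m V) (hn : 0 < n) (hθ : IsMLE V hatθ)
    {c : ℝ} (hc : (d / n : ℝ) ≤ c) (z : Fin n → Euc d) :
    min ‖hatθ z‖ 1 ≤ (4 / m + (1 + c) * badDeviationConst L m) * √(d / n) *
      (1 + deviation V z) := by
  have hm := h.m_pos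
  have hQ := badDeviationConst_nonneg L m
  have hw := deviation_nonneg V z
  have hn' : (0 : ℝ) < n := by exact_mod_cast hn
  have hc0 : 0 ≤ c := le_trans (by positivity) hc
  have hτ0 := Real.sqrt_nonneg (d / n : ℝ)
  rcases Nat.eq_zero_or_pos d with rfl | hd
  · rw [Subsingleton.elim (hatθ z) 0, norm_zero]
    exact (min_le_left _ _).trans (by positivity)
  have hd' : (0 : ℝ) < d := by exact_mod_cast hd
  have hτ : (√(d / n : ℝ)) ^ 2 = d / n := Real.sq_sqrt (by positivity)
  have hτp : 0 < √(d / n : ℝ) := Real.sqrt_pos.2 (by positivity)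
  set τ := √(d / n : ℝ)
  set w := deviation V z
  have hdev := deviation_mul V z hd hn
  by_cases hz : IsGood L m V z
  · refine (min_le_left _ _).trans ((IsGood.norm_estimator_le h hn hθ hz).trans ?_)
    have e : 4 / (m * n) * ‖score V z 0‖ = 4 / m * (‖score V z 0‖ / n) := by field_simp
    have h1 : (‖score V z 0‖ / n) ≤ τ * (1 + w) := by
      refine abs_le_of_sq_le_sq' ?_ (by positivity) |>.2
      rw [mul_pow, hτ]
      have : (‖score V z 0‖ / n) ^ 2 ≤ d / n * w := by
        rw [mul_comm, hdev]; nlinarith [sq_nonneg (hessDev V z / n)]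
      refine this.trans (mul_le_mul_of_nonneg_left ?_ (by positivity))
      nlinarith
    rw [e]
    have h2 := mul_le_mul_of_nonneg_left h1 (by positivity : 0 ≤ 4 / m)
    have h3 : 0 ≤ (1 + c) * badDeviationConst L m * τ * (1 + w) := by positivity
    linarith
  · refine (min_le_right _ _).trans ?_
    have h1 := h.one_le_deviation hd hn hz
    rw [← hτ] at h1
    have h3 : 0 ≤ 4 / m * τ * (1 + w) := by positivity
    have h4 : τ ≤ 1 + c := by nlinarith
    have h5 : badDeviationConst L m * (w * τ ^ 2) ≤
        badDeviationConst L m * ((1 + w) * (τ * (1 + c))) := by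
      refine mul_le_mul_of_nonneg_left ?_ hQ
      rw [sq]
      exact mul_le_mul (by linarith) (mul_le_mul_of_nonneg_left h4 hτ0) (by positivity)
        (by positivity)
    linarith

set_option maxHeartbeats 1000000 in
theorem exists_linearization (h : IsRegularPotential L M m V) (hn : 0 < n) (hθ : IsMLE V hatθ)
    {c ρ K : ℝ} (hρ : 0 < ρ) (hρ1 : ρ ≤ 1) (hc : (d / n : ℝ) ≤ c) {g : Euc d → ℝ}
    (hg : HolderBound ρ K 1 g) (θ : Euc d) : ∃ v : Euc d, ‖v‖ ≤ K / m ∧ ∀ z,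
      |g (θ + hatθ z) - g θ - ⟪score V z 0, v⟫ / n| ≤
        linearizationConst L m c * K * √(d / n) ^ (1 + ρ) * (1 + deviation V z) := by
  have hm := h.m_pos
  have hL := h.L_pos
  have hK := hg.nonneg
  have hQ := badDeviationConst_nonneg L m
  have hn' : (0 : ℝ) < n := by exact_mod_cast hn
  have hc0 : 0 ≤ c := le_trans (by positivity) hc
  have hC := h.one_le_linearizationConst hc0
  obtain ⟨v, hv, hvK⟩ := exists_eq_of_coercive (meanHess V) hm h.le_inner_meanHess
    ((InnerProductSpace.toDual ℝ (Euc d)).symm (fderiv ℝ g θ))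
  rw [LinearIsometryEquiv.norm_map] at hvK
  have hvK : ‖v‖ ≤ K / m := hvK.trans (by gcongr; exact hg.norm_fderiv_le θ)
  refine ⟨v, hvK, fun z => ?_⟩
  have hw := deviation_nonneg V z
  rcases Nat.eq_zero_or_pos d with rfl | hd
  · rw [Subsingleton.elim (θ + hatθ z) θ, Subsingleton.elim v 0, inner_zero_right, sub_self,
      zero_div, sub_zero, abs_zero]
    positivity
  have hd' : (0 : ℝ) < d := by exact_mod_cast hd
  have hτ : (√(d / n : ℝ)) ^ 2 = d / n := Real.sq_sqrt (by positivity)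
  have hτp : 0 < √(d / n : ℝ) := Real.sqrt_pos.2 (by positivity)
  set τ := √(d / n : ℝ)
  have hτρ : 0 < τ ^ (1 + ρ) := by positivity
  have hτ2 := sq_le_mul_rpow hτp (hτ.trans_le hc) hρ hρ1
  have hdev := deviation_mul V z hd hn
  rw [← hτ] at hdev
  have hwτ : deviation V z * τ ^ 2 ≤ (1 + c) * τ ^ (1 + ρ) * (1 + deviation V z) := by
    have := mul_le_mul_of_nonneg_left hτ2 hw
    have h2 : 0 ≤ (1 + c) * τ ^ (1 + ρ) := by positivity
    linarith
  set w := deviation V z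
  set A := ‖score V z 0‖ / n with hA
  set b := hessDev V z / n with hb
  have hA0 : 0 ≤ A := by positivity
  have hb0 : 0 ≤ b := div_nonneg (hessDev_nonneg V z) hn'.le
  suffices hs : |g (θ + hatθ z) - g θ - ⟪score V z 0, v⟫ / n| ≤
      K * ((1 + (4 / m) ^ 2) * τ ^ (1 + ρ) * (1 + w)) +
      K * (4 / m / m + L * (4 / m) ^ 2 / m + 2 * badDeviationConst L m +
        (badDeviationConst L m + 1) / m) * (w * τ ^ 2) by
    have h1 := mul_le_mul_of_nonneg_left hwτ (by positivity : 0 ≤ K * (4 / m / m +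
      L * (4 / m) ^ 2 / m + 2 * badDeviationConst L m + (badDeviationConst L m + 1) / m))
    rw [linearizationConst]
    linarith
  have hwp : 0 ≤ w * τ ^ 2 := by positivity
  by_cases hz : IsGood L m V z
  · set r := hatθ z
    have hr : ‖r‖ ≤ 4 / m * A := by
      refine (IsGood.norm_estimator_le h hn hθ hz).trans (le_of_eq ?_)
      rw [hA]; field_simp
    have t1 : ‖g (θ + r) - g θ - fderiv ℝ g θ r‖ ≤ K * ‖r‖ ^ (1 + ρ) := hg.norm_taylor_le hρ θ r
    have hr2 : ‖r‖ ^ 2 ≤ (4 / m) ^ 2 * (w * τ ^ 2) := by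
      rw [hdev]
      calc ‖r‖ ^ 2 ≤ (4 / m * A) ^ 2 := by gcongr
        _ = (4 / m) ^ 2 * A ^ 2 := by ring
        _ ≤ _ := mul_le_mul_of_nonneg_left (by nlinarith [sq_nonneg b]) (by positivity)
    have t2 : ‖r‖ ^ (1 + ρ) ≤ (1 + (4 / m) ^ 2) * τ ^ (1 + ρ) * (1 + w) := by
      refine (rpow_one_add_le hτp (norm_nonneg r) hρ hρ1).trans ?_
      have : ‖r‖ ^ 2 / τ ^ 2 ≤ (4 / m) ^ 2 * w := by
        rw [div_le_iff₀ (by positivity)]; linarith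
      have h2 : 1 + ‖r‖ ^ 2 / τ ^ 2 ≤ (1 + (4 / m) ^ 2) * (1 + w) := by
        nlinarith [sq_nonneg (4 / m)]
      nlinarith only [mul_le_mul_of_nonneg_left h2 hτρ.le]
    have t3 : fderiv ℝ g θ r = ⟪meanHess V r, v⟫ := by
      rw [h.inner_meanHess_comm, hv, real_inner_comm, InnerProductSpace.toDual_symm_apply]
    have t4 := h.norm_score_sub_le z 0 r
    rw [zero_add, h.score_eq_zero hn hθ z, zero_sub] at t4
    simp only [sub_zero] at t4
    have t5 := norm_sum_hess_sub_le V z r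
    have t6 : |⟪meanHess V r, v⟫ - ⟪score V z 0, v⟫ / n| ≤
        (b * ‖r‖ + L * ‖r‖ ^ 2) * ‖v‖ := by
      have e : ⟪meanHess V r, v⟫ - ⟪score V z 0, v⟫ / n =
          ⟪(-score V z 0 + ∑ j, hess V (z j) r) -
            ((∑ j, hess V (z j) r) - (n : ℝ) • meanHess V r), v⟫ / n := by
        simp only [inner_add_left, inner_sub_left, inner_neg_left, inner_smul_left, conj_trivial]
        field_simp
        ring
      rw [e, abs_div, abs_of_pos hn', div_le_iff₀ hn']
      refine (abs_real_inner_le_norm _ _).trans ?_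
      have := (_root_.norm_sub_le (-score V z 0 + ∑ j, hess V (z j) r)
        ((∑ j, hess V (z j) r) - (n : ℝ) • meanHess V r)).trans (add_le_add t4 t5)
      refine (mul_le_mul_of_nonneg_right this (norm_nonneg v)).trans (le_of_eq ?_)
      rw [hb]
      field_simp
      ring
    have t7 : (b * ‖r‖ + L * ‖r‖ ^ 2) * ‖v‖ ≤
        (4 / m * (w * τ ^ 2) + L * ((4 / m) ^ 2 * (w * τ ^ 2))) * (K / m) := by
      refine mul_le_mul (add_le_add ?_ (mul_le_mul_of_nonneg_left hr2 hL.le)) hvK (norm_nonneg _)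
        (by positivity)
      refine (mul_le_mul_of_nonneg_left hr hb0).trans ?_
      rw [hdev, mul_left_comm]
      refine mul_le_mul_of_nonneg_left ?_ (by positivity)
      nlinarith [sq_nonneg (A - b)]
    have t8 : |g (θ + r) - g θ - ⟪score V z 0, v⟫ / n| ≤
        |g (θ + r) - g θ - fderiv ℝ g θ r| + |⟪meanHess V r, v⟫ - ⟪score V z 0, v⟫ / n| := by
      rw [t3]
      refine (le_of_eq ?_).trans (abs_add_le _ _)
      congr 1
      ring
    rw [Real.norm_eq_abs] at t1
    have t9 := mul_le_mul_of_nonneg_left t2 hK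
    have t10 : 0 ≤ K * (2 * badDeviationConst L m + (badDeviationConst L m + 1) / m) *
      (w * τ ^ 2) := by positivity
    have t11 : (4 / m * (w * τ ^ 2) + L * ((4 / m) ^ 2 * (w * τ ^ 2))) * (K / m) =
      K * (4 / m / m + L * (4 / m) ^ 2 / m) * (w * τ ^ 2) := by ring
    linarith
  · have h1 := h.one_le_deviation hd hn hz
    rw [← hτ] at h1
    have h2 : |g (θ + hatθ z) - g θ - ⟪score V z 0, v⟫ / n| ≤ 2 * K + A * (K / m) := by
      refine (abs_sub _ _).trans (add_le_add ((abs_sub _ _).trans ?_) ?_)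
      · have := hg.norm_le (θ + hatθ z)
        have := hg.norm_le θ
        rw [Real.norm_eq_abs] at *
        linarith
      · rw [abs_div, abs_of_pos hn', hA, div_mul_eq_mul_div]
        gcongr
        exact (abs_real_inner_le_norm _ _).trans (by gcongr)
    have h3 : A ≤ (badDeviationConst L m + 1) * (w * τ ^ 2) := by
      rw [add_mul, one_mul]
      nlinarith [sq_nonneg (A - 1), sq_nonneg b]
    have h4 := mul_le_mul_of_nonneg_right h3 (by positivity : 0 ≤ K / m)
    have h5 := mul_le_mul_of_nonneg_left h1 (by positivity : 0 ≤ 2 * K)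
    have h6 : 0 ≤ K * ((1 + (4 / m) ^ 2) * τ ^ (1 + ρ) * (1 + w)) := by positivity
    have h7 : 0 ≤ K * (4 / m / m + L * (4 / m) ^ 2 / m) * (w * τ ^ 2) := by positivity
    have e : (badDeviationConst L m + 1) * (w * τ ^ 2) * (K / m) =
      K * ((badDeviationConst L m + 1) / m) * (w * τ ^ 2) := by ring
    linarith

theorem continuous_deviation (h : IsRegularPotential L M m V) (n : ℕ) :
    Continuous fun z : Fin n → Euc d => deviation V z := by
  have := h.continuous_hessDev n
  have := h.continuous_score n
  unfold deviation
  fun_prop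

theorem integral_one_add_deviation_sq_le (h : IsRegularPotential L M m V) (hn : 0 < n) :
    Integrable (fun z => (1 + deviation V z) ^ 2) (noiseSample V n) ∧
    ∫ z, (1 + deviation V z) ^ 2 ∂ noiseSample V n ≤ deviationConst M := by
  have := h.isProbabilityMeasure_noiseSample n
  have hn' : (0 : ℝ) < n := by exact_mod_cast hn
  obtain ⟨i1, j1⟩ := h.integral_norm_score_pow_le n 2
  obtain ⟨i2, j2⟩ := h.integral_hessDev_pow_le n 2
  have i3 := ((i1.fun_add i2).const_mul (4 / (n * d : ℝ) ^ 2))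
  have i4 := (integrable_const (2 : ℝ)).fun_add i3
  have le : ∀ z, (1 + deviation V z) ^ 2 ≤ 2 + 4 / (n * d : ℝ) ^ 2 *
      (‖score V z 0‖ ^ (2 * 2) + hessDev V z ^ (2 * 2)) := fun z => by
    have e : 4 / (n * d : ℝ) ^ 2 * (‖score V z 0‖ ^ (2 * 2) + hessDev V z ^ (2 * 2)) -
        2 * deviation V z ^ 2 = 2 * ((‖score V z 0‖ ^ 2 - hessDev V z ^ 2) / (n * d)) ^ 2 := by
      rw [deviation, div_pow, div_pow]; ring
    have := sq_nonneg ((‖score V z 0‖ ^ 2 - hessDev V z ^ 2) / (n * d : ℝ))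
    linarith [sq_nonneg (1 - deviation V z)]
  refine ⟨i4.mono' ((continuous_const.add (h.continuous_deviation n)).pow 2).aestronglyMeasurable
    (.of_forall fun z => by rw [Real.norm_of_nonneg (sq_nonneg _)]; exact le z), ?_⟩
  refine (integral_mono_of_nonneg (.of_forall fun z => sq_nonneg _) i4 (.of_forall le)).trans ?_
  rw [integral_add (integrable_const _) i3, integral_const_mul, integral_add i1 i2]
  simp only [integral_const, probReal_univ, one_smul]
  rw [deviationConst]
  gcongr 2 + ?_
  rcases Nat.eq_zero_or_pos d with rfl | hd
  · have := one_le_subgaussianMomentConst 2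
    have := boundedMomentConst_nonneg 2
    simp only [Nat.cast_zero, mul_zero, ne_eq, OfNat.ofNat_ne_zero, not_false_eq_true, zero_pow,
      div_zero, zero_mul]
    positivity
  · have hd' : (0 : ℝ) < d := by exact_mod_cast hd
    have := mul_le_mul_of_nonneg_left (add_le_add j1 j2)
      (by positivity : 0 ≤ 4 / (n * d : ℝ) ^ 2)
    refine this.trans (le_of_eq ?_)
    field_simp

theorem integral_one_add_deviation_le (h : IsRegularPotential L M m V) (hn : 0 < n) :
    Integrable (fun z => 1 + deviation V z) (noiseSample V n) ∧
    ∫ z, (1 + deviation V z) ∂ noiseSample V n ≤ deviationConst M := by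
  obtain ⟨i, j⟩ := h.integral_one_add_deviation_sq_le (n := n) hn
  have le : ∀ z : Fin n → Euc d, 1 + deviation V z ≤ (1 + deviation V z) ^ 2 := fun z => by
    nlinarith [deviation_nonneg V z]
  have nn : ∀ z : Fin n → Euc d, 0 ≤ 1 + deviation V z := fun z => by
    linarith [deviation_nonneg V z]
  exact ⟨i.mono' (continuous_const.add (h.continuous_deviation n)).aestronglyMeasurable
    (.of_forall fun z => by rw [Real.norm_of_nonneg (nn z)]; exact le z),
    (integral_mono_of_nonneg (.of_forall nn) i (.of_forall le)).trans j⟩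

theorem integral_min_norm_estimator_le (h : IsRegularPotential L M m V) (hn : 0 < n)
    (hθ : IsMLE V hatθ) {c : ℝ} (hc : (d / n : ℝ) ≤ c) :
    ∫ z, min ‖hatθ z‖ 1 ∂ noiseSample V n ≤
      (4 / m + (1 + c) * badDeviationConst L m) * deviationConst M * √(d / n) := by
  have hm := h.m_pos
  have hQ := badDeviationConst_nonneg L m
  have hc0 : 0 ≤ c := le_trans (by positivity) hc
  obtain ⟨i, j⟩ := h.integral_one_add_deviation_le (n := n) hn
  refine (integral_mono_of_nonneg (.of_forall fun z => by positivity) (i.const_mul _)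
    (.of_forall fun z => h.min_norm_estimator_le hn hθ hc z)).trans ?_
  rw [integral_const_mul]
  have := mul_le_mul_of_nonneg_left j (by positivity :
    0 ≤ (4 / m + (1 + c) * badDeviationConst L m) * √(d / n))
  linarith

theorem integrable_inner_score (h : IsRegularPotential L M m V) (n : ℕ) (u : Euc d) :
    Integrable (fun z => ⟪score V z 0, u⟫) (noiseSample V n) ∧
      Integrable (fun z => ⟪score V z 0, u⟫ ^ 2) (noiseSample V n) := by
  have := h.isProbabilityMeasure_noiseSample n
  have := h.continuous_score n
  have hm : MemLp (fun z : Fin n → Euc d => ⟪score V z 0, u⟫) 2 (noiseSample V n) :=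
    by
    simpa using (h.hasSubgaussianMGF_score n u).memLp 2
  exact ⟨hm.integrable (by norm_num), hm.integrable_sq⟩

/-- The bias of the plug-in estimator of a function of smoothness `1 + ρ`. -/
theorem abs_integral_sub_le (h : IsRegularPotential L M m V) (hn : 0 < n) (hθ : IsMLE V hatθ)
    {c ρ K : ℝ} (hρ : 0 < ρ) (hρ1 : ρ ≤ 1) (hc : (d / n : ℝ) ≤ c) {g : Euc d → ℝ}
    (hg : HolderBound ρ K 1 g) (θ : Euc d) :
    |∫ z, g (θ + hatθ z) ∂ noiseSample V n - g θ| ≤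
      linearizationConst L m c * deviationConst M * K * √(d / n) ^ (1 + ρ) := by
  have := h.isProbabilityMeasure_noiseSample n
  have hK := hg.nonneg
  have hC := h.one_le_linearizationConst (c := c) (le_trans (by positivity) hc)
  obtain ⟨v, -, hv⟩ := h.exists_linearization hn hθ hρ hρ1 hc hg θ
  obtain ⟨i, j⟩ := h.integral_one_add_deviation_le (n := n) hn
  have i1 := hg.integrable hρ (P := noiseSample V n) (h.continuous_estimator hn hθ) θ
  have i2 := (h.integrable_inner_score n v).1.div_const (n : ℝ)
  have e : ∫ z, g (θ + hatθ z) ∂ noiseSample V n - g θ =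
      ∫ z, (g (θ + hatθ z) - g θ - ⟪score V z 0, v⟫ / n) ∂ noiseSample V n := by
    have i3 : Integrable (fun z => g (θ + hatθ z) - g θ) (noiseSample V n) :=
      i1.sub (integrable_const _)
    rw [integral_sub i3 i2, integral_sub i1 (integrable_const _),
      integral_div, h.integral_inner_score]
    simp
  rw [e, ← Real.norm_eq_abs]
  refine (norm_integral_le_of_norm_le (i.const_mul _) (.of_forall hv)).trans ?_
  rw [integral_const_mul]
  have := mul_le_mul_of_nonneg_left j (by positivity :
    0 ≤ linearizationConst L m c * K * √(d / n) ^ (1 + ρ))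
  linarith

/-- The mean squared error of the plug-in estimator of a function of smoothness `1 + ρ`. -/
theorem integral_sub_sq_le (h : IsRegularPotential L M m V) (hn : 0 < n) (hθ : IsMLE V hatθ)
    {c ρ K : ℝ} (hρ : 0 < ρ) (hρ1 : ρ ≤ 1) (hc : (d / n : ℝ) ≤ c) {g : Euc d → ℝ}
    (hg : HolderBound ρ K 1 g) (θ : Euc d) :
    ∫ z, (g (θ + hatθ z) - g θ) ^ 2 ∂ noiseSample V n ≤
      4 * subgaussianMomentConst 1 * M / m ^ 2 * K ^ 2 / n +
      2 * (linearizationConst L m c * K) ^ 2 * deviationConst M * (√(d / n) ^ (1 + ρ)) ^ 2 := by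
  have := h.isProbabilityMeasure_noiseSample n
  have hM := h.M_pos
  have hm := h.m_pos
  have hn' : (0 : ℝ) < n := by exact_mod_cast hn
  have hs := one_le_subgaussianMomentConst 1
  obtain ⟨v, hvK, hv⟩ := h.exists_linearization hn hθ hρ hρ1 hc hg θ
  obtain ⟨i, j⟩ := h.integral_one_add_deviation_sq_le (n := n) hn
  have i2 := (h.integrable_inner_score n v).2
  have i3 := i2.const_mul (2 / (n : ℝ) ^ 2)
  have i4 := i.const_mul (2 * (linearizationConst L m c * K * √(d / n) ^ (1 + ρ)) ^ 2)
  refine (integral_mono_of_nonneg (.of_forall fun z => sq_nonneg _) (i3.fun_add i4)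
    (.of_forall fun z => ?_)).trans ?_
  · dsimp only
    have h1 := sq_le_sq' (neg_le_of_abs_le (hv z)) (le_of_abs_le (hv z))
    have e : 2 / (n : ℝ) ^ 2 * ⟪score V z 0, v⟫ ^ 2 = 2 * (⟪score V z 0, v⟫ / n) ^ 2 := by
      rw [div_pow]; ring
    rw [e]
    rw [mul_pow] at h1
    nlinarith only [h1, sq_nonneg (g (θ + hatθ z) - g θ - 2 * (⟪score V z 0, v⟫ / n))]
  · rw [integral_add i3 i4, integral_const_mul, integral_const_mul]
    refine add_le_add ?_ ?_
    · have h1 := h.integral_inner_score_sq_le n v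
      have h2 : ‖v‖ ^ 2 ≤ (K / m) ^ 2 := by gcongr
      have h3 : 2 * M * n * ‖v‖ ^ 2 ≤ 2 * M * n * (K / m) ^ 2 := by gcongr
      have h4 := h1.trans (mul_le_mul_of_nonneg_left h3 (by positivity))
      refine (mul_le_mul_of_nonneg_left h4 (by positivity)).trans (le_of_eq ?_)
      field_simp
      ring
    · refine (mul_le_mul_of_nonneg_left j (by positivity)).trans (le_of_eq ?_)
      ring

end IsRegularPotential

theorem HolderBound.neg_one_pow_mul {E : Type} [NormedAddCommGroup E] [NormedSpace ℝ E]
    {ρ B : ℝ} {l : ℕ} {g : E → ℝ} (h : HolderBound ρ B l g) (j : ℕ) :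
    HolderBound ρ B l (fun x => (-1 : ℝ) ^ j * g x) := by
  rcases neg_one_pow_eq_or ℝ j with e | e
  · simpa only [e, one_mul] using h
  · simpa only [e, neg_one_mul] using h.neg

theorem biasCorrect_zero {d : ℕ} (V : Euc d → ℝ) (n : ℕ) (hatθ : (Fin n → Euc d) → Euc d)
    (f : Euc d → ℝ) : biasCorrect V n hatθ 0 f = f := by
  ext x
  simp [biasCorrect]

theorem biasCorrect_succ {d : ℕ} (V : Euc d → ℝ) (n : ℕ) (hatθ : (Fin n → Euc d) → Euc d) (k : ℕ)
    (f : Euc d → ℝ) : biasCorrect V n hatθ (k + 1) f = fun x =>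
      biasCorrect V n hatθ k f x + (-1 : ℝ) ^ (k + 1) * (Bop V n hatθ)^[k + 1] f x := by
  ext x
  rw [biasCorrect, Finset.sum_range_succ, biasCorrect]

/-- A bound `a / n + b * r ^ 2` on a square that is also at most `D ^ 2`. -/
theorem sqrt_le_mul_min_max {X A B D r : ℝ} {n : ℕ} (hr : 0 ≤ r) (hD : 0 ≤ D)
    (h1 : X ≤ A / n + B * r ^ 2) (h2 : X ≤ D ^ 2) :
    √X ≤ (√(|A| + |B|) + D) * min (max (1 / √n) r) 1 := by
  have hs := Real.sqrt_nonneg (|A| + |B|)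
  have hM : 0 ≤ max (1 / √n) r := hr.trans (le_max_right _ _)
  rcases min_cases (max (1 / √n) r) 1 with ⟨e, _⟩ | ⟨e, _⟩
  · rw [e]
    refine le_trans ?_ (mul_le_mul_of_nonneg_right (le_add_of_nonneg_right hD) hM)
    refine Real.sqrt_le_iff.2 ⟨by positivity, ?_⟩
    rw [mul_pow, Real.sq_sqrt (by positivity), add_mul]
    refine h1.trans (add_le_add ?_ ?_)
    · have : 1 / (n : ℝ) ≤ max (1 / √n) r ^ 2 := by
        have := pow_le_pow_left₀ (by positivity) (le_max_left (1 / √(n : ℝ)) r) 2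
        rwa [div_pow, one_pow, Real.sq_sqrt (Nat.cast_nonneg n)] at this
      calc A / n = A * (1 / n) := by ring
        _ ≤ |A| * (1 / n) := mul_le_mul_of_nonneg_right (le_abs_self A) (by positivity)
        _ ≤ _ := mul_le_mul_of_nonneg_left this (abs_nonneg A)
    · calc B * r ^ 2 ≤ |B| * r ^ 2 := mul_le_mul_of_nonneg_right (le_abs_self B) (by positivity)
        _ ≤ _ := mul_le_mul_of_nonneg_left
          (pow_le_pow_left₀ hr (le_max_right _ _) 2) (abs_nonneg B)
  · rw [e, mul_one]
    refine ((Real.sqrt_le_sqrt h2).trans_eq (Real.sqrt_sq hD)).trans ?_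
    linarith

/-- The factor in front of `√(d / n)` in the bound for the mean of `min ‖θ̂ - θ‖ 1`. -/
def errorConst (L M m c : ℝ) : ℝ := (4 / m + (1 + c) * badDeviationConst L m) * deviationConst M

namespace IsRegularPotential

variable {L M m : ℝ} {d n : ℕ} {V : Euc d → ℝ} {hatθ : (Fin n → Euc d) → Euc d}

theorem Bop_eq (h : IsRegularPotential L M m V) (hn : 0 < n) (hθ : IsMLE V hatθ)
    (g : Euc d → ℝ) :
    Bop V n hatθ g = fun θ => shiftMean (noiseSample V n) hatθ g θ - g θ := by
  ext θ
  rw [Bop, h.Texp_eq hn hθ, shiftMean]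

theorem holderBound_iterate_Bop (h : IsRegularPotential L M m V) (hn : 0 < n)
    (hθ : IsMLE V hatθ) {ρ B : ℝ} (hρ : 0 < ρ) {l : ℕ} {f : Euc d → ℝ}
    (hf : HolderBound ρ B l f) (j : ℕ) : HolderBound ρ (2 ^ j * B) l ((Bop V n hatθ)^[j] f) := by
  have := h.isProbabilityMeasure_noiseSample n
  induction j with
  | zero => simpa using hf
  | succ j ih =>
    rw [Function.iterate_succ_apply', h.Bop_eq hn hθ]
    have := (ih.shiftMean hρ (P := noiseSample V n) (h.continuous_estimator hn hθ)).add ih.neg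
    rw [pow_succ, mul_two, add_mul]
    simpa only [sub_eq_add_neg] using this

theorem holderBound_iterate_Bop_of_add (h : IsRegularPotential L M m V) (hn : 0 < n)
    (hθ : IsMLE V hatθ) {ρ B : ℝ} (hρ : 0 < ρ) (hρ1 : ρ ≤ 1) {f : Euc d → ℝ} (j : ℕ) :
    ∀ l : ℕ, HolderBound ρ B (l + j) f →
      HolderBound ρ ((4 * ∫ z, min ‖hatθ z‖ 1 ∂ noiseSample V n) ^ j * B) l
        ((Bop V n hatθ)^[j] f) := by
  have := h.isProbabilityMeasure_noiseSample n
  induction j with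
  | zero => intro l hf; simpa using hf
  | succ j ih =>
    intro l hf
    rw [Function.iterate_succ_apply', h.Bop_eq hn hθ, pow_succ', mul_assoc]
    exact (ih (l + 1) (by rwa [add_assoc, add_comm 1 j])).shiftMean_sub hρ hρ1
      (h.continuous_estimator hn hθ)

theorem holderBound_biasCorrect (h : IsRegularPotential L M m V) (hn : 0 < n)
    (hθ : IsMLE V hatθ) {ρ B : ℝ} (hρ : 0 < ρ) {l : ℕ} {f : Euc d → ℝ}
    (hf : HolderBound ρ B l f) (k : ℕ) :
    HolderBound ρ (2 ^ (k + 1) * B) l (biasCorrect V n hatθ k f) := by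
  induction k with
  | zero =>
    rw [biasCorrect_zero]
    exact hf.mono (by rw [zero_add, pow_one]; linarith [hf.nonneg])
  | succ k ih =>
    have := ih.add ((h.holderBound_iterate_Bop hn hθ hρ hf (k + 1)).neg_one_pow_mul (k + 1))
    rw [biasCorrect_succ, pow_succ (2 : ℝ) (k + 1), mul_two, add_mul]
    exact this

theorem integral_biasCorrect (h : IsRegularPotential L M m V) (hn : 0 < n) (hθ : IsMLE V hatθ)
    {ρ B : ℝ} (hρ : 0 < ρ) {l : ℕ} {f : Euc d → ℝ} (hf : HolderBound ρ B l f) (θ : Euc d)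
    (k : ℕ) :
    ∫ z, biasCorrect V n hatθ k f (θ + hatθ z) ∂ noiseSample V n =
      f θ + (-1 : ℝ) ^ k * (Bop V n hatθ)^[k + 1] f θ := by
  have := h.isProbabilityMeasure_noiseSample n
  have hc := h.continuous_estimator hn hθ
  have hB : ∀ g : Euc d → ℝ, ∫ z, g (θ + hatθ z) ∂ noiseSample V n = g θ + Bop V n hatθ g θ :=
    fun g => by
      rw [h.Bop_eq hn hθ]
      simp only [shiftMean]
      ring
  induction k with
  | zero => simp only [biasCorrect_zero, hB, pow_zero, one_mul, Function.iterate_one, zero_add]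
  | succ k ih =>
    have i1 := (h.holderBound_biasCorrect hn hθ hρ hf k).integrable hρ (P := noiseSample V n) hc θ
    have i2 := (h.holderBound_iterate_Bop hn hθ hρ hf (k + 1)).integrable hρ
      (P := noiseSample V n) hc θ
    rw [biasCorrect_succ]
    dsimp only
    rw [integral_add i1 (i2.const_mul _), integral_const_mul, ih, hB,
      Function.iterate_succ_apply' _ (k + 1)]
    ring

/-- The bias of the bias-corrected estimator. -/
theorem abs_integral_biasCorrect_sub_le (h : IsRegularPotential L M m V) (hn : 0 < n)
    (hθ : IsMLE V hatθ) {c ρ : ℝ} (hρ : 0 < ρ) (hρ1 : ρ ≤ 1) (hc : (d / n : ℝ) ≤ c) {k : ℕ}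
    {f : Euc d → ℝ} (hf : HolderBound ρ 1 (k + 1) f) (θ : Euc d) :
    |∫ z, biasCorrect V n hatθ k f (θ + hatθ z) ∂ noiseSample V n - f θ| ≤
      linearizationConst L m c * deviationConst M * (4 * errorConst L M m c) ^ k *
        √(d / n) ^ ((k : ℝ) + 1 + ρ) := by
  set δ := ∫ z, min ‖hatθ z‖ 1 ∂ noiseSample V n with hδ
  have hδ0 : 0 ≤ δ := integral_nonneg fun z => by positivity
  have hδ1 : δ ≤ errorConst L M m c * √(d / n) := h.integral_min_norm_estimator_le hn hθ hc
  have hC := h.one_le_linearizationConst (c := c) (le_trans (by positivity) hc)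
  have hdev : 0 ≤ deviationConst M := (integral_nonneg fun z => sq_nonneg _).trans
    (h.integral_one_add_deviation_sq_le hn).2
  have h1 := h.holderBound_iterate_Bop_of_add hn hθ hρ hρ1 k 1 (by rwa [add_comm 1 k])
  have h2 := h.abs_integral_sub_le hn hθ hρ hρ1 hc h1 θ
  rw [h.integral_biasCorrect hn hθ hρ hf, add_sub_cancel_left, abs_mul, abs_pow, abs_neg, abs_one,
    one_pow, one_mul, Function.iterate_succ_apply', h.Bop_eq hn hθ]
  refine h2.trans ?_
  have e : √(d / n : ℝ) ^ ((k : ℝ) + 1 + ρ) = √(d / n) ^ k * √(d / n) ^ (1 + ρ) := by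
    rw [add_assoc, Real.rpow_add_of_nonneg (Real.sqrt_nonneg _) (by positivity) (by positivity),
      Real.rpow_natCast]
  have h3 : (4 * δ) ^ k ≤ (4 * errorConst L M m c) ^ k * √(d / n) ^ k := by
    rw [← mul_pow]
    exact pow_le_pow_left₀ (by positivity) (by linarith) k
  rw [e, mul_one]
  calc _ = linearizationConst L m c * deviationConst M * √(d / n) ^ (1 + ρ) * (4 * δ) ^ k := by
        rw [← hδ]; ring
    _ ≤ _ := mul_le_mul_of_nonneg_left h3 (by positivity)
    _ = _ := by ring

theorem exists_integral_biasCorrect_sub_sq_le {ρ α c : ℝ} (L M m : ℝ) (hρ : 0 < ρ) (hρ1 : ρ ≤ 1)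
    (hα : α < 1) (hc0 : 0 < c) (k : ℕ) :
    ∃ A B : ℝ, ∀ (d n : ℕ) (V : Euc d → ℝ) (hatθ : (Fin n → Euc d) → Euc d),
      IsRegularPotential L M m V → 0 < n → IsMLE V hatθ → (d : ℝ) ≤ c * (n : ℝ) ^ α →
      ∀ f : Euc d → ℝ, HolderBound ρ 1 (k + 1) f → ∀ θ,
        ∫ z, (biasCorrect V n hatθ k f (θ + hatθ z) - f θ) ^ 2 ∂ noiseSample V n ≤
          A / n + B * (√(d / n) ^ ((k : ℝ) + 1 + ρ)) ^ 2 := by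
  have hle : ∀ d n : ℕ, 0 < n → (d : ℝ) ≤ c * (n : ℝ) ^ α → (d / n : ℝ) ≤ c := by
    intro d n hn hd
    have hn' : (0 : ℝ) < n := by exact_mod_cast hn
    have hn1 : (1 : ℝ) ≤ n := by exact_mod_cast hn
    rw [div_le_iff₀ hn']
    refine hd.trans (mul_le_mul_of_nonneg_left ?_ hc0.le)
    simpa using Real.rpow_le_rpow_of_exponent_le hn1 hα.le
  rcases k with _ | k
  · refine ⟨4 * subgaussianMomentConst 1 * M / m ^ 2,
      2 * linearizationConst L m c ^ 2 * deviationConst M, ?_⟩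
    intro d n V hatθ h hn hθ hd f hf θ
    rw [biasCorrect_zero]
    have := h.integral_sub_sq_le hn hθ hρ hρ1 (hle d n hn hd) hf θ
    simpa using this
  · obtain ⟨p, hp⟩ := exists_nat_ge (2 / (1 - α))
    refine ⟨varianceConst L M m p c * (2 ^ (k + 1 + 1) * 1) ^ 2,
      (linearizationConst L m c * deviationConst M * (4 * errorConst L M m c) ^ (k + 1)) ^ 2, ?_⟩
    intro d n V hatθ h hn hθ hd f hf θ
    have := h.isProbabilityMeasure_noiseSample n
    have hp' : 2 ≤ (1 - α) * p := by
      rwa [div_le_iff₀ (by linarith), mul_comm] at hp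
    have hfk := h.holderBound_biasCorrect hn hθ hρ hf (k + 1)
    have hv := h.variance_le hn hθ (hle d n hn hd) (div_pow_le_of_le_rpow hn hp' hd)
      hfk.hasExpansion θ
    have hb := h.abs_integral_biasCorrect_sub_le hn hθ hρ hρ1 (hle d n hn hd) hf θ
    have hm := h.measurable_comp_estimator hn hθ (hfk.continuous hρ) θ
    have e := fun b : ℝ => (sq_integral_sub_le (noiseSample V n) hm
      (fun z => hfk.norm_le (θ + hatθ z)) b).2
    rw [e] at hv ⊢
    have hb2 := sq_le_sq' (neg_le_of_abs_le hb) (le_of_abs_le hb)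
    rw [mul_pow] at hb2
    linarith

end IsRegularPotential

/-- Proposition 2.4, part 2: minimax upper bound for `f_k(θ̂)` over the unit
ball of `C^s`, `s = k+1+ρ`, when `‖Σ‖ ≤ c₀` and `d ≤ c₁ n^α`. -/
theorem stmt_3 :
    ∀ (L M m ρ α c0 c1 : ℝ) (k : ℕ),
      0 < L → 0 < M → 0 < m → 0 < ρ → ρ ≤ 1 → 0 < α → α < 1 → 0 < c0 → 0 < c1 →
      ∃ C : ℝ, 0 < C ∧
        ∀ (d n : ℕ) (V : Euc d → ℝ) (J Jinv : Euc d →L[ℝ] Euc d)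
          (hatθ : (Fin n → Euc d) → Euc d),
          0 < n →
          StrictConvexOn ℝ Set.univ V →
          ContDiff ℝ 2 V →
          (∫ x, Real.exp (-(V x)) = 1) →
          (∀ x, ‖iteratedFDeriv ℝ 2 V x‖ ≤ M) →
          (∀ x y, ‖iteratedFDeriv ℝ 2 V x - iteratedFDeriv ℝ 2 V y‖ ≤ L * ‖x - y‖) →
          (∀ u, J u = ∫ x, ⟪gradient V x, u⟫ • gradient V x ∂ noiseMeasure V) →
          (∀ u : Euc d, m * ‖u‖ ^ 2 ≤ ⟪J u, u⟫) →
          (∀ u, J (Jinv u) = u) →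
          (∀ u, Jinv (J u) = u) →
          (∀ (x : Fin n → Euc d) (θ' : Euc d),
            ∑ j, V (x j - hatθ x) ≤ ∑ j, V (x j - θ')) →
          -- the covariance operator `Σ` of `ξ` satisfies `‖Σ‖ ≤ c₀`
          (∀ u : Euc d,
            ∫ x, ⟪x - ∫ y, y ∂ noiseMeasure V, u⟫ ^ 2 ∂ noiseMeasure V ≤ c0 * ‖u‖ ^ 2) →
          -- `d ≤ c₁ n^α`
          (d : ℝ) ≤ c1 * (n : ℝ) ^ α →
          ∀ f : Euc d → ℝ, holderCLe (k + 1) ρ f 1 →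
            ∀ θ : Euc d,
              Real.sqrt (∫ x, (biasCorrect V n hatθ k f (hatθ x) - f θ) ^ 2
                  ∂ sampleMeasure V n θ) ≤
                C * min (max (1 / Real.sqrt n)
                  (Real.sqrt ((d : ℝ) / n) ^ ((k : ℝ) + 1 + ρ))) 1 := by
  intro L M m ρ α c0 c1 k hL hM hm hρ hρ1 _ hα _ hc1
  obtain ⟨A, B, hAB⟩ :=
    IsRegularPotential.exists_integral_biasCorrect_sub_sq_le L M m hρ hρ1 hα hc1 k
  refine ⟨√(|A| + |B|) + (2 ^ (k + 1) + 1), by positivity, ?_⟩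
  intro d n V J Jinv hatθ hn hconv hcd h_int hbd hlip hJ hfish _ _ hθ _ hd f hf θ
  have h : IsRegularPotential L M m V :=
    ⟨hL, hM, hm, hconv, hcd, h_int, hbd, hlip, fun u => hJ u ▸ hfish u⟩
  have hf' : HolderBound ρ 1 (k + 1) f := HolderBound.of_iteratedFDeriv _ hf.1 hf.2.1 hf.2.2
  have := h.isProbabilityMeasure_noiseSample n
  rw [h.integral_sampleMeasure]
  simp only [h.estimator_add hn hθ]
  refine sqrt_le_mul_min_max (by positivity) (by positivity)
    (hAB d n V hatθ h hn hθ hd f hf' θ) ?_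
  have hle : ∀ z, (biasCorrect V n hatθ k f (θ + hatθ z) - f θ) ^ 2 ≤
      (2 ^ (k + 1) + 1 : ℝ) ^ 2 := fun z => by
    have h1 := (h.holderBound_biasCorrect hn hθ hρ hf' k).norm_le (θ + hatθ z)
    have h2 := hf'.norm_le θ
    rw [Real.norm_eq_abs] at h1 h2
    rw [mul_one] at h1
    have h3 := (abs_sub _ _).trans (add_le_add h1 h2)
    exact sq_le_sq' (neg_le_of_abs_le h3) (le_of_abs_le h3)
  have := integral_mono_of_nonneg (μ := noiseSample V n) (.of_forall fun z => sq_nonneg _)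
    (integrable_const _) (.of_forall hle)
  simpa using this
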